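/- Let A > 0, a > 0, T > 0, and let c > 0. Let ρ and ρ_n (n ∈ ℕ) be solutions of the polar flow equation ρ_t = ρ_θθ/(ρ² + ρ_θ²) − (2ρ_θ² + ρ²)/(ρ(ρ_θ² + ρ²)) + (A/ρ)√(ρ_θ² + ρ²) on (0,π) × (0,T), each continuous on [0,π] × [0,T) and with continuous ρ_θ, ρ_θθ, ρ_t on [0,π] × (0,T), each positive, and each satisfying the boundary conditions ρ(0,t) = ρ(π,t) = a and ρ_n(0,t) = ρ_n(π,t) = a. Assume ρ(θ,t) ≥ c for all (θ,t). If ‖ρ_n(·,0) − ρ(·,0)‖_{C¹([0,π])} → 0 as n → ∞, then for every t ∈ (0,T), ‖ρ_n(·,t) − ρ(·,t)‖_{C²([0,π])} → 0 as n → ∞. -/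

import Mathlib

open Set

/-- first touching time -/
theorem first_touch {E : Type*} [TopologicalSpace E] {K : Set E} (hK : IsCompact K)
    (f : E → ℝ → ℝ) (t1 t2 : ℝ)
    (hf : ContinuousOn (fun z : E × ℝ => f z.1 z.2) (K ×ˢ Icc t1 t2))
    (h0 : ∀ x ∈ K, f x t1 < 0)
    (hkey : ∀ x ∈ K, ∀ t ∈ Ioc t1 t2, f x t = 0 → (∀ y ∈ K, f y t ≤ 0) →
      (∀ s ∈ Ico t1 t, f x s < 0) → False) :
    ∀ x ∈ K, ∀ t ∈ Icc t1 t2, f x t < 0 := by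
  by_contra hcon
  push Not at hcon
  obtain ⟨x0, hx0, t0, ht0, hf0⟩ := hcon
  have hKc : IsCompact (K ×ˢ Icc t1 t2) := hK.prod isCompact_Icc
  -- the set of nonnegative points
  obtain ⟨Z, hZne, hZc, hZ⟩ : ∃ Z : Set (E × ℝ), Z.Nonempty ∧ IsCompact Z ∧
      ∀ z, z ∈ Z ↔ (z.1 ∈ K ∧ z.2 ∈ Icc t1 t2 ∧ 0 ≤ f z.1 z.2) := by
    refine ⟨(K ×ˢ Icc t1 t2) ∩ (fun z : E × ℝ => f z.1 z.2) ⁻¹' Ici 0, ⟨(x0, t0), ?_⟩, ?_, ?_⟩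
    · exact ⟨⟨hx0, ht0⟩, hf0⟩
    · obtain ⟨u, hu, hu2⟩ := (continuousOn_iff_isClosed.1 hf) (Ici 0) isClosed_Ici
      rw [inter_comm, hu2, inter_comm]
      exact hKc.inter_right hu
    · intro z
      simp only [mem_inter_iff, mem_prod, mem_preimage, mem_Ici]
      tauto
  obtain ⟨z, hzZ, hzmin⟩ := hZc.exists_isMinOn hZne continuous_snd.continuousOn
  obtain ⟨hz1, hz2, hz3⟩ := (hZ z).1 hzZ
  have hlt : t1 < z.2 := by
    rcases eq_or_lt_of_le hz2.1 with h | h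
    · exfalso
      have := h0 z.1 hz1
      rw [h] at this
      linarith
    · exact h
  have hbefore : ∀ y ∈ K, ∀ s ∈ Ico t1 z.2, f y s < 0 := by
    intro y hy s hs
    by_contra hh
    push Not at hh
    have := hzmin ((hZ (y, s)).2 ⟨hy, ⟨hs.1, hs.2.le.trans hz2.2⟩, hh⟩)
    simp only [mem_ofPred_eq] at this
    linarith [hs.2]
  have hat : ∀ y ∈ K, f y z.2 ≤ 0 := by
    intro y hy
    have hc : ContinuousWithinAt (fun s => f y s) (Icc t1 z.2) z.2 := by
      have h1 : ContinuousOn (fun s => f y s) (Icc t1 t2) :=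
        hf.comp (f := fun s => (y, s)) (by fun_prop) (fun s hs => ⟨hy, hs⟩)
      exact (h1 z.2 hz2).mono (Icc_subset_Icc le_rfl hz2.2)
    have hc2 : ContinuousWithinAt (fun s => f y s) (Ico t1 z.2) z.2 := hc.mono Ico_subset_Icc_self
    have : z.2 ∈ closure (Ico t1 z.2) := by
      rw [closure_Ico hlt.ne]
      exact ⟨hlt.le, le_rfl⟩
    have hne : (nhdsWithin z.2 (Ico t1 z.2)).NeBot := mem_closure_iff_nhdsWithin_neBot.1 this
    refine le_of_tendsto hc2 ?_
    filter_upwards [self_mem_nhdsWithin] with s hs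
    exact (hbefore y hy s hs).le
  exact hkey z.1 hz1 z.2 ⟨hlt, hz2.2⟩ (le_antisymm (hat _ hz1) hz3) hat (hbefore z.1 hz1)

theorem second_test (g g1 : ℝ → ℝ) (x0 g2 : ℝ) (hm : IsLocalMax g x0)
    (hd : ∀ᶠ x in nhds x0, HasDerivAt g (g1 x) x) (hd2 : HasDerivAt g1 g2 x0) :
    g1 x0 = 0 ∧ g2 ≤ 0 := by
  have h0 : HasDerivAt g (g1 x0) x0 := hd.self_of_nhds
  have h1 : g1 x0 = 0 := hm.hasDerivAt_eq_zero h0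
  refine ⟨h1, ?_⟩
  by_contra hcon
  push Not at hcon
  have he : deriv g =ᶠ[nhds x0] g1 := by
    filter_upwards [hd] with x hx using hx.deriv
  have hdd : deriv (deriv g) x0 = g2 := by
    rw [he.deriv_eq, hd2.deriv]
  have hmin : IsLocalMin g x0 :=
    isLocalMin_of_deriv_deriv_pos (by rw [hdd]; exact hcon) (by rw [h0.deriv, h1]) h0.continuousAt
  have hconst : g =ᶠ[nhds x0] fun _ => g x0 := by
    filter_upwards [hm, hmin] with x a b using le_antisymm a b
  have h3 : deriv g =ᶠ[nhds x0] fun _ => 0 := by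
    have := hconst.eventuallyEq_nhds
    filter_upwards [this] with x hx
    rw [hx.deriv_eq]; simp
  rw [h3.deriv_eq] at hdd
  simp at hdd
  linarith

/-- a function increasing to its value at t from the left has nonneg derivative -/
theorem deriv_nonneg_of_left (g : ℝ → ℝ) (g' t1 t : ℝ) (ht : t1 < t) (h : HasDerivAt g g' t)
    (h0 : g t = 0) (hl : ∀ s ∈ Ico t1 t, g s < 0) : 0 ≤ g' := by
  by_contra hcon
  push Not at hcon
  have h1 : Filter.Tendsto (slope g t) (nhdsWithin t (Iio t)) (nhds g') :=
    (hasDerivAt_iff_tendsto_slope.1 h).mono_left (nhdsWithin_mono _ (fun x hx => ne_of_lt hx))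
  have h2 : 0 ≤ g' := by
    refine ge_of_tendsto h1 ?_
    have : Ioo t1 t ∈ nhdsWithin t (Iio t) := Ioo_mem_nhdsLT ht
    filter_upwards [this] with s hs
    rw [slope_def_field, h0]
    have := hl s ⟨hs.1.le, hs.2⟩
    exact div_nonneg_of_nonpos (by linarith) (by linarith [hs.2])
  linarith

/-- slices of jointly continuous functions -/
theorem slice_cont {f : ℝ → ℝ → ℝ} {X Y : Set ℝ}
    (hf : ContinuousOn (fun z : ℝ × ℝ => f z.1 z.2) (X ×ˢ Y)) {t : ℝ} (ht : t ∈ Y) :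
    ContinuousOn (fun θ => f θ t) X :=
  hf.comp (f := fun θ => (θ, t)) (by fun_prop) (fun θ hθ => ⟨hθ, ht⟩)

theorem slice_int {f : ℝ → ℝ} (hf : ContinuousOn f (Icc 0 Real.pi)) :
    IntervalIntegrable f MeasureTheory.volume 0 Real.pi := by
  apply ContinuousOn.intervalIntegrable
  rwa [uIcc_of_le Real.pi_pos.le]

theorem joint_bdd {f : ℝ → ℝ → ℝ} {Y : Set ℝ}
    (hf : ContinuousOn (fun z : ℝ × ℝ => f z.1 z.2) (Icc 0 Real.pi ×ˢ Y)) {s0 s1 : ℝ}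
    (h : Icc s0 s1 ⊆ Y) : ∃ C : ℝ, 0 < C ∧ ∀ θ ∈ Icc 0 Real.pi, ∀ t ∈ Icc s0 s1, |f θ t| ≤ C := by
  obtain ⟨C, hC⟩ := (isCompact_Icc.prod isCompact_Icc).exists_bound_of_continuousOn
    (hf.mono (prod_mono_right h))
  refine ⟨max C 1, by positivity, fun θ hθ t ht => ?_⟩
  exact (hC (θ, t) ⟨hθ, ht⟩).trans (le_max_left _ _)

theorem diff_under {f g : ℝ → ℝ → ℝ} {s0 s1 : ℝ}
    (hf : ContinuousOn (fun z : ℝ × ℝ => f z.1 z.2) (Icc 0 Real.pi ×ˢ Ioo s0 s1))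
    (hg : ContinuousOn (fun z : ℝ × ℝ => g z.1 z.2) (Icc 0 Real.pi ×ˢ Ioo s0 s1))
    (hd : ∀ θ ∈ Icc 0 Real.pi, ∀ t ∈ Ioo s0 s1, HasDerivAt (fun τ => f θ τ) (g θ t) t)
    {t : ℝ} (ht : t ∈ Ioo s0 s1) :
    HasDerivAt (fun τ => ∫ θ in (0:ℝ)..Real.pi, f θ τ) (∫ θ in (0:ℝ)..Real.pi, g θ t) t := by
  obtain ⟨b0, hb0, hb0'⟩ := exists_between ht.1
  obtain ⟨b1, hb1, hb1'⟩ := exists_between ht.2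
  have hsub : Icc b0 b1 ⊆ Ioo s0 s1 := fun x hx => ⟨hb0.trans_le hx.1, hx.2.trans_lt hb1'⟩
  obtain ⟨C, hC0, hC⟩ := joint_bdd hg hsub
  have hI : uIoc 0 Real.pi ⊆ Icc 0 Real.pi := by
    rw [uIoc_of_le Real.pi_pos.le]; exact Ioc_subset_Icc_self
  have hnb : Icc b0 b1 ∈ nhds t := Icc_mem_nhds hb0' hb1
  refine (intervalIntegral.hasDerivAt_integral_of_dominated_loc_of_deriv_le
    (F := fun τ θ => f θ τ) (F' := fun τ θ => g θ τ) (bound := fun _ => C) hnb ?_ ?_ ?_ ?_ ?_ ?_).2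
  · filter_upwards [hnb] with τ hτ
    exact (slice_int (slice_cont hf (hsub hτ))).def'.aestronglyMeasurable
  · exact slice_int (slice_cont hf ht)
  · exact (slice_int (slice_cont hg ht)).def'.aestronglyMeasurable
  · filter_upwards with θ hθ τ hτ
    exact hC θ (hI hθ) τ hτ
  · simp
  · filter_upwards with θ hθ τ hτ
    exact hd θ (hI hθ) τ (hsub hτ)

theorem ftc (W W' : ℝ → ℝ) (hW : ∀ θ ∈ Icc 0 Real.pi, HasDerivWithinAt W (W' θ) (Icc 0 Real.pi) θ)
    (hc : ContinuousOn W' (Icc 0 Real.pi)) {x y : ℝ} (hx : x ∈ Icc 0 Real.pi)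
    (hy : y ∈ Icc 0 Real.pi) (hxy : x ≤ y) : ∫ θ in x..y, W' θ = W y - W x := by
  have hsub : Icc x y ⊆ Icc 0 Real.pi := Icc_subset_Icc hx.1 hy.2
  apply intervalIntegral.integral_eq_sub_of_hasDerivAt_of_le hxy
  · exact fun θ hθ => (hW θ (hsub hθ)).continuousWithinAt.mono hsub
  · intro θ hθ
    have h1 : θ ∈ Icc 0 Real.pi := hsub (Ioo_subset_Icc_self hθ)
    exact (hW θ h1).hasDerivAt (Icc_mem_nhds (hx.1.trans_lt hθ.1) (hθ.2.trans_le hy.2))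
  · apply ContinuousOn.intervalIntegrable
    rw [uIcc_of_le hxy]
    exact hc.mono hsub

theorem ftc_full (W W' : ℝ → ℝ) (hW : ∀ θ ∈ Icc 0 Real.pi, HasDerivWithinAt W (W' θ) (Icc 0 Real.pi) θ)
    (hc : ContinuousOn W' (Icc 0 Real.pi)) : ∫ θ in (0:ℝ)..Real.pi, W' θ = W Real.pi - W 0 :=
  ftc W W' hW hc ⟨le_rfl, Real.pi_pos.le⟩ ⟨Real.pi_pos.le, le_rfl⟩ Real.pi_pos.le

theorem energy_deriv {f g k w : ℝ → ℝ → ℝ} {s0 s1 b0 b1 : ℝ}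
    (hg : ContinuousOn (fun z : ℝ × ℝ => g z.1 z.2) (Icc 0 Real.pi ×ˢ Ioo s0 s1))
    (hk : ContinuousOn (fun z : ℝ × ℝ => k z.1 z.2) (Icc 0 Real.pi ×ˢ Ioo s0 s1))
    (hw : ContinuousOn (fun z : ℝ × ℝ => w z.1 z.2) (Icc 0 Real.pi ×ˢ Ioo s0 s1))
    (hdf : ∀ θ ∈ Icc 0 Real.pi, ∀ t ∈ Ioo s0 s1,
      HasDerivWithinAt (fun φ => f φ t) (g θ t) (Icc 0 Real.pi) θ)
    (hdg : ∀ θ ∈ Icc 0 Real.pi, ∀ t ∈ Ioo s0 s1,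
      HasDerivWithinAt (fun φ => g φ t) (k θ t) (Icc 0 Real.pi) θ)
    (hdt : ∀ θ ∈ Icc 0 Real.pi, ∀ t ∈ Ioo s0 s1, HasDerivAt (fun τ => f θ τ) (w θ t) t)
    (h0 : ∀ t ∈ Ioo s0 s1, f 0 t = b0) (h1 : ∀ t ∈ Ioo s0 s1, f Real.pi t = b1)
    {t : ℝ} (ht : t ∈ Ioo s0 s1) :
    HasDerivAt (fun τ => ∫ θ in (0:ℝ)..Real.pi, (g θ τ) ^ 2)
      (-(2 * ∫ θ in (0:ℝ)..Real.pi, k θ t * w θ t)) t := by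
  obtain ⟨c0, hc0, hc0'⟩ := exists_between ht.1
  obtain ⟨c1, hc1, hc1'⟩ := exists_between ht.2
  have hsub : Icc c0 c1 ⊆ Ioo s0 s1 := fun x hx => ⟨hc0.trans_le hx.1, hx.2.trans_lt hc1'⟩
  obtain ⟨C, hC0, hC⟩ := joint_bdd hk hsub
  obtain ⟨D, hD0, hD⟩ := joint_bdd hw hsub
  have hI : uIoc 0 Real.pi ⊆ Icc 0 Real.pi := by
    rw [uIoc_of_le Real.pi_pos.le]; exact Ioc_subset_Icc_self
  have hnb : Ioo c0 c1 ∈ nhds t := Ioo_mem_nhds hc0' hc1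
  have htc : t ∈ Icc c0 c1 := ⟨hc0'.le, hc1.le⟩
  have hfc : ∀ τ ∈ Ioo s0 s1, ContinuousOn (fun θ => f θ τ) (Icc 0 Real.pi) :=
    fun τ hτ θ hθ => (hdf θ hθ τ hτ).continuousWithinAt
  -- exact difference identity
  have hid : ∀ τ ∈ Ioo s0 s1, (∫ θ in (0:ℝ)..Real.pi, (g θ τ) ^ 2) - (∫ θ in (0:ℝ)..Real.pi, (g θ t) ^ 2)
      = ∫ θ in (0:ℝ)..Real.pi, -((k θ τ + k θ t) * (f θ τ - f θ t)) := by
    intro τ hτ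
    have gτ := slice_cont hg hτ
    have gt := slice_cont hg ht
    have kτ := slice_cont hk hτ
    have kt := slice_cont hk ht
    have fτ := hfc τ hτ
    have ft := hfc t ht
    have hW : ∀ θ ∈ Icc 0 Real.pi, HasDerivWithinAt (fun θ => (g θ τ + g θ t) * (f θ τ - f θ t))
        ((k θ τ + k θ t) * (f θ τ - f θ t) + (g θ τ + g θ t) * (g θ τ - g θ t)) (Icc 0 Real.pi) θ :=
      fun θ hθ => ((hdg θ hθ τ hτ).add (hdg θ hθ t ht)).mul ((hdf θ hθ τ hτ).sub (hdf θ hθ t ht))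
    have h := ftc_full _ _ hW (by fun_prop)
    rw [h0 τ hτ, h0 t ht, h1 τ hτ, h1 t ht] at h
    rw [← intervalIntegral.integral_sub (slice_int (by fun_prop)) (slice_int (by fun_prop))]
    rw [intervalIntegral.integral_add (slice_int (by fun_prop)) (slice_int (by fun_prop))] at h
    rw [intervalIntegral.integral_neg]
    have e : ∀ θ, (g θ τ) ^ 2 - (g θ t) ^ 2 = (g θ τ + g θ t) * (g θ τ - g θ t) := fun θ => by ring
    simp only [e]
    linarith
  rw [hasDerivAt_iff_tendsto_slope]
  have hrhs : -(2 * ∫ θ in (0:ℝ)..Real.pi, k θ t * w θ t)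
      = ∫ θ in (0:ℝ)..Real.pi, -((k θ t + k θ t) * w θ t) := by
    rw [intervalIntegral.integral_neg, ← intervalIntegral.integral_const_mul]
    congr 2; ext θ; ring
  rw [hrhs]
  have hev : ∀ᶠ τ in nhdsWithin t {t}ᶜ, τ ∈ Ioo c0 c1 ∧ τ ≠ t := by
    filter_upwards [mem_nhdsWithin_of_mem_nhds hnb, self_mem_nhdsWithin] with τ h1 h2
    exact ⟨h1, h2⟩
  have hlim : Filter.Tendsto (fun τ => ∫ θ in (0:ℝ)..Real.pi,
      -((k θ τ + k θ t) * ((f θ τ - f θ t) / (τ - t)))) (nhdsWithin t {t}ᶜ)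
      (nhds (∫ θ in (0:ℝ)..Real.pi, -((k θ t + k θ t) * w θ t))) := by
    apply intervalIntegral.tendsto_integral_filter_of_dominated_convergence (fun _ => (C + C) * D)
    · filter_upwards [hev] with τ hτ
      have hτ' : τ ∈ Ioo s0 s1 := hsub (Ioo_subset_Icc_self hτ.1)
      have kτ := slice_cont hk hτ'
      have kt := slice_cont hk ht
      have fτ := hfc τ hτ'
      have ft := hfc t ht
      exact (slice_int (by fun_prop)).def'.aestronglyMeasurable
    · filter_upwards [hev] with τ hτ
      filter_upwards with θ hθ
      have hθ' := hI hθ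
      have hτ2 := Ioo_subset_Icc_self hτ.1
      rw [norm_neg, norm_mul]
      have a1 : ‖k θ τ + k θ t‖ ≤ C + C :=
        (norm_add_le _ _).trans (add_le_add (hC θ hθ' τ hτ2) (hC θ hθ' t htc))
      have a2 : ‖(f θ τ - f θ t) / (τ - t)‖ ≤ D := by
        rw [norm_div, div_le_iff₀ (norm_pos_iff.2 (sub_ne_zero.2 hτ.2))]
        exact (convex_Icc c0 c1).norm_image_sub_le_of_norm_hasDerivWithin_le
          (f' := fun s => w θ s)
          (fun s hs => (hdt θ hθ' s (hsub hs)).hasDerivWithinAt)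
          (fun s hs => hD θ hθ' s hs) htc hτ2
      exact mul_le_mul a1 a2 (norm_nonneg _) (by positivity)
    · simp
    · filter_upwards with θ hθ
      have hθ' := hI hθ
      have kc : Filter.Tendsto (fun τ => k θ τ) (nhdsWithin t {t}ᶜ) (nhds (k θ t)) := by
        have h1 : ContinuousOn (fun τ => k θ τ) (Ioo s0 s1) :=
          hk.comp (f := fun s => (θ, s)) (by fun_prop) (fun s hs => ⟨hθ', hs⟩)
        exact ((h1.continuousAt (Ioo_mem_nhds ht.1 ht.2)).tendsto).mono_left nhdsWithin_le_nhds
      have fc := hasDerivAt_iff_tendsto_slope.1 (hdt θ hθ' t ht)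
      have fc2 : Filter.Tendsto (fun τ => (f θ τ - f θ t) / (τ - t)) (nhdsWithin t {t}ᶜ) (nhds (w θ t)) := by
        refine fc.congr (fun τ => ?_)
        rw [slope_def_field]
      exact ((kc.add tendsto_const_nhds).mul fc2).neg
  refine hlim.congr' ?_
  filter_upwards [hev] with τ hτ
  rw [slope_def_field, hid τ (hsub (Ioo_subset_Icc_self hτ.1)), div_eq_mul_inv,
    ← intervalIntegral.integral_mul_const]
  congr 1; ext θ
  rw [div_eq_mul_inv]; ring

theorem int_nonneg {f : ℝ → ℝ} (h : ∀ θ ∈ Icc 0 Real.pi, 0 ≤ f θ) :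
    0 ≤ ∫ θ in (0:ℝ)..Real.pi, f θ :=
  intervalIntegral.integral_nonneg Real.pi_pos.le h

theorem int_mono {f g : ℝ → ℝ} (hf : ContinuousOn f (Icc 0 Real.pi))
    (hg : ContinuousOn g (Icc 0 Real.pi)) (h : ∀ θ ∈ Icc 0 Real.pi, f θ ≤ g θ) :
    ∫ θ in (0:ℝ)..Real.pi, f θ ≤ ∫ θ in (0:ℝ)..Real.pi, g θ :=
  intervalIntegral.integral_mono_on Real.pi_pos.le (slice_int hf) (slice_int hg) h

theorem int_cs {f g : ℝ → ℝ} (hf : ContinuousOn f (Icc 0 Real.pi))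
    (hg : ContinuousOn g (Icc 0 Real.pi)) {x y : ℝ} (hx : 0 ≤ x) (hxy : x ≤ y) (hy : y ≤ Real.pi) :
    (∫ θ in x..y, f θ * g θ) ^ 2 ≤ (∫ θ in x..y, f θ ^ 2) * (∫ θ in x..y, g θ ^ 2) := by
  have hsub : Icc x y ⊆ Icc 0 Real.pi := Icc_subset_Icc hx hy
  have hf' := hf.mono hsub
  have hg' := hg.mono hsub
  have hitg : ∀ h : ℝ → ℝ, ContinuousOn h (Icc x y) → IntervalIntegrable h MeasureTheory.volume x y := by
    intro h hh
    apply ContinuousOn.intervalIntegrable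
    rwa [uIcc_of_le hxy]
  set X := ∫ θ in x..y, f θ ^ 2
  set Y := ∫ θ in x..y, g θ ^ 2
  set I := ∫ θ in x..y, f θ * g θ
  have key : ∀ s : ℝ, 0 ≤ Y * (s * s) + (2 * I) * s + X := by
    intro s
    have h1 : 0 ≤ ∫ θ in x..y, (f θ + s * g θ) ^ 2 :=
      intervalIntegral.integral_nonneg hxy (fun _ _ => sq_nonneg _)
    have h2 : ∫ θ in x..y, (f θ + s * g θ) ^ 2 = Y * (s * s) + (2 * I) * s + X := by
      have e : ∀ θ, (f θ + s * g θ) ^ 2 = (s * s) * g θ ^ 2 + (2 * s) * (f θ * g θ) + f θ ^ 2 :=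
        fun θ => by ring
      simp only [e]
      rw [intervalIntegral.integral_add (hitg _ (by fun_prop)) (hitg _ (by fun_prop)),
        intervalIntegral.integral_add (hitg _ (by fun_prop)) (hitg _ (by fun_prop)),
        intervalIntegral.integral_const_mul, intervalIntegral.integral_const_mul]
      ring
    linarith
  have := discrim_le_zero key
  rw [discrim] at this
  nlinarith

theorem int_sub_le {f : ℝ → ℝ} (hf : ContinuousOn f (Icc 0 Real.pi))
    (h : ∀ θ ∈ Icc 0 Real.pi, 0 ≤ f θ) {x y : ℝ} (hx : 0 ≤ x) (hxy : x ≤ y) (hy : y ≤ Real.pi) :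
    ∫ θ in x..y, f θ ≤ ∫ θ in (0:ℝ)..Real.pi, f θ := by
  apply intervalIntegral.integral_mono_interval hx hxy hy _ (slice_int hf)
  filter_upwards [MeasureTheory.ae_restrict_mem measurableSet_Ioc] with θ hθ
  exact h θ (Ioc_subset_Icc_self hθ)

/-- Hölder one half bound -/
theorem holder_half {f g : ℝ → ℝ} (hd : ∀ θ ∈ Icc 0 Real.pi, HasDerivWithinAt f (g θ) (Icc 0 Real.pi) θ)
    (hg : ContinuousOn g (Icc 0 Real.pi)) {x y : ℝ} (hx : x ∈ Icc 0 Real.pi) (hy : y ∈ Icc 0 Real.pi) :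
    (f x - f y) ^ 2 ≤ |x - y| * ∫ θ in (0:ℝ)..Real.pi, g θ ^ 2 := by
  wlog hxy : x ≤ y generalizing x y
  · have := this hy hx (le_of_not_ge hxy)
    rw [abs_sub_comm]; nlinarith
  have h1 := ftc f g hd hg hx hy hxy
  have h2 := int_cs (f := fun _ => (1:ℝ)) (g := g) continuousOn_const hg hx.1 hxy hy.2
  simp only [one_mul, one_pow, intervalIntegral.integral_const, smul_eq_mul, mul_one] at h2
  rw [h1] at h2
  have h3 := int_sub_le (f := fun θ => g θ ^ 2) (by fun_prop) (fun _ _ => sq_nonneg _) hx.1 hxy hy.2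
  rw [abs_sub_comm, abs_of_nonneg (by linarith)]
  calc (f x - f y) ^ 2 = (f y - f x) ^ 2 := by ring
    _ ≤ _ := h2
    _ ≤ _ := mul_le_mul_of_nonneg_left h3 (by linarith)

/-- Agmon inequality for a function with a zero -/
theorem agmon {f g : ℝ → ℝ} (hd : ∀ θ ∈ Icc 0 Real.pi, HasDerivWithinAt f (g θ) (Icc 0 Real.pi) θ)
    (hg : ContinuousOn g (Icc 0 Real.pi)) {x y : ℝ} (hx : x ∈ Icc 0 Real.pi) (hy : y ∈ Icc 0 Real.pi)
    (h0 : f y = 0) {η : ℝ} (hη : 0 < η) :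
    (f x) ^ 2 ≤ η * (∫ θ in (0:ℝ)..Real.pi, g θ ^ 2) + (1 / η) * ∫ θ in (0:ℝ)..Real.pi, f θ ^ 2 := by
  have hf : ContinuousOn f (Icc 0 Real.pi) := fun θ hθ => (hd θ hθ).continuousWithinAt
  have hd2 : ∀ θ ∈ Icc 0 Real.pi, HasDerivWithinAt (fun θ => f θ ^ 2) (2 * f θ * g θ) (Icc 0 Real.pi) θ := by
    intro θ hθ
    have := (hd θ hθ).fun_pow 2
    simpa using this
  have hc2 : ContinuousOn (fun θ => 2 * f θ * g θ) (Icc 0 Real.pi) := by fun_prop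
  have hpt : ∀ θ, |2 * f θ * g θ| ≤ η * g θ ^ 2 + (1 / η) * f θ ^ 2 := by
    intro θ
    have e : η * g θ ^ 2 + (1 / η) * f θ ^ 2 - 2 * (|f θ| * |g θ|) = (1 / η) * (η * |g θ| - |f θ|) ^ 2 := by
      rw [← sq_abs (g θ), ← sq_abs (f θ)]
      field_simp
      ring
    have : 0 ≤ (1 / η) * (η * |g θ| - |f θ|) ^ 2 := by positivity
    rw [abs_mul, abs_mul, abs_two]
    nlinarith
  have main : ∀ x y, x ∈ Icc 0 Real.pi → y ∈ Icc 0 Real.pi → x ≤ y →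
      |f y ^ 2 - f x ^ 2| ≤ η * (∫ θ in (0:ℝ)..Real.pi, g θ ^ 2) + (1 / η) * ∫ θ in (0:ℝ)..Real.pi, f θ ^ 2 := by
    intro x y hx hy hxy
    rw [← ftc _ _ hd2 hc2 hx hy hxy]
    refine (intervalIntegral.abs_integral_le_integral_abs hxy).trans ?_
    refine (int_sub_le (f := fun θ => |2 * f θ * g θ|) hc2.abs (fun _ _ => abs_nonneg _) hx.1 hxy hy.2).trans ?_
    refine (int_mono hc2.abs (g := fun θ => η * g θ ^ 2 + (1 / η) * f θ ^ 2) (by fun_prop) (fun θ _ => hpt θ)).trans ?_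
    rw [intervalIntegral.integral_add (slice_int (by fun_prop)) (slice_int (by fun_prop)),
        intervalIntegral.integral_const_mul, intervalIntegral.integral_const_mul]
  rcases le_total x y with h | h
  · have := main x y hx hy h
    rw [h0] at this
    have := (abs_le.1 this).1
    nlinarith
  · have := main y x hy hx h
    rw [h0] at this
    have := (abs_le.1 this).2
    nlinarith

theorem gronwall_simple {J J' : ℝ → ℝ} {C s t : ℝ} (hst : s ≤ t)
    (hc : ContinuousOn J (Icc s t)) (hd : ∀ τ ∈ Ioo s t, HasDerivAt J (J' τ) τ)
    (hle : ∀ τ ∈ Ioo s t, J' τ ≤ C * J τ) : J t ≤ Real.exp (C * (t - s)) * J s := by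
  have hanti : AntitoneOn (fun τ => Real.exp (-(C * τ)) * J τ) (Icc s t) := by
    apply antitoneOn_of_hasDerivWithinAt_nonpos (convex_Icc s t)
      (f' := fun τ => Real.exp (-(C * τ)) * (J' τ - C * J τ))
    · fun_prop
    · intro τ hτ
      rw [interior_Icc] at hτ ⊢
      have h1 : HasDerivAt (fun τ => Real.exp (-(C * τ))) (Real.exp (-(C * τ)) * (-(C * 1))) τ :=
        (((hasDerivAt_id τ).const_mul C).neg).exp
      have := (h1.mul (hd τ hτ)).hasDerivWithinAt (s := Ioo s t)
      refine this.congr_deriv ?_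
      ring
    · intro τ hτ
      rw [interior_Icc] at hτ
      have := hle τ hτ
      exact mul_nonpos_of_nonneg_of_nonpos (Real.exp_pos _).le (by linarith)
  have h := hanti ⟨le_rfl, hst⟩ ⟨hst, le_rfl⟩ hst
  simp only at h
  have e1 : Real.exp (C * (t - s)) = Real.exp (C * t) * Real.exp (-(C * s)) := by
    rw [← Real.exp_add]; ring_nf
  have e2 : Real.exp (C * t) * Real.exp (-(C * t)) = 1 := by
    rw [← Real.exp_add]; simp
  calc J t = Real.exp (C * t) * (Real.exp (-(C * t)) * J t) := by rw [← mul_assoc, e2, one_mul]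
    _ ≤ Real.exp (C * t) * (Real.exp (-(C * s)) * J s) :=
      mul_le_mul_of_nonneg_left h (Real.exp_pos _).le
    _ = _ := by rw [e1]; ring

/-- interpolation: uniformly small function with equicontinuous derivative has small derivative -/
theorem interp {f g : ℝ → ℝ} (hd : ∀ θ ∈ Icc 0 Real.pi, HasDerivWithinAt f (g θ) (Icc 0 Real.pi) θ)
    {ε δ η : ℝ} (hδ : 0 < δ) (hδ2 : δ ≤ Real.pi / 2) (hf : ∀ θ ∈ Icc 0 Real.pi, |f θ| ≤ η)
    (hg : ∀ x ∈ Icc 0 Real.pi, ∀ y ∈ Icc 0 Real.pi, |x - y| ≤ δ → |g x - g y| ≤ ε) :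
    ∀ x ∈ Icc 0 Real.pi, |g x| ≤ ε + 2 * η / δ := by
  have hfc : ContinuousOn f (Icc 0 Real.pi) := fun θ hθ => (hd θ hθ).continuousWithinAt
  have main : ∀ x y z, x ∈ Icc 0 Real.pi → y ∈ Icc 0 Real.pi → y - x = δ → z ∈ Icc x y → |g z| ≤ ε + 2 * η / δ := by
    intro x y z hx hy hxy hz
    have hlt : x < y := by linarith
    obtain ⟨w, hw, hwe⟩ := exists_hasDerivAt_eq_slope f g hlt
      (hfc.mono (Icc_subset_Icc hx.1 hy.2))
      (fun θ hθ => (hd θ ⟨hx.1.trans hθ.1.le, hθ.2.le.trans hy.2⟩).hasDerivAt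
        (Icc_mem_nhds (hx.1.trans_lt hθ.1) (hθ.2.trans_le hy.2)))
    have h1 : |g w| ≤ 2 * η / δ := by
      rw [hwe, hxy, abs_div, abs_of_pos hδ]
      gcongr
      have := abs_sub (f y) (f x)
      linarith [hf x hx, hf y hy]
    have h2 := hg z ⟨hx.1.trans hz.1, hz.2.trans hy.2⟩ w ⟨hx.1.trans hw.1.le, hw.2.le.trans hy.2⟩
      (by rw [abs_le]; constructor <;> linarith [hz.1, hz.2, hw.1, hw.2])
    have h3 : |g z| ≤ |g z - g w| + |g w| := by
      have := abs_add_le (g z - g w) (g w)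
      simpa using this
    linarith
  intro x hx
  rcases le_total x (Real.pi / 2) with h | h
  · exact main x (x + δ) x hx ⟨by linarith [hx.1], by linarith⟩ (by ring) ⟨le_rfl, by linarith⟩
  · exact main (x - δ) x x ⟨by linarith, by linarith [hx.2]⟩ hx (by ring) ⟨by linarith, le_rfl⟩

theorem mono_diff {f f' : ℝ → ℝ} {x y : ℝ} (hxy : x ≤ y) (hd : ∀ x, HasDerivAt f (f' x) x)
    (hr : ∀ z ∈ Icc x y, 0 ≤ f' z) : f x ≤ f y := by
  have hc : Continuous f := continuous_iff_continuousAt.2 (fun x => (hd x).continuousAt)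
  have : MonotoneOn f (Icc x y) := by
    apply monotoneOn_of_hasDerivWithinAt_nonneg (convex_Icc _ _) hc.continuousOn
      (f' := f') (fun x _ => (hd x).hasDerivWithinAt)
    intro z hz
    rw [interior_Icc] at hz
    exact hr z (Ioo_subset_Icc_self hz)
  exact this ⟨le_rfl, hxy⟩ ⟨hxy, le_rfl⟩ hxy

theorem vshape {f f' : ℝ → ℝ} {m M x1 x2 : ℝ} (h1 : x1 ∈ Icc m M) (h2 : x2 ∈ Icc m M)
    (hd : ∀ x, HasDerivAt f (f' x) x) (hr : ∀ x ∈ Icc m M, x2 ≤ x → 0 ≤ f' x)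
    (hl : ∀ x ∈ Icc m M, x ≤ x2 → f' x ≤ 0) : f x2 ≤ f x1 := by
  have hc : Continuous f := continuous_iff_continuousAt.2 (fun x => (hd x).continuousAt)
  rcases le_total x2 x1 with h | h
  · have : MonotoneOn f (Icc x2 x1) := by
      apply monotoneOn_of_hasDerivWithinAt_nonneg (convex_Icc _ _) hc.continuousOn
        (f' := f') (fun x _ => (hd x).hasDerivWithinAt)
      intro x hx
      rw [interior_Icc] at hx
      exact hr x ⟨h2.1.trans hx.1.le, hx.2.le.trans h1.2⟩ hx.1.le
    exact this ⟨le_rfl, h⟩ ⟨h, le_rfl⟩ h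
  · have : AntitoneOn f (Icc x1 x2) := by
      apply antitoneOn_of_hasDerivWithinAt_nonpos (convex_Icc _ _) hc.continuousOn
        (f' := f') (fun x _ => (hd x).hasDerivWithinAt)
      intro x hx
      rw [interior_Icc] at hx
      exact hl x ⟨h1.1.trans hx.1.le, hx.2.le.trans h2.2⟩ hx.2.le
    exact this ⟨le_rfl, h⟩ ⟨h, le_rfl⟩ h

noncomputable def phiF (k x : ℝ) : ℝ := Real.exp (k * x) * (k * x - 1) / k ^ 2
noncomputable def PhiF (k x : ℝ) : ℝ := (x ^ 2 * Real.exp (k * x) - 3 * phiF k x) / k ^ 2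
noncomputable def QF (k x1 x2 : ℝ) : ℝ :=
  PhiF k x1 - PhiF k x2 - phiF k x2 * ((x1 ^ 2 - x2 ^ 2) / 2)

theorem ee_deriv (k x : ℝ) : HasDerivAt (fun x => Real.exp (k * x)) (k * Real.exp (k * x)) x := by
  have := ((hasDerivAt_id x).const_mul k).exp
  simp only [id] at this
  exact this.congr_deriv (by ring)

theorem phiF_deriv {k : ℝ} (hk : 0 < k) (x : ℝ) :
    HasDerivAt (phiF k) (x * Real.exp (k * x)) x := by
  have h := ((ee_deriv k x).mul (((hasDerivAt_id x).const_mul k).sub_const 1)).div_const (k ^ 2)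
  refine h.congr_deriv ?_
  simp only [id]
  field_simp
  ring

theorem PhiF_deriv {k : ℝ} (hk : 0 < k) (x : ℝ) :
    HasDerivAt (PhiF k) (x * phiF k x) x := by
  have h := (((hasDerivAt_pow 2 x).mul (ee_deriv k x)).sub ((phiF_deriv hk x).const_mul 3)).div_const (k ^ 2)
  refine h.congr_deriv ?_
  simp only [phiF]
  field_simp
  ring

theorem sq_deriv (x2 x : ℝ) : HasDerivAt (fun x : ℝ => (x ^ 2 - x2 ^ 2) / 2) x x := by
  have h := ((hasDerivAt_pow 2 x).sub_const (x2 ^ 2)).div_const 2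
  exact h.congr_deriv (by norm_num)

section pw
variable {k m M x1 x2 : ℝ}

theorem ee_mono (hk : 0 < k) {x y : ℝ} (h : x ≤ y) : Real.exp (k * x) ≤ Real.exp (k * y) :=
  Real.exp_le_exp.2 (by nlinarith)

theorem ee_one (hk : 0 < k) {x : ℝ} (h : 0 ≤ x) : 1 ≤ Real.exp (k * x) :=
  Real.one_le_exp (by positivity)

theorem phi_lower (hk : 0 < k) (h2 : 0 ≤ x2) (h : x2 ≤ x1) :
    (x1 ^ 2 - x2 ^ 2) / 2 ≤ phiF k x1 - phiF k x2 := by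
  have := mono_diff (f := fun x => phiF k x - (x ^ 2 - x2 ^ 2) / 2) h
      (fun x => (phiF_deriv hk x).sub (sq_deriv x2 x))
      (fun x hx => by
        have h0 : 0 ≤ x := by linarith [hx.1]
        have := ee_one hk h0
        nlinarith)
  simp only [sub_self, zero_div] at this
  linarith

theorem phi_upper (hk : 0 < k) (h2 : 0 ≤ x2) (h : x2 ≤ x1) (hM : x1 ≤ M) :
    phiF k x1 - phiF k x2 ≤ Real.exp (k * M) * ((x1 ^ 2 - x2 ^ 2) / 2) := by
  have := mono_diff (f := fun x => Real.exp (k * M) * ((x ^ 2 - x2 ^ 2) / 2) - phiF k x) h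
      (fun x => ((sq_deriv x2 x).const_mul _).sub (phiF_deriv hk x))
      (fun x hx => by
        have h0 : 0 ≤ x := by linarith [hx.1]
        have := ee_mono hk (hx.2.trans hM)
        nlinarith)
  simp only [sub_self, zero_div, mul_zero] at this
  linarith

theorem QF_lower (hk : 0 < k) (hm : 0 < m) (h1 : x1 ∈ Icc m M) (h2 : x2 ∈ Icc m M) :
    m ^ 2 / 2 * (x1 - x2) ^ 2 ≤ QF k x1 x2 := by
  have key := vshape (f := fun x => PhiF k x - phiF k x2 * ((x ^ 2 - x2 ^ 2) / 2)
      - 1 / 2 * (((x ^ 2 - x2 ^ 2) / 2) * ((x ^ 2 - x2 ^ 2) / 2))) h1 h2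
    (fun x => ((PhiF_deriv hk x).sub ((sq_deriv x2 x).const_mul _)).sub
      (((sq_deriv x2 x).mul (sq_deriv x2 x)).const_mul _))
    (fun x hx h => by
      have h0 : 0 ≤ x := by linarith [hx.1]
      have := phi_lower hk (by linarith [h2.1]) h
      nlinarith)
    (fun x hx h => by
      have h0 : 0 ≤ x := by linarith [hx.1]
      have := phi_lower hk h0 h
      nlinarith)
  simp only [sub_self, zero_div, mul_zero, sub_zero] at key
  have e : ((x1 ^ 2 - x2 ^ 2) / 2) * ((x1 ^ 2 - x2 ^ 2) / 2) = (x1 - x2) ^ 2 * ((x1 + x2) / 2) ^ 2 := by ring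
  have e2 : m ^ 2 ≤ ((x1 + x2) / 2) ^ 2 := by
    have : m ≤ (x1 + x2) / 2 := by linarith [h1.1, h2.1]
    exact pow_le_pow_left₀ hm.le this 2
  rw [e] at key
  rw [QF]
  nlinarith [mul_le_mul_of_nonneg_left e2 (sq_nonneg (x1 - x2))]

theorem QF_upper (hk : 0 < k) (hm : 0 < m) (h1 : x1 ∈ Icc m M) (h2 : x2 ∈ Icc m M) :
    QF k x1 x2 ≤ Real.exp (k * M) * M ^ 2 / 2 * (x1 - x2) ^ 2 := by
  have hMp : 0 < M := by linarith [h1.1, h1.2]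
  have key := vshape (f := fun x => Real.exp (k * M) / 2 * (((x ^ 2 - x2 ^ 2) / 2) * ((x ^ 2 - x2 ^ 2) / 2))
      - (PhiF k x - phiF k x2 * ((x ^ 2 - x2 ^ 2) / 2))) h1 h2
    (fun x => ((((sq_deriv x2 x).mul (sq_deriv x2 x)).const_mul _)).sub
      ((PhiF_deriv hk x).sub ((sq_deriv x2 x).const_mul _)))
    (fun x hx h => by
      have h0 : 0 ≤ x := by linarith [hx.1]
      have := phi_upper hk (by linarith [h2.1]) h hx.2
      nlinarith)
    (fun x hx h => by
      have h0 : 0 ≤ x := by linarith [hx.1]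
      have := phi_upper hk h0 h h2.2
      nlinarith)
  simp only [sub_self, zero_div, mul_zero, sub_zero] at key
  have e : ((x1 ^ 2 - x2 ^ 2) / 2) * ((x1 ^ 2 - x2 ^ 2) / 2) = (x1 - x2) ^ 2 * ((x1 + x2) / 2) ^ 2 := by ring
  have e2 : ((x1 + x2) / 2) ^ 2 ≤ M ^ 2 := by
    have : (x1 + x2) / 2 ≤ M := by linarith [h1.2, h2.2]
    exact pow_le_pow_left₀ (by linarith [h1.1, h2.1]) this 2
  rw [e] at key
  rw [QF]
  have := mul_le_mul_of_nonneg_left (mul_le_mul_of_nonneg_left e2 (sq_nonneg (x1 - x2)))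
    (Real.exp_pos (k * M)).le
  nlinarith

/-- the quadratic remainder -/
theorem rem_bound (hk : 0 < k) (hm : 0 < m) (h1 : x1 ∈ Icc m M) (h2 : x2 ∈ Icc m M) :
    0 ≤ phiF k x1 - phiF k x2 - Real.exp (k * x2) * ((x1 ^ 2 - x2 ^ 2) / 2) ∧
    phiF k x1 - phiF k x2 - Real.exp (k * x2) * ((x1 ^ 2 - x2 ^ 2) / 2)
      ≤ M * (k * Real.exp (k * M)) / 2 * (x1 - x2) ^ 2 := by
  have hMp : 0 < M := by linarith [h1.1, h1.2]
  constructor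
  · have key := vshape (f := fun x => phiF k x - Real.exp (k * x2) * ((x ^ 2 - x2 ^ 2) / 2)) h1 h2
      (fun x => (phiF_deriv hk x).sub ((sq_deriv x2 x).const_mul _))
      (fun x hx h => by
        have h0 : 0 ≤ x := by linarith [hx.1]
        have := ee_mono hk h
        nlinarith)
      (fun x hx h => by
        have h0 : 0 ≤ x := by linarith [hx.1]
        have := ee_mono hk h
        nlinarith)
    simp only [sub_self, zero_div, mul_zero, sub_zero] at key
    linarith
  · have hexp : ∀ x y, x ≤ y → y ≤ M → Real.exp (k * y) - Real.exp (k * x) ≤ k * Real.exp (k * M) * (y - x) := by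
      intro x y hxy hyM
      have := mono_diff (f := fun z => k * Real.exp (k * M) * z - Real.exp (k * z)) hxy
        (fun z => ((hasDerivAt_id z).const_mul _).sub (ee_deriv k z))
        (fun z hz => by
          have := ee_mono hk (hz.2.trans hyM)
          nlinarith)
      linarith
    have key := vshape (f := fun x => M * (k * Real.exp (k * M)) / 2 * ((x - x2) * (x - x2))
        - (phiF k x - Real.exp (k * x2) * ((x ^ 2 - x2 ^ 2) / 2))) h1 h2
      (fun x => ((((hasDerivAt_id x).sub_const x2).mul ((hasDerivAt_id x).sub_const x2)).const_mul _).sub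
        ((phiF_deriv hk x).sub ((sq_deriv x2 x).const_mul _)))
      (fun x hx h => by
        have h0 : 0 ≤ x := by linarith [hx.1]
        have a1 := hexp x2 x h hx.2
        have a2 : 0 ≤ k * Real.exp (k * M) * (x - x2) := by
          have := sub_nonneg.2 h
          positivity
        have a3 := mul_le_mul_of_nonneg_left a1 h0
        have a4 := mul_le_mul_of_nonneg_right hx.2 a2
        simp only [id]
        nlinarith)
      (fun x hx h => by
        have h0 : 0 ≤ x := by linarith [hx.1]
        have a1 := hexp x x2 h h2.2
        have a2 : 0 ≤ k * Real.exp (k * M) * (x2 - x) := by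
          have := sub_nonneg.2 h
          positivity
        have a3 := mul_le_mul_of_nonneg_left a1 h0
        have a4 := mul_le_mul_of_nonneg_right hx.2 a2
        simp only [id]
        nlinarith)
    simp only [sub_self, zero_div, mul_zero, sub_zero] at key
    nlinarith

theorem ee_phi (hk : 0 < k) (hm : 0 < m) (h1 : x1 ∈ Icc m M) (h2 : x2 ∈ Icc m M) :
    k * (phiF k x1 - phiF k x2) ≤ x1 * (Real.exp (k * x1) - Real.exp (k * x2)) := by
  have key := vshape (f := fun x => x * (Real.exp (k * x) - Real.exp (k * x2)) - k * phiF k x) h1 h2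
      (fun x => ((hasDerivAt_id x).mul ((ee_deriv k x).sub_const _)).sub ((phiF_deriv hk x).const_mul _))
      (fun x hx h => by
        have := ee_mono hk h
        simp only [id]
        nlinarith)
      (fun x hx h => by
        have := ee_mono hk h
        simp only [id]
        nlinarith)
  simp only [sub_self, mul_zero] at key
  linarith
end pw

theorem arctan_d (x : ℝ) : HasDerivAt Real.arctan (1 / (1 + x ^ 2)) x := Real.hasDerivAt_arctan x

theorem arctan_strong {p1 p2 : ℝ} (h0 : 0 ≤ p2) (h : p2 ≤ p1) :
    (1 + p2 ^ 2) * (Real.arctan p1 - Real.arctan p2) ≤ p1 - p2 := by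
  have := mono_diff (f := fun x => x - (1 + p2 ^ 2) * Real.arctan x) h
    (fun x => (hasDerivAt_id x).sub ((arctan_d x).const_mul _))
    (fun x hx => by
      have h1 : p2 ^ 2 ≤ x ^ 2 := pow_le_pow_left₀ h0 hx.1 2
      have h2 : (1 + p2 ^ 2) * (1 / (1 + x ^ 2)) ≤ 1 := by
        rw [mul_one_div, div_le_one (by positivity)]
        linarith
      linarith)
  linarith

theorem arctan_lip {p1 p2 : ℝ} (h : p2 ≤ p1) : Real.arctan p1 - Real.arctan p2 ≤ p1 - p2 := by
  have := mono_diff (f := fun x => x - Real.arctan x) h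
    (fun x => (hasDerivAt_id x).sub (arctan_d x))
    (fun x hx => by
      have h2 : (1 / (1 + x ^ 2)) ≤ 1 := by
        rw [div_le_one (by positivity)]
        nlinarith [sq_nonneg x]
      linarith)
  linarith

theorem D_ge (p1 p2 : ℝ) :
    (Real.arctan p1 - Real.arctan p2) ^ 2 ≤ (Real.arctan p1 - Real.arctan p2) * (p1 - p2) := by
  rcases le_total p1 p2 with h | h
  · have h1 := arctan_lip h
    have h2 := Real.arctan_strictMono.monotone h
    nlinarith
  · have h1 := arctan_lip h
    have h2 := Real.arctan_strictMono.monotone h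
    nlinarith

theorem D_ge_strong {p1 p2 : ℝ} (hs : 0 ≤ p1 * p2) (habs : |p2| ≤ |p1|) :
    (1 + p2 ^ 2) * (Real.arctan p1 - Real.arctan p2) ^ 2 ≤ (Real.arctan p1 - Real.arctan p2) * (p1 - p2) := by
  rcases lt_trichotomy p2 0 with h2 | h2 | h2
  · have h1 : p1 ≤ 0 := by by_contra hc; push Not at hc; nlinarith
    have hp : -p2 ≤ -p1 := by
      rwa [abs_of_nonpos h1, abs_of_neg h2] at habs
    have a := arctan_strong (by linarith) hp
    have b := Real.arctan_strictMono.monotone hp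
    simp only [Real.arctan_neg, neg_sq] at a b
    nlinarith
  · have := D_ge p1 p2
    rw [h2] at this ⊢
    simpa using this
  · have h1 : 0 ≤ p1 := by by_contra hc; push Not at hc; nlinarith
    have hp : p2 ≤ p1 := by
      rwa [abs_of_nonneg h1, abs_of_pos h2] at habs
    have a := arctan_strong h2.le hp
    have b := Real.arctan_strictMono.monotone hp
    nlinarith

noncomputable def etaF (p : ℝ) : ℝ := Real.sqrt (1 + p ^ 2) - 2 / Real.pi * (p * Real.arctan p)

theorem sqrt_d (x : ℝ) : HasDerivAt (fun p : ℝ => Real.sqrt (1 + p ^ 2)) (x / Real.sqrt (1 + x ^ 2)) x := by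
  have h := (((hasDerivAt_pow 2 x).const_add 1).sqrt (by positivity))
  refine h.congr_deriv ?_
  field_simp
  ring

theorem eta_deriv_bound {p : ℝ} (hp : 0 ≤ p) :
    |p / Real.sqrt (1 + p ^ 2) - 2 / Real.pi * (Real.arctan p + p * (1 / (1 + p ^ 2)))|
      ≤ 2 * (1 / (1 + p ^ 2)) := by
  have hpi := Real.pi_pos
  have hpi3 := Real.pi_gt_three
  set S := Real.sqrt (1 + p ^ 2) with hS
  have hSp : 0 < S := Real.sqrt_pos.2 (by positivity)
  have hS2 : S ^ 2 = 1 + p ^ 2 := Real.sq_sqrt (by positivity)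
  have hpS : p ≤ S := Real.le_sqrt_of_sq_le (by linarith)
  have h1 : p / S ≤ 1 := (div_le_one hSp).2 hpS
  have h0 : 0 ≤ p / S := by positivity
  have ha0 : 0 ≤ Real.arctan p := Real.arctan_nonneg.2 hp
  rcases le_total p 1 with hle | hge
  · have ha : Real.arctan p ≤ Real.pi / 4 := by
      rw [← Real.arctan_one]; exact Real.arctan_strictMono.monotone hle
    have hq : p * (1 / (1 + p ^ 2)) ≤ 1 / 2 := by
      rw [mul_one_div, div_le_div_iff₀ (by positivity) (by norm_num)]
      nlinarith [sq_nonneg (p - 1)]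
    have hq0 : 0 ≤ p * (1 / (1 + p ^ 2)) := by positivity
    have h2 : 2 / Real.pi * (Real.arctan p + p * (1 / (1 + p ^ 2))) ≤ 1 := by
      rw [div_mul_eq_mul_div, div_le_one hpi]; linarith
    have h20 : 0 ≤ 2 / Real.pi * (Real.arctan p + p * (1 / (1 + p ^ 2))) := by positivity
    have h3 : 1 ≤ 2 * (1 / (1 + p ^ 2)) := by
      rw [mul_one_div, one_le_div (by positivity)]; nlinarith
    rw [abs_le]; constructor <;> linarith
  · set b := Real.pi / 2 - Real.arctan p with hb
    have hpp : 0 < p := by linarith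
    have ha1 := Real.arctan_lt_pi_div_two p
    have hap : 0 < Real.arctan p := Real.arctan_pos.2 hpp
    have hb0 : 0 ≤ b := by linarith
    have hbu : b ≤ 1 / p := by
      have := Real.le_tan hb0 (by linarith)
      rw [hb, Real.tan_pi_div_two_sub, Real.tan_arctan] at this
      rw [one_div]; exact this
    have hbl : p * (1 / (1 + p ^ 2)) ≤ b := by
      have s1 : Real.sin b = 1 / S := by rw [hb, Real.sin_pi_div_two_sub, Real.cos_arctan]
      have s2 := Real.sin_le hb0
      rw [s1] at s2
      refine le_trans ?_ s2
      rw [← hS2, mul_one_div, div_le_div_iff₀ (by positivity) hSp]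
      nlinarith
    have e : Real.arctan p = Real.pi / 2 - b := by rw [hb]; ring
    have e2 : 2 / Real.pi * (Real.arctan p + p * (1 / (1 + p ^ 2)))
        = 1 - 2 / Real.pi * (b - p * (1 / (1 + p ^ 2))) := by
      rw [e]; field_simp; ring
    rw [e2]
    have c1 : b - p * (1 / (1 + p ^ 2)) ≤ 1 / (1 + p ^ 2) := by
      have : 1 / p - p * (1 / (1 + p ^ 2)) = 1 / p * (1 / (1 + p ^ 2)) := by field_simp; try ring
      have h3 : 1 / p ≤ 1 := (div_le_one hpp).2 hge
      have h4 : 0 ≤ 1 / (1 + p ^ 2) := by positivity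
      nlinarith
    have c2 : 0 ≤ b - p * (1 / (1 + p ^ 2)) := by linarith
    have c3 : 2 / Real.pi ≤ 1 := (div_le_one hpi).2 (by linarith)
    have c4 : 0 ≤ 2 / Real.pi := by positivity
    have c5 : 1 - p / S ≤ 1 / (1 + p ^ 2) := by
      rw [← hS2, ← sub_nonneg]
      have : 1 / S ^ 2 - (1 - p / S) = (1 - S * (S - p)) / S ^ 2 := by field_simp
      rw [this]
      apply div_nonneg _ (by positivity)
      nlinarith
    have c6 : 2 / Real.pi * (b - p * (1 / (1 + p ^ 2))) ≤ 1 / (1 + p ^ 2) := by nlinarith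
    have c7 : 0 ≤ 2 / Real.pi * (b - p * (1 / (1 + p ^ 2))) := by positivity
    rw [abs_le]; constructor <;> linarith

theorem eta_lip_pos {p1 p2 : ℝ} (h0 : 0 ≤ p2) (h : p2 ≤ p1) :
    |etaF p1 - etaF p2| ≤ 2 * |Real.arctan p1 - Real.arctan p2| := by
  have hd : ∀ x, HasDerivAt etaF (x / Real.sqrt (1 + x ^ 2) - 2 / Real.pi * (Real.arctan x + x * (1 / (1 + x ^ 2)))) x := by
    intro x
    have := (sqrt_d x).sub (((hasDerivAt_id x).mul (arctan_d x)).const_mul (2 / Real.pi))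
    refine this.congr_deriv ?_
    simp only [id, one_mul]
  have a := mono_diff (f := fun x => 2 * Real.arctan x - etaF x) h
    (fun x => ((arctan_d x).const_mul 2).sub (hd x))
    (fun x hx => by
      have := (abs_le.1 (eta_deriv_bound (h0.trans hx.1))).2
      linarith)
  have b := mono_diff (f := fun x => 2 * Real.arctan x + etaF x) h
    (fun x => ((arctan_d x).const_mul 2).add (hd x))
    (fun x hx => by
      have := (abs_le.1 (eta_deriv_bound (h0.trans hx.1))).1
      linarith)
  have c := Real.arctan_strictMono.monotone h
  rw [abs_of_nonneg (a := Real.arctan p1 - Real.arctan p2) (by linarith), abs_le]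
  constructor <;> linarith

theorem eta_abs (p : ℝ) : etaF p = etaF |p| := by
  rcases abs_choice p with h | h
  · rw [h]
  · rw [h, etaF, etaF, Real.arctan_neg]; ring_nf

theorem arctan_abs (p : ℝ) : Real.arctan |p| = |Real.arctan p| := by
  rcases le_total 0 p with h | h
  · rw [abs_of_nonneg h, abs_of_nonneg (Real.arctan_nonneg.2 h)]
  · rw [abs_of_nonpos h, Real.arctan_neg, abs_of_nonpos (by have := Real.arctan_strictMono.monotone h; simpa using this)]

theorem eta_lip (p1 p2 : ℝ) :
    |etaF p1 - etaF p2| ≤ 2 * |Real.arctan p1 - Real.arctan p2| := by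
  have h : |etaF (|p1|) - etaF (|p2|)| ≤ 2 * |Real.arctan (|p1|) - Real.arctan (|p2|)| := by
    rcases le_total |p2| |p1| with h | h
    · exact eta_lip_pos (abs_nonneg _) h
    · have := eta_lip_pos (abs_nonneg _) h
      rwa [abs_sub_comm, abs_sub_comm (Real.arctan _)] at this
  rw [← eta_abs, ← eta_abs, arctan_abs, arctan_abs] at h
  have := abs_abs_sub_abs_le_abs_sub (Real.arctan p1) (Real.arctan p2)
  linarith

theorem eta_bdd (p : ℝ) : |etaF p| ≤ 5 := by
  have h := eta_lip p 0
  have e : etaF 0 = 1 := by simp [etaF]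
  rw [e, Real.arctan_zero, sub_zero] at h
  have h1 := Real.arctan_lt_pi_div_two p
  have h2 := Real.neg_pi_div_two_lt_arctan p
  have h3 := Real.pi_lt_four
  have h3 := Real.pi_lt_d2
  have h4 : |Real.arctan p| ≤ 1.6 := by rw [abs_le]; constructor <;> linarith
  have := abs_le.1 (h.trans (by linarith : 2 * |Real.arctan p| ≤ 3.2))
  rw [abs_le]; constructor <;> linarith

theorem D_nonneg (p1 p2 : ℝ) : 0 ≤ (Real.arctan p1 - Real.arctan p2) * (p1 - p2) :=
  (sq_nonneg _).trans (D_ge p1 p2)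

theorem cross_bound {m M x1 x2 : ℝ} (hm : 0 < m) (h1 : x1 ∈ Icc m M) (h2 : x2 ∈ Icc m M) (p1 p2 : ℝ) :
    m ^ 2 / 2 * ((Real.arctan p1 - Real.arctan p2) * (p1 - p2)) - 2 * M ^ 2 / m ^ 2 * (x1 - x2) ^ 2
      ≤ (Real.arctan p1 - Real.arctan p2) * (x1 ^ 2 * p1 - x2 ^ 2 * p2) := by
  have hMp : 0 < M := by linarith [h1.1, h1.2]
  have hx1 : m ^ 2 ≤ x1 ^ 2 := pow_le_pow_left₀ hm.le h1.1 2
  have hx2 : m ^ 2 ≤ x2 ^ 2 := pow_le_pow_left₀ hm.le h2.1 2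
  have hD := D_nonneg p1 p2
  have hw : 0 ≤ 2 * M ^ 2 / m ^ 2 * (x1 - x2) ^ 2 := by positivity
  -- auxiliary same-sign estimate
  have aux : ∀ x y p q : ℝ, x ∈ Icc m M → y ∈ Icc m M → 0 ≤ p * q → |q| ≤ |p| →
      m ^ 2 / 2 * ((Real.arctan p - Real.arctan q) * (p - q)) - 2 * M ^ 2 / m ^ 2 * (x - y) ^ 2
      ≤ (Real.arctan p - Real.arctan q) * (x ^ 2 * p - y ^ 2 * q) := by
    intro x y p q hx hy hs ha
    have hst := D_ge_strong hs ha
    have hx1 : m ^ 2 ≤ x ^ 2 := pow_le_pow_left₀ hm.le hx.1 2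
    have hD := D_nonneg p q
    set al := Real.arctan p - Real.arctan q
    have e : al * (x ^ 2 * p - y ^ 2 * q) = x ^ 2 * (al * (p - q)) + (x + y) * ((x - y) * (q * al)) := by ring
    rw [e]
    have k1 : m ^ 2 * (al * (p - q)) ≤ x ^ 2 * (al * (p - q)) := mul_le_mul_of_nonneg_right hx1 hD
    have k2 : (q * al) ^ 2 ≤ al * (p - q) := by nlinarith [sq_nonneg al]
    have k3 : -(m ^ 2 / 2 * (q * al) ^ 2 + 2 * M ^ 2 / m ^ 2 * (x - y) ^ 2) ≤ (x + y) * ((x - y) * (q * al)) := by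
      have s1 : 0 ≤ (m * (q * al) + (x + y) * (x - y) / m) ^ 2 := sq_nonneg _
      have s2 : (m * (q * al) + (x + y) * (x - y) / m) ^ 2
        = m ^ 2 * (q * al) ^ 2 + 2 * ((x + y) * ((x - y) * (q * al))) + (x + y) ^ 2 * ((x - y) ^ 2 / m ^ 2) := by
        field_simp
        ring
      have s3 : (x + y) ^ 2 ≤ (2 * M) ^ 2 :=
        pow_le_pow_left₀ (by linarith [hx.1, hy.1]) (by linarith [hx.2, hy.2]) 2
      have s4 : (x + y) ^ 2 * ((x - y) ^ 2 / m ^ 2) ≤ (2 * M) ^ 2 * ((x - y) ^ 2 / m ^ 2) :=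
        mul_le_mul_of_nonneg_right s3 (by positivity)
      have s5 : 2 * M ^ 2 / m ^ 2 * (x - y) ^ 2 = ((2 * M) ^ 2 * ((x - y) ^ 2 / m ^ 2)) / 2 := by
        field_simp; try ring
      rw [s5]
      nlinarith
    have k4 : m ^ 2 / 2 * (q * al) ^ 2 ≤ m ^ 2 / 2 * (al * (p - q)) :=
      mul_le_mul_of_nonneg_left k2 (by positivity)
    linarith
  rcases le_total 0 (p1 * p2) with hs | hs
  · rcases le_total |p2| |p1| with ha | ha
    · exact aux x1 x2 p1 p2 h1 h2 hs ha
    · have := aux x2 x1 p2 p1 h2 h1 (by linarith [mul_comm p1 p2]) ha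
      have e3 : (x2 - x1) ^ 2 = (x1 - x2) ^ 2 := by ring
      rw [e3] at this
      linarith
  · -- opposite signs
    have : m ^ 2 * ((Real.arctan p1 - Real.arctan p2) * (p1 - p2)) ≤
        (Real.arctan p1 - Real.arctan p2) * (x1 ^ 2 * p1 - x2 ^ 2 * p2) := by
      rcases le_total p2 p1 with h | h
      · have hp1 : 0 ≤ p1 := by by_contra hc; push Not at hc; nlinarith
        have hp2 : p2 ≤ 0 := by by_contra hc; push Not at hc; nlinarith
        have := Real.arctan_strictMono.monotone h
        have k : m ^ 2 * (p1 - p2) ≤ x1 ^ 2 * p1 - x2 ^ 2 * p2 := by nlinarith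
        have := mul_le_mul_of_nonneg_left k (sub_nonneg.2 this)
        linarith
      · have hp1 : 0 ≤ p2 := by by_contra hc; push Not at hc; nlinarith
        have hp2 : p1 ≤ 0 := by by_contra hc; push Not at hc; nlinarith
        have := Real.arctan_strictMono.monotone h
        have k : m ^ 2 * (p2 - p1) ≤ x2 ^ 2 * p2 - x1 ^ 2 * p1 := by nlinarith
        have := mul_le_mul_of_nonneg_left k (sub_nonneg.2 this)
        linarith
    nlinarith [mul_nonneg (sq_nonneg m) hD]

/-- integrand of the pair lemma -/
noncomputable def IF (A x1 x2 p1 p2 : ℝ) : ℝ :=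
  -(phiF (2 * A / Real.pi) x1 - phiF (2 * A / Real.pi) x2)
    + Real.exp (2 * A / Real.pi * x2) * ((x1 ^ 2 - x2 ^ 2) / 2)
    + A * x1 * (phiF (2 * A / Real.pi) x1 - phiF (2 * A / Real.pi) x2) * Real.sqrt (1 + p1 ^ 2)
    - A * x2 * Real.exp (2 * A / Real.pi * x2) * ((x1 ^ 2 - x2 ^ 2) / 2) * Real.sqrt (1 + p2 ^ 2)
    - Real.arctan p1 * (x1 ^ 2 * Real.exp (2 * A / Real.pi * x1) * p1
        - x2 ^ 2 * Real.exp (2 * A / Real.pi * x2) * p2)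
    + Real.arctan p2 * (2 * A / Real.pi * x2 * Real.exp (2 * A / Real.pi * x2) * p2 * ((x1 ^ 2 - x2 ^ 2) / 2)
        + Real.exp (2 * A / Real.pi * x2) * (x1 ^ 2 * p1 - x2 ^ 2 * p2))

set_option maxHeartbeats 1000000 in
theorem IF_bound {A m M : ℝ} (hA : 0 < A) (hm : 0 < m) (hM : 0 < M) :
    ∃ C : ℝ, 0 < C ∧ ∀ x1 ∈ Icc m M, ∀ x2 ∈ Icc m M, ∀ p1 p2 : ℝ,
      IF A x1 x2 p1 p2 ≤ C * (x1 - x2) ^ 2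
        - m ^ 2 / 4 * ((Real.arctan p1 - Real.arctan p2) * (p1 - p2)) := by
  set k := 2 * A / Real.pi with hk
  have hkp : 0 < k := by have := Real.pi_pos; positivity
  set E := Real.exp (k * M) with hE
  have hEp : 0 < E := Real.exp_pos _
  set R := M * (k * E) / 2 with hR
  have hRp : 0 < R := by positivity
  set B := A * M * E * M * 2 with hB
  have hBp : 0 < B := by positivity
  refine ⟨A * (M * R + E * M) * 5 + B ^ 2 / m ^ 2 + E * (2 * M ^ 2 / m ^ 2), by positivity, ?_⟩
  intro x1 h1 x2 h2 p1 p2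
  have hx1 : 0 < x1 := by linarith [h1.1]
  have hx2 : 0 < x2 := by linarith [h2.1]
  set e1 := Real.exp (k * x1) with he1
  set e2 := Real.exp (k * x2) with he2
  have he2E : e2 ≤ E := ee_mono hkp h2.2
  have he2one : 1 ≤ e2 := ee_one hkp hx2.le
  obtain ⟨r0, r1⟩ := rem_bound hkp hm h1 h2
  rw [← he2] at r0 r1
  rw [← hE, ← hR] at r1
  have g := ee_phi hkp hm h1 h2
  rw [← he1, ← he2] at g
  have cb := cross_bound hm h1 h2 p1 p2
  have hDge := D_ge p1 p2
  have hD := D_nonneg p1 p2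
  have hel := eta_lip p1 p2
  have heb := eta_bdd p1
  have hap : 0 ≤ Real.arctan p1 * p1 := by
    have := D_nonneg p1 0
    simpa using this
  have hIF : IF A x1 x2 p1 p2 = -(phiF k x1 - phiF k x2 - e2 * ((x1 ^ 2 - x2 ^ 2) / 2))
      + A * (x1 * (phiF k x1 - phiF k x2) - x2 * (e2 * ((x1 ^ 2 - x2 ^ 2) / 2))) * etaF p1
      + A * (x2 * (e2 * ((x1 ^ 2 - x2 ^ 2) / 2))) * (etaF p1 - etaF p2)
      - e2 * ((Real.arctan p1 - Real.arctan p2) * (x1 ^ 2 * p1 - x2 ^ 2 * p2))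
      - (Real.arctan p1 * p1) * x1 * (x1 * (e1 - e2) - k * (phiF k x1 - phiF k x2)) := by
    have hAk : A * (2 / Real.pi) = k := by rw [hk]; ring
    have et1 : A * etaF p1 = A * Real.sqrt (1 + p1 ^ 2) - k * (p1 * Real.arctan p1) := by
      rw [etaF, ← hAk]; ring
    have et2 : A * etaF p2 = A * Real.sqrt (1 + p2 ^ 2) - k * (p2 * Real.arctan p2) := by
      rw [etaF, ← hAk]; ring
    have z1 : A * (x1 * (phiF k x1 - phiF k x2) - x2 * (e2 * ((x1 ^ 2 - x2 ^ 2) / 2))) * etaF p1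
      = (x1 * (phiF k x1 - phiF k x2) - x2 * (e2 * ((x1 ^ 2 - x2 ^ 2) / 2))) * (A * etaF p1) := by ring
    have z2 : A * (x2 * (e2 * ((x1 ^ 2 - x2 ^ 2) / 2))) * (etaF p1 - etaF p2)
      = (x2 * (e2 * ((x1 ^ 2 - x2 ^ 2) / 2))) * (A * etaF p1 - A * etaF p2) := by ring
    rw [z1, z2, et1, et2, IF, ← hk, ← he1, ← he2]
    ring
  rw [hIF]
  set f := phiF k x1 - phiF k x2 - e2 * ((x1 ^ 2 - x2 ^ 2) / 2) with hf
  set dl := (x1 ^ 2 - x2 ^ 2) / 2 with hdl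
  set al := Real.arctan p1 - Real.arctan p2 with hal
  set D := al * (p1 - p2) with hDdef
  set w := x1 - x2 with hw
  have hdlw : |dl| ≤ M * |w| := by
    have : dl = (x1 + x2) / 2 * w := by rw [hdl, hw]; ring
    rw [this, abs_mul, abs_of_pos (by positivity)]
    exact mul_le_mul_of_nonneg_right (by linarith [h1.2, h2.2]) (abs_nonneg _)
  have t1 : |x1 * (phiF k x1 - phiF k x2) - x2 * (e2 * dl)| ≤ (M * R + E * M) * w ^ 2 := by
    have e : x1 * (phiF k x1 - phiF k x2) - x2 * (e2 * dl) = x1 * f + w * (e2 * dl) := by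
      rw [hf, hw]; ring
    rw [e]
    refine (abs_add_le _ _).trans ?_
    rw [abs_mul, abs_mul, abs_mul, abs_of_pos hx1, abs_of_nonneg r0, abs_of_pos (Real.exp_pos _)]
    have a1 : x1 * f ≤ M * (R * w ^ 2) := mul_le_mul h1.2 r1 r0 hM.le
    have a2 : |w| * (e2 * |dl|) ≤ |w| * (E * (M * |w|)) := by gcongr
    have a3 : |w| * |w| = w ^ 2 := by rw [← sq, sq_abs]
    nlinarith
  have T1 : A * (x1 * (phiF k x1 - phiF k x2) - x2 * (e2 * dl)) * etaF p1
      ≤ A * ((M * R + E * M) * w ^ 2) * 5 := by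
    refine (le_abs_self _).trans ?_
    rw [abs_mul, abs_mul, abs_of_pos hA]
    gcongr
  have T2 : A * (x2 * (e2 * dl)) * (etaF p1 - etaF p2) ≤ m ^ 2 / 4 * D + B ^ 2 / m ^ 2 * w ^ 2 := by
    refine (le_abs_self _).trans ?_
    rw [abs_mul, abs_mul, abs_mul, abs_mul, abs_of_pos hA, abs_of_pos hx2, abs_of_pos (Real.exp_pos _)]
    have a1 : A * (x2 * (e2 * |dl|)) * |etaF p1 - etaF p2| ≤ A * (M * (E * (M * |w|))) * (2 * |al|) := by
      gcongr
      exact h2.2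
    have a2 : A * (M * (E * (M * |w|))) * (2 * |al|) = B * |w| * |al| := by rw [hB]; ring
    have s1 : 0 ≤ (m / 2 * |al| - B / m * |w|) ^ 2 := sq_nonneg _
    have s2 : (m / 2 * |al| - B / m * |w|) ^ 2 = m ^ 2 / 4 * al ^ 2 - B * |w| * |al| + B ^ 2 / m ^ 2 * w ^ 2 := by
      rw [← sq_abs al, ← sq_abs w]; field_simp; ring
    have s3 : m ^ 2 / 4 * al ^ 2 ≤ m ^ 2 / 4 * D := mul_le_mul_of_nonneg_left hDge (by positivity)
    linarith
  have T3 : -(e2 * (al * (x1 ^ 2 * p1 - x2 ^ 2 * p2))) ≤ -(m ^ 2 / 2 * D) + E * (2 * M ^ 2 / m ^ 2) * w ^ 2 := by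
    have a1 := mul_le_mul_of_nonneg_left cb (by linarith : (0:ℝ) ≤ e2)
    have a2 : 1 * (m ^ 2 / 2 * D) ≤ e2 * (m ^ 2 / 2 * D) := mul_le_mul_of_nonneg_right he2one (by positivity)
    have a3 : e2 * (2 * M ^ 2 / m ^ 2 * w ^ 2) ≤ E * (2 * M ^ 2 / m ^ 2 * w ^ 2) :=
      mul_le_mul_of_nonneg_right he2E (by positivity)
    rw [mul_sub] at a1
    linarith
  have T4 : 0 ≤ (Real.arctan p1 * p1) * x1 * (x1 * (e1 - e2) - k * (phiF k x1 - phiF k x2)) :=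
    mul_nonneg (mul_nonneg hap hx1.le) (by linarith)
  linarith

/-- solutions in the variable u = log rho, p = u_theta, q = u_thetatheta, v = u_t -/
structure Sol (A b s0 s1 : ℝ) (u p q v : ℝ → ℝ → ℝ) : Prop where
  cu : ContinuousOn (fun z : ℝ × ℝ => u z.1 z.2) (Icc 0 Real.pi ×ˢ Ioo s0 s1)
  cp : ContinuousOn (fun z : ℝ × ℝ => p z.1 z.2) (Icc 0 Real.pi ×ˢ Ioo s0 s1)
  cq : ContinuousOn (fun z : ℝ × ℝ => q z.1 z.2) (Icc 0 Real.pi ×ˢ Ioo s0 s1)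
  cv : ContinuousOn (fun z : ℝ × ℝ => v z.1 z.2) (Icc 0 Real.pi ×ˢ Ioo s0 s1)
  du : ∀ θ ∈ Icc 0 Real.pi, ∀ t ∈ Ioo s0 s1,
    HasDerivWithinAt (fun φ => u φ t) (p θ t) (Icc 0 Real.pi) θ
  dp : ∀ θ ∈ Icc 0 Real.pi, ∀ t ∈ Ioo s0 s1,
    HasDerivWithinAt (fun φ => p φ t) (q θ t) (Icc 0 Real.pi) θ
  dt : ∀ θ ∈ Icc 0 Real.pi, ∀ t ∈ Ioo s0 s1, HasDerivAt (fun τ => u θ τ) (v θ t) t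
  b0 : ∀ t ∈ Ioo s0 s1, u 0 t = b
  b1 : ∀ t ∈ Ioo s0 s1, u Real.pi t = b
  pde : ∀ θ ∈ Icc 0 Real.pi, ∀ t ∈ Ioo s0 s1,
    Real.exp (u θ t) ^ 2 * v θ t = q θ t / (1 + p θ t ^ 2) - 1
      + A * Real.exp (u θ t) * Real.sqrt (1 + p θ t ^ 2)

theorem Sol.mono {A b s0 s1 r0 r1 : ℝ} {u p q v : ℝ → ℝ → ℝ} (h : Sol A b s0 s1 u p q v)
    (h0 : s0 ≤ r0) (h1 : r1 ≤ s1) : Sol A b r0 r1 u p q v := by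
  have hs : Ioo r0 r1 ⊆ Ioo s0 s1 := Ioo_subset_Ioo h0 h1
  exact ⟨h.cu.mono (prod_mono_right hs), h.cp.mono (prod_mono_right hs),
    h.cq.mono (prod_mono_right hs), h.cv.mono (prod_mono_right hs),
    fun θ hθ t ht => h.du θ hθ t (hs ht), fun θ hθ t ht => h.dp θ hθ t (hs ht),
    fun θ hθ t ht => h.dt θ hθ t (hs ht), fun t ht => h.b0 t (hs ht),
    fun t ht => h.b1 t (hs ht), fun θ hθ t ht => h.pde θ hθ t (hs ht)⟩

theorem Sol.shift {A b s0 s1 : ℝ} {u p q v : ℝ → ℝ → ℝ} (h : Sol A b s0 s1 u p q v) (d : ℝ) :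
    Sol A b (s0 - d) (s1 - d) (fun θ t => u θ (t + d)) (fun θ t => p θ (t + d))
      (fun θ t => q θ (t + d)) (fun θ t => v θ (t + d)) := by
  have hs : ∀ t ∈ Ioo (s0 - d) (s1 - d), t + d ∈ Ioo s0 s1 :=
    fun t ht => ⟨by linarith [ht.1], by linarith [ht.2]⟩
  have hc : ∀ f : ℝ → ℝ → ℝ, ContinuousOn (fun z : ℝ × ℝ => f z.1 z.2) (Icc 0 Real.pi ×ˢ Ioo s0 s1) →
      ContinuousOn (fun z : ℝ × ℝ => f z.1 (z.2 + d)) (Icc 0 Real.pi ×ˢ Ioo (s0 - d) (s1 - d)) := by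
    intro f hf
    exact hf.comp (f := fun z : ℝ × ℝ => (z.1, z.2 + d)) (by fun_prop) (fun z hz => ⟨hz.1, hs _ hz.2⟩)
  exact ⟨hc _ h.cu, hc _ h.cp, hc _ h.cq, hc _ h.cv,
    fun θ hθ t ht => h.du θ hθ _ (hs t ht), fun θ hθ t ht => h.dp θ hθ _ (hs t ht),
    fun θ hθ t ht => (h.dt θ hθ _ (hs t ht)).comp_add_const t d, fun t ht => h.b0 _ (hs t ht),
    fun t ht => h.b1 _ (hs t ht), fun θ hθ t ht => h.pde θ hθ _ (hs t ht)⟩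

theorem Sol.reflect {A b s0 s1 : ℝ} {u p q v : ℝ → ℝ → ℝ} (h : Sol A b s0 s1 u p q v) :
    Sol A b s0 s1 (fun θ t => u (Real.pi - θ) t) (fun θ t => -p (Real.pi - θ) t)
      (fun θ t => q (Real.pi - θ) t) (fun θ t => v (Real.pi - θ) t) := by
  have hs : ∀ θ ∈ Icc 0 Real.pi, Real.pi - θ ∈ Icc 0 Real.pi :=
    fun t ht => ⟨by linarith [ht.2], by linarith [ht.1]⟩
  have hc : ∀ f : ℝ → ℝ → ℝ, ContinuousOn (fun z : ℝ × ℝ => f z.1 z.2) (Icc 0 Real.pi ×ˢ Ioo s0 s1) →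
      ContinuousOn (fun z : ℝ × ℝ => f (Real.pi - z.1) z.2) (Icc 0 Real.pi ×ˢ Ioo s0 s1) := by
    intro f hf
    exact hf.comp (f := fun z : ℝ × ℝ => (Real.pi - z.1, z.2)) (by fun_prop) (fun z hz => ⟨hs _ hz.1, hz.2⟩)
  have hd : ∀ f g : ℝ → ℝ, (∀ θ ∈ Icc 0 Real.pi, HasDerivWithinAt f (g θ) (Icc 0 Real.pi) θ) →
      ∀ θ ∈ Icc 0 Real.pi, HasDerivWithinAt (fun φ => f (Real.pi - φ)) (-g (Real.pi - θ)) (Icc 0 Real.pi) θ := by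
    intro f g hfg θ hθ
    have h1 : HasDerivWithinAt (fun φ => Real.pi - φ) (-1) (Icc 0 Real.pi) θ :=
      ((hasDerivWithinAt_id θ _).const_sub Real.pi)
    have := (hfg _ (hs θ hθ)).scomp (t' := Icc 0 Real.pi) θ h1 (fun x hx => hs x hx)
    refine this.congr_deriv ?_
    simp
  refine ⟨hc _ h.cu, (hc _ h.cp).neg, hc _ h.cq, hc _ h.cv,
    fun θ hθ t ht => hd _ _ (fun x hx => h.du x hx t ht) θ hθ,
    fun θ hθ t ht => ?_,
    fun θ hθ t ht => h.dt _ (hs θ hθ) t ht, fun t ht => ?_,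
    fun t ht => ?_, fun θ hθ t ht => ?_⟩
  · have := (hd _ _ (fun x hx => h.dp x hx t ht) θ hθ).neg
    rw [neg_neg] at this
    exact this
  · rw [sub_zero]; exact h.b1 t ht
  · rw [sub_self]; exact h.b0 t ht
  · rw [neg_sq]; exact h.pde _ (hs θ hθ) t ht

theorem phiF_cont (k : ℝ) : Continuous (phiF k) := by
  unfold phiF; fun_prop

theorem PhiF_cont (k : ℝ) : Continuous (PhiF k) := by
  have := phiF_cont k
  unfold PhiF; fun_prop

noncomputable def JF (A : ℝ) (u1 u2 : ℝ → ℝ → ℝ) (t : ℝ) : ℝ :=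
  ∫ θ in (0:ℝ)..Real.pi, QF (2 * A / Real.pi) (Real.exp (u1 θ t)) (Real.exp (u2 θ t))

noncomputable def DF (p1 p2 : ℝ → ℝ → ℝ) (t : ℝ) : ℝ :=
  ∫ θ in (0:ℝ)..Real.pi, (Real.arctan (p1 θ t) - Real.arctan (p2 θ t)) * (p1 θ t - p2 θ t)

theorem QF_contOn {k : ℝ} {X : Type*} [TopologicalSpace X] {f g : X → ℝ} {s : Set X}
    (hf : ContinuousOn f s) (hg : ContinuousOn g s) : ContinuousOn (fun z => QF k (f z) (g z)) s := by
  have h1 := (PhiF_cont k).comp_continuousOn hf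
  have h2 := (PhiF_cont k).comp_continuousOn hg
  have h3 := (phiF_cont k).comp_continuousOn hg
  simp only [Function.comp_def] at h1 h2 h3
  unfold QF
  fun_prop

theorem pair_deriv {A b s0 s1 : ℝ} (hA : 0 < A) {u1 p1 q1 v1 u2 p2 q2 v2 : ℝ → ℝ → ℝ}
    (S1 : Sol A b s0 s1 u1 p1 q1 v1) (S2 : Sol A b s0 s1 u2 p2 q2 v2) {t : ℝ} (ht : t ∈ Ioo s0 s1) :
    HasDerivAt (JF A u1 u2) (∫ θ in (0:ℝ)..Real.pi,
      IF A (Real.exp (u1 θ t)) (Real.exp (u2 θ t)) (p1 θ t) (p2 θ t)) t := by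
  set k := 2 * A / Real.pi with hk
  have hkp : 0 < k := by have := Real.pi_pos; positivity
  have hpc := phiF_cont k
  have cu1 := S1.cu
  have cu2 := S2.cu
  have cv1 := S1.cv
  have cv2 := S2.cv
  have f1 := hpc.comp_continuousOn cu1.rexp
  have f2 := hpc.comp_continuousOn cu2.rexp
  simp only [Function.comp_def] at f1 f2
  have main := diff_under
    (f := fun θ t => QF k (Real.exp (u1 θ t)) (Real.exp (u2 θ t)))
    (g := fun θ t => (phiF k (Real.exp (u1 θ t)) - phiF k (Real.exp (u2 θ t))) * (Real.exp (u1 θ t) ^ 2 * v1 θ t)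
      - Real.exp (k * Real.exp (u2 θ t)) * ((Real.exp (u1 θ t) ^ 2 - Real.exp (u2 θ t) ^ 2) / 2)
        * (Real.exp (u2 θ t) ^ 2 * v2 θ t)) (s0 := s0) (s1 := s1)
    (QF_contOn cu1.rexp cu2.rexp) (by fun_prop)
    (fun θ hθ t ht => by
      have d1 := (S1.dt θ hθ t ht).exp
      have d2 := (S2.dt θ hθ t ht).exp
      have a1 := (PhiF_deriv hkp (Real.exp (u1 θ t))).comp t d1
      have a2 := (PhiF_deriv hkp (Real.exp (u2 θ t))).comp t d2
      have a3 := (phiF_deriv hkp (Real.exp (u2 θ t))).comp t d2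
      have a4 := ((d1.fun_pow 2).sub (d2.fun_pow 2)).div_const 2
      have := (a1.sub a2).sub (a3.mul a4)
      refine this.congr_deriv ?_
      simp only [Function.comp_def]
      norm_num
      ring) ht
  refine main.congr_deriv ?_
  have cu1 := slice_cont S1.cu ht
  have cu2 := slice_cont S2.cu ht
  have cp1 := slice_cont S1.cp ht
  have cp2 := slice_cont S2.cp ht
  have cq1 := slice_cont S1.cq ht
  have cq2 := slice_cont S2.cq ht
  have cv1 := slice_cont S1.cv ht
  have cv2 := slice_cont S2.cv ht
  have f1 := hpc.comp_continuousOn cu1.rexp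
  have f2 := hpc.comp_continuousOn cu2.rexp
  simp only [Function.comp_def] at f1 f2
  have ca1 := Real.continuous_arctan.comp_continuousOn cp1
  have ca2 := Real.continuous_arctan.comp_continuousOn cp2
  simp only [Function.comp_def] at ca1 ca2
  -- W
  have hW : ∀ θ ∈ Icc 0 Real.pi, HasDerivWithinAt (fun θ =>
      (phiF k (Real.exp (u1 θ t)) - phiF k (Real.exp (u2 θ t))) * Real.arctan (p1 θ t)
      - Real.exp (k * Real.exp (u2 θ t)) * ((Real.exp (u1 θ t) ^ 2 - Real.exp (u2 θ t) ^ 2) / 2) * Real.arctan (p2 θ t))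
      (((phiF k (Real.exp (u1 θ t)) - phiF k (Real.exp (u2 θ t))) * (Real.exp (u1 θ t) ^ 2 * v1 θ t)
      - Real.exp (k * Real.exp (u2 θ t)) * ((Real.exp (u1 θ t) ^ 2 - Real.exp (u2 θ t) ^ 2) / 2)
        * (Real.exp (u2 θ t) ^ 2 * v2 θ t))
        - IF A (Real.exp (u1 θ t)) (Real.exp (u2 θ t)) (p1 θ t) (p2 θ t)) (Icc 0 Real.pi) θ := by
    intro θ hθ
    have d1 := (S1.du θ hθ t ht).exp
    have d2 := (S2.du θ hθ t ht).exp
    have a1 := (phiF_deriv hkp (Real.exp (u1 θ t))).comp_hasDerivWithinAt θ d1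
    have a2 := (phiF_deriv hkp (Real.exp (u2 θ t))).comp_hasDerivWithinAt θ d2
    have a3 := (ee_deriv k (Real.exp (u2 θ t))).comp_hasDerivWithinAt θ d2
    have a4 := ((d1.fun_pow 2).sub (d2.fun_pow 2)).div_const 2
    have r1 := (S1.dp θ hθ t ht).arctan
    have r2 := (S2.dp θ hθ t ht).arctan
    have := ((a1.sub a2).mul r1).sub ((a3.mul a4).mul r2)
    refine this.congr_deriv ?_
    rw [S1.pde θ hθ t ht, S2.pde θ hθ t ht, IF, ← hk]
    simp only [Function.comp_def, Pi.mul_apply, Pi.sub_apply]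
    norm_num
    ring
  have hIc : ContinuousOn (fun θ => IF A (Real.exp (u1 θ t)) (Real.exp (u2 θ t)) (p1 θ t) (p2 θ t)) (Icc 0 Real.pi) := by
    simp only [IF, ← hk]
    fun_prop
  have h := ftc_full _ _ hW (by fun_prop)
  rw [intervalIntegral.integral_sub (slice_int (by fun_prop)) (slice_int hIc)] at h
  rw [S1.b0 t ht, S1.b1 t ht, S2.b0 t ht, S2.b1 t ht] at h
  simp only [sub_self, zero_mul, zero_div, mul_zero, sub_zero] at h
  linarith

theorem JF_lower {A m M : ℝ} (hA : 0 < A) (hm : 0 < m) {u1 u2 : ℝ → ℝ → ℝ} {t : ℝ}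
    (c1 : ContinuousOn (fun θ => u1 θ t) (Icc 0 Real.pi)) (c2 : ContinuousOn (fun θ => u2 θ t) (Icc 0 Real.pi))
    (h1 : ∀ θ ∈ Icc 0 Real.pi, Real.exp (u1 θ t) ∈ Icc m M)
    (h2 : ∀ θ ∈ Icc 0 Real.pi, Real.exp (u2 θ t) ∈ Icc m M) :
    m ^ 2 / 2 * (∫ θ in (0:ℝ)..Real.pi, (Real.exp (u1 θ t) - Real.exp (u2 θ t)) ^ 2) ≤ JF A u1 u2 t := by
  have hkp : 0 < 2 * A / Real.pi := by have := Real.pi_pos; positivity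
  rw [← intervalIntegral.integral_const_mul]
  exact int_mono (by fun_prop) (QF_contOn c1.rexp c2.rexp)
    (fun θ hθ => QF_lower hkp hm (h1 θ hθ) (h2 θ hθ))

theorem JF_upper {A m M : ℝ} (hA : 0 < A) (hm : 0 < m) {u1 u2 : ℝ → ℝ → ℝ} {t : ℝ}
    (c1 : ContinuousOn (fun θ => u1 θ t) (Icc 0 Real.pi)) (c2 : ContinuousOn (fun θ => u2 θ t) (Icc 0 Real.pi))
    (h1 : ∀ θ ∈ Icc 0 Real.pi, Real.exp (u1 θ t) ∈ Icc m M)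
    (h2 : ∀ θ ∈ Icc 0 Real.pi, Real.exp (u2 θ t) ∈ Icc m M) :
    JF A u1 u2 t ≤ Real.exp (2 * A / Real.pi * M) * M ^ 2 / 2 *
      (∫ θ in (0:ℝ)..Real.pi, (Real.exp (u1 θ t) - Real.exp (u2 θ t)) ^ 2) := by
  have hkp : 0 < 2 * A / Real.pi := by have := Real.pi_pos; positivity
  rw [← intervalIntegral.integral_const_mul]
  exact int_mono (QF_contOn c1.rexp c2.rexp) (by fun_prop)
    (fun θ hθ => QF_upper hkp hm (h1 θ hθ) (h2 θ hθ))

theorem pair_ineq {A m M : ℝ} (hA : 0 < A) (hm : 0 < m) (hM : 0 < M) : ∃ C : ℝ, 0 < C ∧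
    ∀ (b s0 s1 : ℝ) (u1 p1 q1 v1 u2 p2 q2 v2 : ℝ → ℝ → ℝ), Sol A b s0 s1 u1 p1 q1 v1 →
    Sol A b s0 s1 u2 p2 q2 v2 → ∀ t ∈ Ioo s0 s1,
    (∀ θ ∈ Icc 0 Real.pi, Real.exp (u1 θ t) ∈ Icc m M) →
    (∀ θ ∈ Icc 0 Real.pi, Real.exp (u2 θ t) ∈ Icc m M) →
    ∃ J' : ℝ, HasDerivAt (JF A u1 u2) J' t ∧ J' ≤ C * JF A u1 u2 t - m ^ 2 / 4 * DF p1 p2 t := by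
  obtain ⟨C, hC, hI⟩ := IF_bound hA hm hM
  refine ⟨C * (2 / m ^ 2), by positivity, ?_⟩
  intro b s0 s1 u1 p1 q1 v1 u2 p2 q2 v2 S1 S2 t ht h1 h2
  refine ⟨_, pair_deriv hA S1 S2 ht, ?_⟩
  have cu1 := slice_cont S1.cu ht
  have cu2 := slice_cont S2.cu ht
  have cp1 := slice_cont S1.cp ht
  have cp2 := slice_cont S2.cp ht
  have ca1 := Real.continuous_arctan.comp_continuousOn cp1
  have ca2 := Real.continuous_arctan.comp_continuousOn cp2
  have hpc := phiF_cont (2 * A / Real.pi)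
  have f1 := hpc.comp_continuousOn cu1.rexp
  have f2 := hpc.comp_continuousOn cu2.rexp
  simp only [Function.comp_def] at f1 f2 ca1 ca2
  have hIc : ContinuousOn (fun θ => IF A (Real.exp (u1 θ t)) (Real.exp (u2 θ t)) (p1 θ t) (p2 θ t)) (Icc 0 Real.pi) := by
    simp only [IF]
    fun_prop
  have h3 := int_mono hIc (g := fun θ => C * (Real.exp (u1 θ t) - Real.exp (u2 θ t)) ^ 2
      - m ^ 2 / 4 * ((Real.arctan (p1 θ t) - Real.arctan (p2 θ t)) * (p1 θ t - p2 θ t))) (by fun_prop)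
    (fun θ hθ => hI _ (h1 θ hθ) _ (h2 θ hθ) _ _)
  rw [intervalIntegral.integral_sub (slice_int (by fun_prop)) (slice_int (by fun_prop)),
    intervalIntegral.integral_const_mul, intervalIntegral.integral_const_mul] at h3
  refine h3.trans ?_
  have h4 := JF_lower hA hm cu1 cu2 h1 h2
  rw [DF]
  have h5 : C * (∫ θ in (0:ℝ)..Real.pi, (Real.exp (u1 θ t) - Real.exp (u2 θ t)) ^ 2)
      = C * (2 / m ^ 2) * (m ^ 2 / 2 * (∫ θ in (0:ℝ)..Real.pi, (Real.exp (u1 θ t) - Real.exp (u2 θ t)) ^ 2)) := by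
    field_simp
  rw [h5]
  have := mul_le_mul_of_nonneg_left h4 (by positivity : 0 ≤ C * (2 / m ^ 2))
  linarith

theorem DF_nonneg (p1 p2 : ℝ → ℝ → ℝ) (t : ℝ) : 0 ≤ DF p1 p2 t :=
  int_nonneg (fun _ _ => D_nonneg _ _)

theorem Sol.v_eq {A b s0 s1 : ℝ} {u p q v : ℝ → ℝ → ℝ} (S : Sol A b s0 s1 u p q v) {θ t : ℝ}
    (hθ : θ ∈ Icc 0 Real.pi) (ht : t ∈ Ioo s0 s1) :
    v θ t = Real.exp (-u θ t) ^ 2 * (q θ t / (1 + p θ t ^ 2) - 1)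
      + A * Real.exp (-u θ t) * Real.sqrt (1 + p θ t ^ 2) := by
  have h := S.pde θ hθ t ht
  have e : Real.exp (-u θ t) * Real.exp (u θ t) = 1 := by rw [← Real.exp_add]; simp
  have h2 : v θ t = Real.exp (-u θ t) ^ 2 * (Real.exp (u θ t) ^ 2 * v θ t) := by
    rw [← mul_assoc, ← mul_pow, e]; ring
  rw [h2, h]
  have h3 : Real.exp (-u θ t) ^ 2 * (q θ t / (1 + p θ t ^ 2) - 1 + A * Real.exp (u θ t) * Real.sqrt (1 + p θ t ^ 2))
    = Real.exp (-u θ t) ^ 2 * (q θ t / (1 + p θ t ^ 2) - 1)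
      + A * Real.exp (-u θ t) * Real.sqrt (1 + p θ t ^ 2) * (Real.exp (-u θ t) * Real.exp (u θ t)) := by ring
  rw [h3, e, mul_one]

theorem Sol.du_at {A b s0 s1 : ℝ} {u p q v : ℝ → ℝ → ℝ} (S : Sol A b s0 s1 u p q v) {θ t : ℝ}
    (hθ : θ ∈ Ioo 0 Real.pi) (ht : t ∈ Ioo s0 s1) : HasDerivAt (fun φ => u φ t) (p θ t) θ :=
  (S.du θ (Ioo_subset_Icc_self hθ) t ht).hasDerivAt (Icc_mem_nhds hθ.1 hθ.2)

theorem Sol.dp_at {A b s0 s1 : ℝ} {u p q v : ℝ → ℝ → ℝ} (S : Sol A b s0 s1 u p q v) {θ t : ℝ}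
    (hθ : θ ∈ Ioo 0 Real.pi) (ht : t ∈ Ioo s0 s1) : HasDerivAt (fun φ => p φ t) (q θ t) θ :=
  (S.dp θ (Ioo_subset_Icc_self hθ) t ht).hasDerivAt (Icc_mem_nhds hθ.1 hθ.2)

theorem sqrt_le_one_add {k K : ℝ} (hk0 : 0 ≤ k) (hk : k ≤ K) : Real.sqrt (1 + k ^ 2) ≤ 1 + K := by
  rw [Real.sqrt_le_left (by linarith)]
  nlinarith

theorem exp_bds {u U : ℝ} (h : |u| ≤ U) : Real.exp (-(2 * U)) ≤ Real.exp (-u) ^ 2 ∧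
    Real.exp (-u) ^ 2 ≤ Real.exp (2 * U) ∧ Real.exp (-u) ≤ Real.exp U := by
  have h := abs_le.1 h
  have e : Real.exp (-u) ^ 2 = Real.exp (-(2 * u)) := by rw [← Real.exp_nat_mul]; ring_nf
  rw [e]
  refine ⟨Real.exp_le_exp.2 (by linarith), Real.exp_le_exp.2 (by linarith), Real.exp_le_exp.2 (by linarith)⟩

theorem Lam_le {U N K k X : ℝ} (hN : 0 < N) (hk0 : 0 ≤ k) (hk : k ≤ K) (hX : Real.exp (-(2 * U)) ≤ X) :
    Real.exp (-(2 * U)) * N / (1 + K ^ 2) ≤ X * (N / (1 + k ^ 2)) := by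
  rw [mul_div_assoc]
  have := Real.exp_pos (-(2 * U))
  have hX0 : 0 ≤ X := this.le.trans hX
  gcongr

section lip
variable {A b s0 s1 : ℝ} {u p q v : ℝ → ℝ → ℝ} {t1 τ U K N ε δ l : ℝ}

/-- common hypotheses for the Lipschitz barrier -/
structure LH (A t1 τ U K N ε δ l s0 s1 : ℝ) : Prop where
  hA : 0 < A
  hτ : 0 < τ
  ht1 : s0 < t1
  ht2 : t1 + τ < s1
  hK : 0 < K
  hN : 0 < N
  hl : l = K / N
  hlpi : l < Real.pi
  hNbig : A * Real.exp U * (1 + K) + Real.exp (2 * U) + 1 < Real.exp (-(2 * U)) * N / (1 + K ^ 2)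
  hε : 0 < ε
  hεl : ε ≤ l
  hετ : 2 * ε / τ ≤ 1
  hδ : 0 < δ

noncomputable def psiF (t1 τ K N ε δ s t : ℝ) : ℝ :=
  2 * ε * (1 - (t - t1) / τ) + δ + K * s - N * s ^ 2 / 2

theorem psi_ds (s t : ℝ) : HasDerivAt (fun s => psiF t1 τ K N ε δ s t) (K - N * s) s := by
  have := (((hasDerivAt_id s).const_mul K).const_add (2 * ε * (1 - (t - t1) / τ) + δ)).sub
    (((hasDerivAt_pow 2 s).const_mul N).div_const 2)
  refine this.congr_deriv ?_
  norm_num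
  ring

theorem psi_dt (s t : ℝ) : HasDerivAt (fun t => psiF t1 τ K N ε δ s t) (-(2 * ε / τ)) t := by
  have := ((((((hasDerivAt_id t).sub_const t1).div_const τ).const_sub 1).const_mul (2 * ε)).add_const δ).add_const (K * s) |>.sub_const (N * s ^ 2 / 2)
  refine this.congr_deriv ?_
  ring

theorem psi_ge (h : LH A t1 τ U K N ε δ l s0 s1) {s t : ℝ} (hs0 : 0 ≤ s) (hs : s ≤ l) (ht : t ≤ t1 + τ) :
    δ + K / 2 * s ≤ psiF t1 τ K N ε δ s t := by
  have hN := h.hN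
  have hτ := h.hτ
  have hε := h.hε
  have h1 : (t - t1) / τ ≤ 1 := (div_le_one hτ).2 (by linarith)
  have h2 : 0 ≤ 2 * ε * (1 - (t - t1) / τ) := mul_nonneg (by linarith) (by linarith)
  have h3 : N * s ≤ K := by
    have := h.hl
    rw [this, le_div_iff₀ hN] at hs
    linarith
  rw [psiF]
  nlinarith

theorem psi_init (h : LH A t1 τ U K N ε δ l s0 s1) {s : ℝ} (hs0 : 0 ≤ s) (hs : s ≤ l) :
    2 * ε + δ + K / 2 * s ≤ psiF t1 τ K N ε δ s t1 := by
  have hN := h.hN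
  have h3 : N * s ≤ K := by
    have := h.hl
    rw [this, le_div_iff₀ hN] at hs
    linarith
  rw [psiF, sub_self, zero_div]
  nlinarith

theorem onept (S : Sol A b s0 s1 u p q v) (h : LH A t1 τ U K N ε δ l s0 s1)
    (hU : ∀ θ ∈ Icc 0 Real.pi, ∀ t ∈ Icc t1 (t1 + τ), |u θ t| ≤ U) (σ : ℝ) (hσ : σ = 1 ∨ σ = -1)
    (hosc : ∀ x ∈ Icc 0 Real.pi, ∀ t ∈ Icc t1 (t1 + τ), σ * (u x t - b) ≤ ε + (K / 2 - 1) * x) :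
    ∀ x ∈ Icc 0 l, ∀ t ∈ Icc t1 (t1 + τ), σ * (u x t - b) - psiF t1 τ K N ε δ x t < 0 := by
  have hsub : ∀ t ∈ Icc t1 (t1 + τ), t ∈ Ioo s0 s1 := fun t ht =>
    ⟨h.ht1.trans_le ht.1, ht.2.trans_lt h.ht2⟩
  have hlpi := h.hlpi
  have hε := h.hε
  have hεl := h.hεl
  have hδ := h.hδ
  have hIcc : Icc 0 l ⊆ Icc 0 Real.pi := Icc_subset_Icc le_rfl hlpi.le
  apply first_touch isCompact_Icc (f := fun x t => σ * (u x t - b) - psiF t1 τ K N ε δ x t)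
  · have := S.cu.mono (prod_mono hIcc hsub)
    unfold psiF
    fun_prop
  · intro x hx
    have h1 := hosc x (hIcc hx) t1 ⟨le_rfl, by linarith [h.hτ]⟩
    have h2 := psi_init h hx.1 hx.2
    nlinarith [hx.1]
  · intro x hx t ht hf hmax hbef
    have htt : t ∈ Icc t1 (t1 + τ) := ⟨ht.1.le, ht.2⟩
    have hts := hsub t htt
    -- x is interior
    have hx0 : 0 < x := by
      rcases eq_or_lt_of_le hx.1 with h0 | h0
      · exfalso
        rw [← h0, S.b0 t hts, sub_self, mul_zero] at hf
        have := psi_ge h (le_refl 0) (by linarith) ht.2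
        linarith
      · exact h0
    have hxl : x < l := by
      rcases eq_or_lt_of_le hx.2 with h0 | h0
      · exfalso
        have h1 := hosc x (hIcc hx) t htt
        have h2 := psi_ge h hx.1 hx.2 ht.2
        nlinarith
      · exact h0
    have hxpi : x ∈ Ioo 0 Real.pi := ⟨hx0, hxl.trans hlpi⟩
    have hloc : IsLocalMax (fun y => σ * (u y t - b) - psiF t1 τ K N ε δ y t) x := by
      filter_upwards [Icc_mem_nhds hx0 hxl] with y hy
      rw [hf]
      exact hmax y hy
    obtain ⟨g1, g2⟩ := second_test _ (fun y => σ * p y t - (K - N * y)) x (σ * q x t - (0 - N * 1)) hloc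
      (by
        filter_upwards [Ioo_mem_nhds hx0 (hxl.trans hlpi)] with y hy
        exact (((S.du_at hy hts).sub_const b).const_mul σ).sub (psi_ds y t))
      (((S.dp_at hxpi hts).const_mul σ).sub
        ((hasDerivAt_const x K).sub ((hasDerivAt_id x).const_mul N)))
    have g3 := deriv_nonneg_of_left (fun t => σ * (u x t - b) - psiF t1 τ K N ε δ x t) _ t1 t ht.1
      ((((S.dt x (Ioo_subset_Icc_self hxpi) t hts).sub_const b).const_mul σ).sub (psi_dt x t)) hf hbef
    have hv := S.v_eq (Ioo_subset_Icc_self hxpi) hts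
    obtain ⟨e1, e2, e3⟩ := exp_bds (hU x (hIcc hx) t htt)
    have hN := h.hN
    have hKN : N * x ≤ K := by
      have := h.hl
      rw [this, lt_div_iff₀ hN] at hxl
      linarith
    set k := K - N * x with hk
    have hk0 : 0 ≤ k := by linarith
    have hkK : k ≤ K := by nlinarith
    have hL := Lam_le hN hk0 hkK e1
    have hNb := h.hNbig
    have hετ := h.hετ
    have hA := h.hA
    have hexpU := Real.exp_pos U
    have hE : 0 < Real.exp (-u x t) := Real.exp_pos _
    have hE2 : 0 < Real.exp (2 * U) := Real.exp_pos _
    rcases hσ with rfl | rfl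
    · have hp : p x t = k := by linarith
      have hq : q x t ≤ -N := by linarith
      rw [hp] at hv
      have hs := sqrt_le_one_add hk0 hkK
      have a1 : A * Real.exp (-u x t) * Real.sqrt (1 + k ^ 2) ≤ A * Real.exp U * (1 + K) := by gcongr
      have a2 : q x t / (1 + k ^ 2) ≤ -(N / (1 + k ^ 2)) := by
        rw [← neg_div]; gcongr
      have a3 : Real.exp (-u x t) ^ 2 * (q x t / (1 + k ^ 2)) ≤ Real.exp (-u x t) ^ 2 * (-(N / (1 + k ^ 2))) :=
        mul_le_mul_of_nonneg_left a2 (by positivity)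
      have a4 : 0 ≤ Real.exp (-u x t) ^ 2 := by positivity
      nlinarith
    · have hp : p x t = -k := by linarith
      have hq : N ≤ q x t := by linarith
      rw [hp, neg_sq] at hv
      have a1 : 0 ≤ A * Real.exp (-u x t) * Real.sqrt (1 + k ^ 2) := by positivity
      have a2 : N / (1 + k ^ 2) ≤ q x t / (1 + k ^ 2) := by gcongr
      have a3 : Real.exp (-u x t) ^ 2 * (N / (1 + k ^ 2)) ≤ Real.exp (-u x t) ^ 2 * (q x t / (1 + k ^ 2)) :=
        mul_le_mul_of_nonneg_left a2 (by positivity)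
      have a4 : 0 ≤ A * Real.exp U * (1 + K) := by have := h.hK; positivity
      nlinarith

set_option maxHeartbeats 1000000 in
theorem twopt (S : Sol A b s0 s1 u p q v) (h : LH A t1 τ U K N ε δ l s0 s1)
    (hU : ∀ θ ∈ Icc 0 Real.pi, ∀ t ∈ Icc t1 (t1 + τ), |u θ t| ≤ U)
    (hosc : ∀ x ∈ Icc 0 Real.pi, ∀ y ∈ Icc 0 Real.pi, ∀ t ∈ Icc t1 (t1 + τ),
      u x t - u y t ≤ ε + (K / 2 - 1) * |x - y|) :
    ∀ x ∈ Icc 0 Real.pi, ∀ y ∈ Icc 0 Real.pi, y ≤ x → x - y ≤ l → ∀ t ∈ Icc t1 (t1 + τ),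
      u x t - u y t - psiF t1 τ K N ε δ (x - y) t < 0 := by
  have hsub : ∀ t ∈ Icc t1 (t1 + τ), t ∈ Ioo s0 s1 := fun t ht =>
    ⟨h.ht1.trans_le ht.1, ht.2.trans_lt h.ht2⟩
  have hlpi := h.hlpi
  have hε := h.hε
  have hεl := h.hεl
  have hδ := h.hδ
  have hpi := Real.pi_pos
  have hz : (0:ℝ) ∈ Icc 0 Real.pi := ⟨le_rfl, hpi.le⟩
  have hpz : Real.pi ∈ Icc 0 Real.pi := ⟨hpi.le, le_rfl⟩
  have hup := onept S h hU 1 (Or.inl rfl) (fun x hx t ht => by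
    have := hosc x hx 0 hz t ht
    rw [S.b0 t (hsub t ht), sub_zero, abs_of_nonneg hx.1] at this
    linarith)
  have hdn := onept S.reflect h (fun θ hθ t ht => hU _ ⟨by linarith [hθ.2], by linarith [hθ.1]⟩ t ht)
    (-1) (Or.inr rfl) (fun x hx t ht => by
    have := hosc Real.pi hpz (Real.pi - x) ⟨by linarith [hx.2], by linarith [hx.1]⟩ t ht
    rw [S.b1 t (hsub t ht), sub_sub_cancel, abs_of_nonneg hx.1] at this
    linarith)
  set Kset : Set (ℝ × ℝ) := {z | z.1 ∈ Icc 0 Real.pi ∧ z.2 ∈ Icc 0 Real.pi ∧ z.2 ≤ z.1 ∧ z.1 - z.2 ≤ l} with hKs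
  have hKc : IsCompact Kset := by
    have hclosed : IsClosed {z : ℝ × ℝ | z.2 ≤ z.1 ∧ z.1 - z.2 ≤ l} :=
      (isClosed_le continuous_snd continuous_fst).inter
        (isClosed_le (continuous_fst.sub continuous_snd) continuous_const)
    have : Kset = (Icc 0 Real.pi ×ˢ Icc 0 Real.pi) ∩ {z : ℝ × ℝ | z.2 ≤ z.1 ∧ z.1 - z.2 ≤ l} := by
      ext z
      constructor
      · rintro ⟨a, b, c, d⟩
        exact ⟨⟨a, b⟩, c, d⟩
      · rintro ⟨⟨a, b⟩, c, d⟩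
        exact ⟨a, b, c, d⟩
    rw [this]
    exact (isCompact_Icc.prod isCompact_Icc).inter_right hclosed
  have main := first_touch hKc (fun (z : ℝ × ℝ) t => u z.1 t - u z.2 t - psiF t1 τ K N ε δ (z.1 - z.2) t)
    t1 (t1 + τ) ?_ ?_ ?_
  · intro x hx y hy hyx hxy t ht
    exact main (x, y) ⟨hx, hy, hyx, hxy⟩ t ht
  · have c1 : ContinuousOn (fun w : (ℝ × ℝ) × ℝ => u w.1.1 w.2) (Kset ×ˢ Icc t1 (t1 + τ)) :=
      S.cu.comp (f := fun w : (ℝ × ℝ) × ℝ => (w.1.1, w.2)) (by fun_prop)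
        (fun w hw => ⟨hw.1.1, hsub _ hw.2⟩)
    have c2 : ContinuousOn (fun w : (ℝ × ℝ) × ℝ => u w.1.2 w.2) (Kset ×ˢ Icc t1 (t1 + τ)) :=
      S.cu.comp (f := fun w : (ℝ × ℝ) × ℝ => (w.1.2, w.2)) (by fun_prop)
        (fun w hw => ⟨hw.1.2.1, hsub _ hw.2⟩)
    refine (c1.sub c2).sub (Continuous.continuousOn ?_)
    unfold psiF
    fun_prop
  · rintro ⟨x, y⟩ ⟨hx, hy, hyx, hxy⟩
    simp only at hx hy hyx hxy ⊢
    have h1 := hosc x hx y hy t1 ⟨le_rfl, by linarith [h.hτ]⟩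
    rw [abs_of_nonneg (by linarith)] at h1
    have h2 := psi_init h (sub_nonneg.2 hyx) hxy
    nlinarith
  · rintro ⟨x, y⟩ ⟨hx, hy, hyx, hxy⟩ t ht hf hmax hbef
    simp only at hx hy hyx hxy hf hbef
    have htt : t ∈ Icc t1 (t1 + τ) := ⟨ht.1.le, ht.2⟩
    have hts := hsub t htt
    have hne : y < x := by
      rcases eq_or_lt_of_le hyx with h0 | h0
      · exfalso
        rw [h0, sub_self, sub_self] at hf
        have := psi_ge h (le_refl 0) (by linarith) ht.2
        linarith
      · exact h0
    have hltl : x - y < l := by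
      rcases eq_or_lt_of_le hxy with h0 | h0
      · exfalso
        have h1 := hosc x hx y hy t htt
        rw [abs_of_nonneg (by linarith)] at h1
        have h2 := psi_ge h (sub_nonneg.2 hyx) hxy ht.2
        nlinarith
      · exact h0
    have hy0 : 0 < y := by
      rcases eq_or_lt_of_le hy.1 with h0 | h0
      · exfalso
        rw [← h0] at hf hxy
        rw [S.b0 t hts, sub_zero] at hf
        have := hup x ⟨hx.1, by linarith⟩ t htt
        linarith
      · exact h0
    have hxpi : x < Real.pi := by
      rcases eq_or_lt_of_le hx.2 with h0 | h0
      · exfalso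
        rw [h0] at hf hxy
        rw [S.b1 t hts] at hf
        have := hdn (Real.pi - y) ⟨by linarith [hy.2], by linarith⟩ t htt
        simp only [sub_sub_cancel] at this
        linarith
      · exact h0
    have hx0 : 0 < x := hy0.trans hne
    have hypi : y < Real.pi := hne.trans hxpi
    have hN := h.hN
    set k := K - N * (x - y) with hk
    -- first order conditions
    have hpx : p x t = k := by
      have hloc : IsLocalMax (fun z => u z t - u y t - psiF t1 τ K N ε δ (z - y) t) x := by
        filter_upwards [Ioo_mem_nhds hx0 hxpi, Ioo_mem_nhds hne (show x < y + l by linarith)] with z hz hz2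
        rw [hf]
        exact hmax (z, y) ⟨Ioo_subset_Icc_self hz, hy, hz2.1.le, by linarith [hz2.2]⟩
      have hd : HasDerivAt (fun z => u z t - u y t - psiF t1 τ K N ε δ (z - y) t)
          (p x t - k) x :=
        ((S.du_at ⟨hx0, hxpi⟩ hts).sub_const _).sub ((psi_ds (x - y) t).comp_sub_const x y)
      have := hloc.hasDerivAt_eq_zero hd
      linarith
    have hpy : p y t = k := by
      have hloc : IsLocalMax (fun z => u x t - u z t - psiF t1 τ K N ε δ (x - z) t) y := by
        filter_upwards [Ioo_mem_nhds hy0 hypi, Ioo_mem_nhds (show x - l < y by linarith) hne] with z hz hz2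
        rw [hf]
        exact hmax (x, z) ⟨hx, Ioo_subset_Icc_self hz, hz2.2.le, by linarith [hz2.1]⟩
      have hd : HasDerivAt (fun z => u x t - u z t - psiF t1 τ K N ε δ (x - z) t)
          (-(p y t) - -k) y :=
        ((S.du_at ⟨hy0, hypi⟩ hts).const_sub _).sub ((psi_ds (x - y) t).comp_const_sub x y)
      have := hloc.hasDerivAt_eq_zero hd
      linarith
    set al := Real.exp (-u x t) with hal
    set be := Real.exp (-u y t) with hbe
    have hal0 : 0 < al := Real.exp_pos _
    have hbe0 : 0 < be := Real.exp_pos _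
    -- second order
    have h2nd : al * al * q x t - be * be * q y t + N * (al + be) * (al + be) ≤ 0 := by
      have cx : Filter.Tendsto (fun e : ℝ => x + al * e) (nhds 0) (nhds x) := by
        have : Continuous (fun e : ℝ => x + al * e) := by fun_prop
        simpa using this.tendsto 0
      have cy : Filter.Tendsto (fun e : ℝ => y - be * e) (nhds 0) (nhds y) := by
        have : Continuous (fun e : ℝ => y - be * e) := by fun_prop
        simpa using this.tendsto 0
      have cxy : Filter.Tendsto (fun e : ℝ => (x + al * e) - (y - be * e)) (nhds 0) (nhds (x - y)) := cx.sub cy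
      have ev1 := cx.eventually (Ioo_mem_nhds hx0 hxpi)
      have ev2 := cy.eventually (Ioo_mem_nhds hy0 hypi)
      have ev3 := cxy.eventually (Ioo_mem_nhds (sub_pos.2 hne) hltl)
      have hloc : IsLocalMax (fun e => u (x + al * e) t - u (y - be * e) t
          - psiF t1 τ K N ε δ ((x + al * e) - (y - be * e)) t) 0 := by
        filter_upwards [ev1, ev2, ev3] with e a1 a2 a3
        simp only [mul_zero, add_zero, sub_zero]
        rw [hf]
        exact hmax (x + al * e, y - be * e) ⟨Ioo_subset_Icc_self a1, Ioo_subset_Icc_self a2,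
          by linarith [a3.1], a3.2.le⟩
      have dX : ∀ e : ℝ, HasDerivAt (fun e => x + al * e) al e := fun e => by
        have := ((hasDerivAt_id e).const_mul al).const_add x
        simpa using this
      have dY : ∀ e : ℝ, HasDerivAt (fun e => y - be * e) (-be) e := fun e => by
        have := ((hasDerivAt_id e).const_mul be).const_sub y
        simpa using this
      have dXY : ∀ e : ℝ, HasDerivAt (fun e => (x + al * e) - (y - be * e)) (al - -be) e :=
        fun e => (dX e).sub (dY e)
      obtain ⟨_, g2⟩ := second_test _ (fun e => p (x + al * e) t * al - p (y - be * e) t * (-be)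
          - (K - N * ((x + al * e) - (y - be * e))) * (al - -be)) 0
          (q x t * al * al - q y t * (-be) * (-be) - (0 - N * (al - -be)) * (al - -be)) hloc
        (by
          filter_upwards [ev1, ev2, ev3] with e a1 a2 a3
          exact (((S.du_at a1 hts).comp e (dX e)).sub ((S.du_at a2 hts).comp e (dY e))).sub
            ((psi_ds _ t).comp e (dXY e)))
        (by
          have hx' : HasDerivAt (fun φ => p φ t) (q x t) (x + al * 0) := by
            simpa using S.dp_at ⟨hx0, hxpi⟩ hts
          have hy' : HasDerivAt (fun φ => p φ t) (q y t) (y - be * 0) := by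
            simpa using S.dp_at ⟨hy0, hypi⟩ hts
          exact (((hx'.comp 0 (dX 0)).mul_const al).sub ((hy'.comp 0 (dY 0)).mul_const (-be))).sub
            (((hasDerivAt_const (0:ℝ) K).sub ((dXY 0).const_mul N)).mul_const _))
      nlinarith
    have g3 := deriv_nonneg_of_left (fun t => u x t - u y t - psiF t1 τ K N ε δ (x - y) t) _ t1 t ht.1
      (((S.dt x hx t hts).sub (S.dt y hy t hts)).sub (psi_dt (x - y) t)) hf hbef
    have hvx := S.v_eq hx hts
    have hvy := S.v_eq hy hts
    rw [hpx, ← hal] at hvx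
    rw [hpy, ← hbe] at hvy
    obtain ⟨e1, e2, e3⟩ := exp_bds (hU x hx t htt)
    obtain ⟨f1, f2, f3⟩ := exp_bds (hU y hy t htt)
    rw [← hal] at e1 e2 e3
    rw [← hbe] at f1 f2 f3
    have hKN : N * (x - y) ≤ K := by
      have := h.hl
      rw [this, lt_div_iff₀ hN] at hltl
      linarith
    have hk0 : 0 ≤ k := by linarith
    have hkK : k ≤ K := by nlinarith
    have hX : Real.exp (-(2 * U)) ≤ (al + be) * (al + be) := by nlinarith
    have hL := Lam_le hN hk0 hkK hX
    have hs := sqrt_le_one_add hk0 hkK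
    have hA := h.hA
    have a1 : A * al * Real.sqrt (1 + k ^ 2) ≤ A * Real.exp U * (1 + K) := by
      have := Real.exp_pos U
      gcongr
    have a1' : 0 ≤ A * be * Real.sqrt (1 + k ^ 2) := by positivity
    have hk2 : 0 < 1 + k ^ 2 := by positivity
    have a2 : al ^ 2 * (q x t / (1 + k ^ 2)) - be ^ 2 * (q y t / (1 + k ^ 2))
        ≤ -((al + be) * (al + be) * (N / (1 + k ^ 2))) := by
      have : al ^ 2 * (q x t / (1 + k ^ 2)) - be ^ 2 * (q y t / (1 + k ^ 2))
        + (al + be) * (al + be) * (N / (1 + k ^ 2))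
        = (al * al * q x t - be * be * q y t + N * (al + be) * (al + be)) / (1 + k ^ 2) := by
        simp only [div_eq_mul_inv]
        ring
      have h3 := div_nonpos_of_nonpos_of_nonneg h2nd hk2.le
      linarith
    have hNb := h.hNbig
    have hετ := h.hετ
    have : 0 < al ^ 2 := by positivity
    rw [hvx, hvy, mul_sub, mul_sub] at g3
    linarith
end lip

/-- gradient bound from C0 closeness to a Lipschitz function -/
theorem grad_bound {A U G τ : ℝ} (hA : 0 < A) (hG : 0 ≤ G) (hτ : 0 < τ) :
    ∃ ε K : ℝ, 0 < ε ∧ 0 < K ∧ ∀ (b s0 s1 : ℝ) (u p q v : ℝ → ℝ → ℝ), Sol A b s0 s1 u p q v →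
    ∀ t1, s0 < t1 → t1 + τ < s1 →
    (∀ θ ∈ Icc 0 Real.pi, ∀ t ∈ Icc t1 (t1 + τ), |u θ t| ≤ U) →
    (∀ x ∈ Icc 0 Real.pi, ∀ y ∈ Icc 0 Real.pi, ∀ t ∈ Icc t1 (t1 + τ),
      u x t - u y t ≤ ε + G * |x - y|) → ∀ θ ∈ Icc 0 Real.pi, |p θ (t1 + τ)| ≤ K := by
  set K := 2 * G + 2 with hK
  have hKp : 0 < K := by linarith
  set Bd := A * Real.exp U * (1 + K) + Real.exp (2 * U) + 1 with hBd
  have hBdp : 0 < Bd := by positivity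
  set N := (Bd + 1) * (1 + K ^ 2) / Real.exp (-(2 * U)) + K with hN
  have hE := Real.exp_pos (-(2 * U))
  have hNp : 0 < N := by positivity
  have hNK : K ≤ N := by
    have : 0 ≤ (Bd + 1) * (1 + K ^ 2) / Real.exp (-(2 * U)) := by positivity
    linarith
  have hNbig : Bd < Real.exp (-(2 * U)) * N / (1 + K ^ 2) := by
    have h1 : Real.exp (-(2 * U)) * N = (Bd + 1) * (1 + K ^ 2) + Real.exp (-(2 * U)) * K := by
      rw [hN]; field_simp
    rw [lt_div_iff₀ (by positivity), h1]
    have : 0 < Real.exp (-(2 * U)) * K := by positivity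
    nlinarith [sq_nonneg K]
  set l := K / N with hl
  have hlp : 0 < l := by positivity
  have hl1 : l ≤ 1 := (div_le_one hNp).2 hNK
  set ε := min l (τ / 2) with hε
  have hεp : 0 < ε := lt_min hlp (by linarith)
  refine ⟨ε, K, hεp, hKp, ?_⟩
  -- one sided
  have one : ∀ (b s0 s1 : ℝ) (u p q v : ℝ → ℝ → ℝ), Sol A b s0 s1 u p q v →
    ∀ t1, s0 < t1 → t1 + τ < s1 →
    (∀ θ ∈ Icc 0 Real.pi, ∀ t ∈ Icc t1 (t1 + τ), |u θ t| ≤ U) →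
    (∀ x ∈ Icc 0 Real.pi, ∀ y ∈ Icc 0 Real.pi, ∀ t ∈ Icc t1 (t1 + τ),
      u x t - u y t ≤ ε + G * |x - y|) → ∀ θ ∈ Icc 0 Real.pi, p θ (t1 + τ) ≤ K := by
    intro b s0 s1 u p q v S t1 h1 h2 hU hosc
    have hlip : ∀ x ∈ Icc 0 Real.pi, ∀ y ∈ Icc 0 Real.pi, y ≤ x → x - y ≤ l →
        u x (t1 + τ) - u y (t1 + τ) ≤ K * (x - y) := by
      intro x hx y hy hyx hxy
      apply le_of_forall_pos_le_add
      intro δ hδ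
      have LHH : LH A t1 τ U K N ε δ l s0 s1 :=
        ⟨hA, hτ, h1, h2, hKp, hNp, hl, by linarith [Real.pi_gt_three], hNbig, hεp, min_le_left _ _,
          by
            rw [div_le_one hτ]
            have := min_le_right l (τ / 2)
            linarith, hδ⟩
      have := twopt S LHH hU (fun x hx y hy t ht => by
        have := hosc x hx y hy t ht
        have e : K / 2 - 1 = G := by rw [hK]; ring
        rw [e]; exact this) x hx y hy hyx hxy (t1 + τ) ⟨by linarith, le_rfl⟩
      rw [psiF, add_sub_cancel_left, div_self hτ.ne', sub_self, mul_zero, zero_add] at this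
      have h3 : 0 ≤ N * (x - y) ^ 2 / 2 := by positivity
      linarith
    have hts : t1 + τ ∈ Ioo s0 s1 := ⟨by linarith, h2⟩
    intro θ hθ
    have hd := S.du θ hθ _ hts
    rcases lt_or_ge θ Real.pi with hlt | hge
    · have h3 : Filter.Tendsto (slope (fun φ => u φ (t1 + τ)) θ) (nhdsWithin θ (Ioo θ Real.pi)) (nhds (p θ (t1 + τ))) := by
        have := hasDerivWithinAt_iff_tendsto_slope.1 hd
        exact this.mono_left (nhdsWithin_mono _ (fun x hx => ⟨⟨hθ.1.trans hx.1.le, hx.2.le⟩, fun h => (ne_of_gt hx.1) h⟩))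
      have : (nhdsWithin θ (Ioo θ Real.pi)).NeBot := by
        rw [← mem_closure_iff_nhdsWithin_neBot, closure_Ioo hlt.ne]
        exact ⟨le_rfl, hlt.le⟩
      refine le_of_tendsto h3 ?_
      have hn : Iio (θ + l) ∈ nhdsWithin θ (Ioo θ Real.pi) := mem_nhdsWithin_of_mem_nhds (Iio_mem_nhds (by linarith))
      filter_upwards [self_mem_nhdsWithin, hn] with x hx hx2
      have hx2 : x < θ + l := hx2
      rw [slope_def_field, div_le_iff₀ (by linarith [hx.1])]
      exact hlip x ⟨hθ.1.trans hx.1.le, hx.2.le⟩ θ hθ hx.1.le (by linarith)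
    · have h3 : Filter.Tendsto (slope (fun φ => u φ (t1 + τ)) θ) (nhdsWithin θ (Ioo 0 θ)) (nhds (p θ (t1 + τ))) := by
        have := hasDerivWithinAt_iff_tendsto_slope.1 hd
        exact this.mono_left (nhdsWithin_mono _ (fun x hx => ⟨⟨hx.1.le, hx.2.le.trans hθ.2⟩, fun h => (ne_of_lt hx.2) h⟩))
      have h0 : 0 < θ := Real.pi_pos.trans_le hge
      have : (nhdsWithin θ (Ioo 0 θ)).NeBot := by
        rw [← mem_closure_iff_nhdsWithin_neBot, closure_Ioo h0.ne]
        exact ⟨h0.le, le_rfl⟩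
      refine le_of_tendsto h3 ?_
      have hn : Ioi (θ - l) ∈ nhdsWithin θ (Ioo 0 θ) := mem_nhdsWithin_of_mem_nhds (Ioi_mem_nhds (by linarith))
      filter_upwards [self_mem_nhdsWithin, hn] with x hx hx2
      have hx2 : θ - l < x := hx2
      rw [slope_def_field, div_le_iff_of_neg (by linarith [hx.2])]
      have := hlip θ hθ x ⟨hx.1.le, hx.2.le.trans hθ.2⟩ hx.2.le (by linarith)
      linarith
  intro b s0 s1 u p q v S t1 h1 h2 hU hosc θ hθ
  have hr : ∀ θ ∈ Icc 0 Real.pi, Real.pi - θ ∈ Icc 0 Real.pi :=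
    fun t ht => ⟨by linarith [ht.2], by linarith [ht.1]⟩
  have r1 := one b s0 s1 u p q v S t1 h1 h2 hU hosc θ hθ
  have r2 := one b s0 s1 _ _ _ _ S.reflect t1 h1 h2 (fun θ hθ t ht => hU _ (hr θ hθ) t ht)
    (fun x hx y hy t ht => by
      have := hosc _ (hr x hx) _ (hr y hy) t ht
      have e : Real.pi - x - (Real.pi - y) = -(x - y) := by ring
      rw [e, abs_neg] at this
      exact this) (Real.pi - θ) (hr θ hθ)
  simp only [sub_sub_cancel] at r2
  rw [abs_le]; constructor <;> linarith

theorem exp_neg_lip {a b U : ℝ} (ha : |a| ≤ U) (hb : |b| ≤ U) :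
    |Real.exp (-a) - Real.exp (-b)| ≤ Real.exp U * |a - b| := by
  have key : ∀ x y : ℝ, |x| ≤ U → |y| ≤ U → Real.exp (-x) - Real.exp (-y) ≤ Real.exp U * |x - y| := by
    intro x y hx hy
    have h1 : Real.exp (-y) = Real.exp (-x) * Real.exp (x - y) := by rw [← Real.exp_add]; ring_nf
    have h2 := Real.add_one_le_exp (x - y)
    have h3 : Real.exp (-x) ≤ Real.exp U := Real.exp_le_exp.2 (by have := (abs_le.1 hx).1; linarith)
    have h4 := Real.exp_pos (-x)
    have h5 : Real.exp (-x) - Real.exp (-y) ≤ Real.exp (-x) * |x - y| := by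
      rw [h1]
      have := neg_abs_le (x - y)
      nlinarith
    exact h5.trans (mul_le_mul_of_nonneg_right h3 (abs_nonneg _))
  rw [abs_le]
  constructor
  · have := key b a hb ha
    rw [abs_sub_comm] at this
    linarith
  · exact key a b ha hb

theorem exp_neg_sq_lip {a b U : ℝ} (ha : |a| ≤ U) (hb : |b| ≤ U) :
    |Real.exp (-a) ^ 2 - Real.exp (-b) ^ 2| ≤ 2 * Real.exp (2 * U) * |a - b| := by
  have h := exp_neg_lip ha hb
  have e1 := (exp_bds ha).2.2
  have e2 := (exp_bds hb).2.2
  have e : Real.exp (2 * U) = Real.exp U * Real.exp U := by rw [← Real.exp_add]; ring_nf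
  have p1 := Real.exp_pos (-a)
  have p2 := Real.exp_pos (-b)
  have : Real.exp (-a) ^ 2 - Real.exp (-b) ^ 2 = (Real.exp (-a) + Real.exp (-b)) * (Real.exp (-a) - Real.exp (-b)) := by ring
  rw [this, abs_mul, abs_of_pos (by positivity), e]
  calc _ ≤ (Real.exp U + Real.exp U) * (Real.exp U * |a - b|) := by gcongr
    _ = _ := by ring

set_option maxHeartbeats 1000000 in
/-- stability in C0, one sign -/
theorem c0_stab_one {A b s0 s1 U G H t1 t2 L ε σ : ℝ} {u1 p1 q1 v1 u2 p2 q2 v2 : ℝ → ℝ → ℝ}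
    (hA : 0 < A) (hG : 0 ≤ G)
    (S1 : Sol A b s0 s1 u1 p1 q1 v1) (S2 : Sol A b s0 s1 u2 p2 q2 v2)
    (ht1 : s0 < t1) (ht2 : t2 < s1)
    (hU : ∀ θ ∈ Icc 0 Real.pi, ∀ t ∈ Icc t1 t2, |u2 θ t| ≤ U)
    (hp : ∀ θ ∈ Icc 0 Real.pi, ∀ t ∈ Icc t1 t2, |p2 θ t| ≤ G)
    (hq : ∀ θ ∈ Icc 0 Real.pi, ∀ t ∈ Icc t1 t2, |q2 θ t| ≤ H)
    (hL : L = 2 * Real.exp (2 * (U + 1)) * (H + 1) + A * Real.exp (U + 1) * (1 + G) + 1)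
    (hε : 0 < ε) (hε1 : ε * Real.exp (L * (t2 - t1)) ≤ 1) (hL0 : 0 ≤ L) (hσ : σ = 1 ∨ σ = -1)
    (hinit : ∀ θ ∈ Icc 0 Real.pi, σ * (u1 θ t1 - u2 θ t1) < ε) :
    ∀ θ ∈ Icc 0 Real.pi, ∀ t ∈ Icc t1 t2,
      σ * (u1 θ t - u2 θ t) - ε * Real.exp (L * (t - t1)) < 0 := by
  have hsub : ∀ t ∈ Icc t1 t2, t ∈ Ioo s0 s1 := fun t ht =>
    ⟨ht1.trans_le ht.1, ht.2.trans_lt ht2⟩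
  apply first_touch isCompact_Icc (f := fun x t => σ * (u1 x t - u2 x t) - ε * Real.exp (L * (t - t1)))
  · have c1 := S1.cu.mono (prod_mono (subset_refl (Icc 0 Real.pi)) hsub)
    have c2 := S2.cu.mono (prod_mono (subset_refl (Icc 0 Real.pi)) hsub)
    exact ((c1.sub c2).const_smul σ).sub (Continuous.continuousOn (by fun_prop))
  · intro x hx
    simpa using hinit x hx
  · intro x hx t ht hf hmax hbef
    have htt : t ∈ Icc t1 t2 := ⟨ht.1.le, ht.2⟩
    have hts := hsub t htt
    have hw0 : 0 < ε * Real.exp (L * (t - t1)) := by positivity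
    have hx0 : 0 < x := by
      rcases eq_or_lt_of_le hx.1 with h0 | h0
      · exfalso
        rw [← h0, S1.b0 t hts, S2.b0 t hts] at hf
        rw [sub_self, mul_zero] at hf
        linarith
      · exact h0
    have hxpi : x < Real.pi := by
      rcases eq_or_lt_of_le hx.2 with h0 | h0
      · exfalso
        rw [h0, S1.b1 t hts, S2.b1 t hts] at hf
        rw [sub_self, mul_zero] at hf
        linarith
      · exact h0
    have hxx : x ∈ Ioo 0 Real.pi := ⟨hx0, hxpi⟩
    have hloc : IsLocalMax (fun y => σ * (u1 y t - u2 y t) - ε * Real.exp (L * (t - t1))) x := by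
      filter_upwards [Icc_mem_nhds hx0 hxpi] with y hy
      rw [hf]
      exact hmax y hy
    obtain ⟨g1, g2⟩ := second_test _ (fun y => σ * (p1 y t - p2 y t)) x (σ * (q1 x t - q2 x t)) hloc
      (by
        filter_upwards [Ioo_mem_nhds hx0 hxpi] with y hy
        exact (((S1.du_at hy hts).sub (S2.du_at hy hts)).const_mul σ).sub_const _)
      (((S1.dp_at hxx hts).sub (S2.dp_at hxx hts)).const_mul σ)
    have dE : HasDerivAt (fun t => ε * Real.exp (L * (t - t1))) (ε * (Real.exp (L * (t - t1)) * (L * 1))) t :=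
      ((((hasDerivAt_id t).sub_const t1).const_mul L).exp).const_mul ε
    have g3 := deriv_nonneg_of_left (fun t => σ * (u1 x t - u2 x t) - ε * Real.exp (L * (t - t1))) _ t1 t ht.1
      ((((S1.dt x hx t hts).sub (S2.dt x hx t hts)).const_mul σ).sub dE) hf hbef
    have hv1 := S1.v_eq hx hts
    have hv2 := S2.v_eq hx hts
    have hσ0 : σ ≠ 0 := by rcases hσ with h | h <;> rw [h] <;> norm_num
    have hσ1 : |σ| = 1 := by rcases hσ with h | h <;> rw [h] <;> norm_num
    have hpp : p1 x t = p2 x t := by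
      rcases mul_eq_zero.1 g1 with h | h
      · exact absurd h hσ0
      · linarith
    set w := ε * Real.exp (L * (t - t1)) with hw
    have hw1 : w ≤ 1 := by
      refine le_trans ?_ hε1
      rw [hw]
      have := ht.2
      gcongr
    have hd : |u1 x t - u2 x t| = w := by
      have : σ * (u1 x t - u2 x t) = w := by linarith
      rw [← abs_of_pos hw0, ← this, abs_mul, hσ1, one_mul]
    have hU2 := hU x hx t htt
    have hU2' : |u2 x t| ≤ U + 1 := by linarith
    have hU1 : |u1 x t| ≤ U + 1 := by
      have := abs_add_le (u1 x t - u2 x t) (u2 x t)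
      rw [sub_add_cancel] at this
      linarith
    have l1 := exp_neg_lip hU1 hU2'
    have l2 := exp_neg_sq_lip hU1 hU2'
    rw [hd] at l1 l2
    rw [hpp] at hv1
    set p := p2 x t with hpd
    set P := Real.sqrt (1 + p ^ 2)
    have hP : P ≤ 1 + G := by
      have := sqrt_le_one_add (abs_nonneg p) (hp x hx t htt)
      rwa [sq_abs] at this
    have hP0 : 0 ≤ P := Real.sqrt_nonneg _
    have hqb := hq x hx t htt
    have hH0 : 0 ≤ H := (abs_nonneg _).trans hqb
    have hd1 : 1 ≤ 1 + p ^ 2 := by nlinarith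
    have hq3 : |q2 x t / (1 + p ^ 2) - 1| ≤ H + 1 := by
      have h1 : |q2 x t / (1 + p ^ 2)| ≤ H := by
        rw [abs_div, abs_of_pos (by linarith : 0 < 1 + p ^ 2)]
        exact (div_le_self (abs_nonneg _) hd1).trans hqb
      have := abs_sub (q2 x t / (1 + p ^ 2)) 1
      rw [abs_one] at this
      linarith
    set al := Real.exp (-u1 x t)
    set be := Real.exp (-u2 x t)
    have e1 : σ * (v1 x t - v2 x t) = al ^ 2 * (σ * (q1 x t - q2 x t)) / (1 + p ^ 2)
        + (σ * ((al ^ 2 - be ^ 2) * (q2 x t / (1 + p ^ 2) - 1)) + σ * (A * (al - be) * P)) := by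
      rw [hv1, hv2]; simp only [div_eq_mul_inv]; ring
    have e2 : al ^ 2 * (σ * (q1 x t - q2 x t)) / (1 + p ^ 2) ≤ 0 :=
      div_nonpos_of_nonpos_of_nonneg (mul_nonpos_of_nonneg_of_nonpos (by positivity) g2) (by linarith)
    have e3 : σ * ((al ^ 2 - be ^ 2) * (q2 x t / (1 + p ^ 2) - 1)) ≤ 2 * Real.exp (2 * (U + 1)) * w * (H + 1) := by
      refine (le_abs_self _).trans ?_
      rw [abs_mul, hσ1, one_mul, abs_mul]
      gcongr
    have e4 : σ * (A * (al - be) * P) ≤ A * (Real.exp (U + 1) * w) * (1 + G) := by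
      refine (le_abs_self _).trans ?_
      rw [abs_mul, hσ1, one_mul, abs_mul, abs_mul, abs_of_pos hA, abs_of_nonneg hP0]
      gcongr
    have e5 : ε * (Real.exp (L * (t - t1)) * (L * 1)) = w * L := by rw [hw]; ring
    rw [e5] at g3
    have e6 : w * L = 2 * Real.exp (2 * (U + 1)) * w * (H + 1) + A * (Real.exp (U + 1) * w) * (1 + G) + w := by
      rw [hL]; ring
    linarith

theorem c0_stab {A U G H t1 t2 : ℝ} (hA : 0 < A) (hG : 0 ≤ G) (hH : 0 ≤ H) (h12 : t1 ≤ t2) :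
    ∃ C > 0, ∀ (b s0 s1 : ℝ) (u1 p1 q1 v1 u2 p2 q2 v2 : ℝ → ℝ → ℝ),
    Sol A b s0 s1 u1 p1 q1 v1 → Sol A b s0 s1 u2 p2 q2 v2 →
    s0 < t1 → t2 < s1 →
    (∀ θ ∈ Icc 0 Real.pi, ∀ t ∈ Icc t1 t2, |u2 θ t| ≤ U) →
    (∀ θ ∈ Icc 0 Real.pi, ∀ t ∈ Icc t1 t2, |p2 θ t| ≤ G) →
    (∀ θ ∈ Icc 0 Real.pi, ∀ t ∈ Icc t1 t2, |q2 θ t| ≤ H) →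
    ∀ ε > 0, C * ε ≤ 1 → ∀ r ∈ Icc t1 t2, (∀ θ ∈ Icc 0 Real.pi, |u1 θ r - u2 θ r| < ε) →
    ∀ θ ∈ Icc 0 Real.pi, ∀ t ∈ Icc r t2, |u1 θ t - u2 θ t| ≤ C * ε := by
  set L := 2 * Real.exp (2 * (U + 1)) * (H + 1) + A * Real.exp (U + 1) * (1 + G) + 1 with hL
  have hL0 : 0 ≤ L := by positivity
  refine ⟨Real.exp (L * (t2 - t1)), Real.exp_pos _, ?_⟩
  intro b s0 s1 u1 p1 q1 v1 u2 p2 q2 v2 S1 S2 hs0 hs1 hU hp hq ε hε hCε r hr hi θ hθ t ht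
  have hss : Icc r t2 ⊆ Icc t1 t2 := Icc_subset_Icc_left hr.1
  have hmono : ∀ t ∈ Icc r t2, ε * Real.exp (L * (t - r)) ≤ Real.exp (L * (t2 - t1)) * ε := by
    intro t ht
    rw [mul_comm]
    have h1 := hr.1
    have h2 := ht.2
    have : t - r ≤ t2 - t1 := by linarith
    gcongr
  have key : ∀ σ : ℝ, σ = 1 ∨ σ = -1 → σ * (u1 θ t - u2 θ t) - ε * Real.exp (L * (t - r)) < 0 := by
    intro σ hσ
    refine c0_stab_one hA hG S1 S2 (hs0.trans_le hr.1) hs1 (fun θ hθ t ht => hU θ hθ t (hss ht))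
      (fun θ hθ t ht => hp θ hθ t (hss ht)) (fun θ hθ t ht => hq θ hθ t (hss ht)) hL hε
      ((hmono t2 ⟨hr.2, le_rfl⟩).trans hCε) hL0 hσ ?_ θ hθ t ht
    intro θ hθ
    have := abs_lt.1 (hi θ hθ)
    rcases hσ with h | h <;> rw [h] <;> linarith [this.1, this.2]
  have k1 := key 1 (Or.inl rfl)
  have k2 := key (-1) (Or.inr rfl)
  have := hmono t ht
  rw [abs_le]
  constructor <;> linarith

theorem arctan_low {x y K : ℝ} (hx : |x| ≤ K) (hy : |y| ≤ K) (hxy : x ≤ y) :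
    (y - x) / (1 + K ^ 2) ≤ Real.arctan y - Real.arctan x := by
  have hx := abs_le.1 hx
  have hy := abs_le.1 hy
  have := mono_diff (f := fun z => Real.arctan z - z / (1 + K ^ 2)) hxy
    (fun z => (arctan_d z).sub ((hasDerivAt_id z).div_const _))
    (fun z hz => by
      have h1 : z ^ 2 ≤ K ^ 2 := by nlinarith [hz.1, hz.2]
      have : 1 / (1 + K ^ 2) ≤ 1 / (1 + z ^ 2) := by gcongr
      linarith)
  rw [sub_div]
  linarith

theorem D_low {x y K : ℝ} (hx : |x| ≤ K) (hy : |y| ≤ K) :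
    (x - y) ^ 2 / (1 + K ^ 2) ≤ (Real.arctan x - Real.arctan y) * (x - y) := by
  rcases le_total x y with h | h
  · have := arctan_low hx hy h
    have e : (x - y) ^ 2 / (1 + K ^ 2) = (y - x) / (1 + K ^ 2) * (y - x) := by ring
    rw [e]
    nlinarith
  · have := arctan_low hy hx h
    have e : (x - y) ^ 2 / (1 + K ^ 2) = (x - y) / (1 + K ^ 2) * (x - y) := by ring
    rw [e]
    nlinarith

theorem D_l1 {x y G η : ℝ} (hη : 0 < η) (hy : |y| ≤ G) :
    |x - y| ≤ η + (1 + (G + η) ^ 2) / η * ((Real.arctan x - Real.arctan y) * (x - y)) := by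
  have hD := D_nonneg x y
  have hC : 0 < (1 + (G + η) ^ 2) / η := by positivity
  rcases le_total |x - y| η with h | h
  · have := mul_nonneg hC.le hD
    linarith
  · have key : η / (1 + (G + η) ^ 2) * |x - y| ≤ (Real.arctan x - Real.arctan y) * (x - y) := by
      have hy2 := abs_le.1 hy
      rcases le_total x y with h1 | h1
      · rw [abs_of_nonpos (by linarith)] at h ⊢
        have a1 := arctan_low (x := y - η) (y := y) (K := G + η) (abs_le.2 ⟨by linarith, by linarith⟩)
          (by linarith) (by linarith)
        have a2 := Real.arctan_strictMono.monotone (show x ≤ y - η by linarith)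
        rw [sub_sub_cancel] at a1
        nlinarith
      · rw [abs_of_nonneg (by linarith)] at h ⊢
        have a1 := arctan_low (x := y) (y := y + η) (K := G + η) (by linarith) (abs_le.2 ⟨by linarith, by linarith⟩)
          (by linarith)
        have a2 := Real.arctan_strictMono.monotone (show y + η ≤ x by linarith)
        rw [add_sub_cancel_left] at a1
        nlinarith
    have := mul_le_mul_of_nonneg_left key hC.le
    have e : (1 + (G + η) ^ 2) / η * (η / (1 + (G + η) ^ 2) * |x - y|) = |x - y| := by
      field_simp
    linarith

theorem tube {f : ℝ → ℝ → ℝ} {T : ℝ} (hT : 0 < T)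
    (hf : ContinuousOn (fun z : ℝ × ℝ => f z.1 z.2) (Icc 0 Real.pi ×ˢ Ico 0 T))
    (h : ∀ θ ∈ Icc 0 Real.pi, f θ 0 < 0) :
    ∀ᶠ t in nhdsWithin 0 (Ioi 0), ∀ θ ∈ Icc 0 Real.pi, f θ t < 0 := by
  have h1 := (isCompact_Icc (a := (0:ℝ)) (b := Real.pi)).eventually_forall_of_forall_eventually
    (x₀ := (0:ℝ)) (P := fun t θ => (θ ∈ Icc 0 Real.pi ∧ t ∈ Ico 0 T) → f θ t < 0) (by
      intro θ hθ
      have h2 : ContinuousWithinAt (fun z : ℝ × ℝ => f z.1 z.2) (Icc 0 Real.pi ×ˢ Ico 0 T) (θ, 0) :=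
        hf (θ, 0) ⟨hθ, le_rfl, hT⟩
      have h3 : ∀ᶠ z in nhdsWithin ((θ, 0) : ℝ × ℝ) (Icc 0 Real.pi ×ˢ Ico 0 T), f z.1 z.2 < 0 :=
        h2.eventually (Iio_mem_nhds (h θ hθ))
      rw [eventually_nhdsWithin_iff] at h3
      have h4 := (continuous_swap (X := ℝ) (Y := ℝ)).tendsto (0, θ)
      have h5 := h4.eventually h3
      filter_upwards [h5] with z hz hz2
      exact hz ⟨hz2.1, hz2.2⟩)
  have h6 : Ioo (-1) T ∈ nhds (0:ℝ) := Ioo_mem_nhds (by norm_num) hT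
  filter_upwards [mem_nhdsWithin_of_mem_nhds h1, mem_nhdsWithin_of_mem_nhds h6, self_mem_nhdsWithin] with t ht ht2 ht3 θ hθ
  exact ht θ hθ ⟨hθ, le_of_lt ht3, ht2.2⟩

theorem barrier0 {A b T U0 L t0 : ℝ} {u p q v : ℝ → ℝ → ℝ} (hA : 0 < A)
    (S : Sol A b 0 T u p q v)
    (cu0 : ContinuousOn (fun z : ℝ × ℝ => u z.1 z.2) (Icc 0 Real.pi ×ˢ Ico 0 T))
    (hb : |b| < U0) (hi : ∀ θ ∈ Icc 0 Real.pi, |u θ 0| < U0)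
    (hL : L = Real.exp (2 * (U0 + 1)) + A * Real.exp (U0 + 1) + 1) (ht0 : L * t0 ≤ 1) (htT : t0 < T) :
    ∀ θ ∈ Icc 0 Real.pi, ∀ t ∈ Icc 0 t0, |u θ t| ≤ U0 + 1 := by
  have hLp : 0 < L := by rw [hL]; positivity
  have key : ∀ σ : ℝ, σ = 1 ∨ σ = -1 → ∀ θ ∈ Icc 0 Real.pi, ∀ t ∈ Icc 0 t0, σ * u θ t - (U0 + L * t) < 0 := by
    intro σ hσ
    have hσ1 : |σ| = 1 := by rcases hσ with h | h <;> rw [h] <;> norm_num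
    have hle : ∀ x : ℝ, σ * x ≤ |x| := by
      intro x
      have := le_abs_self (σ * x)
      rwa [abs_mul, hσ1, one_mul] at this
    apply first_touch isCompact_Icc (f := fun x t => σ * u x t - (U0 + L * t))
    · have c1 := cu0.mono (prod_mono (subset_refl (Icc 0 Real.pi)) (Icc_subset_Ico_right htT))
      exact (c1.const_smul σ).sub (Continuous.continuousOn (by fun_prop))
    · intro x hx
      have := hle (u x 0)
      have := hi x hx
      simp only [mul_zero, add_zero]
      linarith
    · intro x hx t ht hf hmax hbef
      have hts : t ∈ Ioo 0 T := ⟨ht.1, ht.2.trans_lt htT⟩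
      have hLt : 0 < L * t := mul_pos hLp ht.1
      have hLt1 : L * t ≤ 1 := (mul_le_mul_of_nonneg_left ht.2 hLp.le).trans ht0
      have hx0 : 0 < x := by
        rcases eq_or_lt_of_le hx.1 with h0 | h0
        · exfalso
          rw [← h0, S.b0 t hts] at hf
          have := hle b
          linarith
        · exact h0
      have hxpi : x < Real.pi := by
        rcases eq_or_lt_of_le hx.2 with h0 | h0
        · exfalso
          rw [h0, S.b1 t hts] at hf
          have := hle b
          linarith
        · exact h0
      have hxx : x ∈ Ioo 0 Real.pi := ⟨hx0, hxpi⟩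
      have hloc : IsLocalMax (fun y => σ * u y t - (U0 + L * t)) x := by
        filter_upwards [Icc_mem_nhds hx0 hxpi] with y hy
        rw [hf]
        exact hmax y hy
      obtain ⟨g1, g2⟩ := second_test _ (fun y => σ * p y t) x (σ * q x t) hloc
        (by
          filter_upwards [Ioo_mem_nhds hx0 hxpi] with y hy
          exact ((S.du_at hy hts).const_mul σ).sub_const _)
        ((S.dp_at hxx hts).const_mul σ)
      have g3 := deriv_nonneg_of_left (fun t => σ * u x t - (U0 + L * t)) _ 0 t ht.1
        (((S.dt x hx t hts).const_mul σ).sub (((hasDerivAt_id t).const_mul L).const_add U0)) hf hbef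
      have hv := S.v_eq hx hts
      have hσ0 : σ ≠ 0 := by rcases hσ with h | h <;> rw [h] <;> norm_num
      have hpp : p x t = 0 := by
        rcases mul_eq_zero.1 g1 with h | h
        · exact absurd h hσ0
        · exact h
      have hU : |u x t| ≤ U0 + 1 := by
        have : |σ * u x t| = U0 + L * t := by
          rw [show σ * u x t = U0 + L * t by linarith, abs_of_pos]
          have := abs_nonneg b
          linarith
        rw [abs_mul, hσ1, one_mul] at this
        linarith
      obtain ⟨e1, e2, e3⟩ := exp_bds hU
      rw [hpp] at hv
      norm_num at hv
      set al := Real.exp (-u x t)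
      have hal : 0 < al := Real.exp_pos _
      have e : σ * v x t = al ^ 2 * (σ * q x t) + (-σ * al ^ 2 + σ * (A * al)) := by rw [hv]; ring
      have e4 : al ^ 2 * (σ * q x t) ≤ 0 := mul_nonpos_of_nonneg_of_nonpos (by positivity) g2
      have e5 : -σ * al ^ 2 + σ * (A * al) ≤ Real.exp (2 * (U0 + 1)) + A * Real.exp (U0 + 1) := by
        have : A * al ≤ A * Real.exp (U0 + 1) := by gcongr
        have h1 : 0 < al ^ 2 := by positivity
        have h2 : 0 < A * al := by positivity
        rcases hσ with h | h <;> rw [h] <;> linarith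
      have g3' : 0 ≤ σ * v x t - L := by simpa using g3
      linarith
  intro θ hθ t ht
  have k1 := key 1 (Or.inl rfl) θ hθ t ht
  have k2 := key (-1) (Or.inr rfl) θ hθ t ht
  have : L * t ≤ 1 := (mul_le_mul_of_nonneg_left ht.2 hLp.le).trans ht0
  rw [abs_le]
  constructor <;> linarith

theorem exp_mem {x U : ℝ} (h : |x| ≤ U) : Real.exp x ∈ Icc (Real.exp (-U)) (Real.exp U) := by
  have := abs_le.1 h
  exact ⟨Real.exp_le_exp.2 this.1, Real.exp_le_exp.2 this.2⟩

/-- gronwall and good time for pairs -/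
theorem pair_good {A U B : ℝ} (hA : 0 < A) (hB : 0 < B) : ∃ C : ℝ, 0 < C ∧
    ∀ (b s0 s1 : ℝ) (u1 p1 q1 v1 u2 p2 q2 v2 : ℝ → ℝ → ℝ), Sol A b s0 s1 u1 p1 q1 v1 →
    Sol A b s0 s1 u2 p2 q2 v2 → ∀ r0 r1, s0 < r0 → r0 < r1 → r1 < s1 → r1 - r0 ≤ B →
    (∀ θ ∈ Icc 0 Real.pi, ∀ t ∈ Icc r0 r1, |u1 θ t| ≤ U) →
    (∀ θ ∈ Icc 0 Real.pi, ∀ t ∈ Icc r0 r1, |u2 θ t| ≤ U) →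
    (∀ t ∈ Icc r0 r1, JF A u1 u2 t ≤ C * JF A u1 u2 r0) ∧
    ∃ τ ∈ Ioo r0 r1, DF p1 p2 τ ≤ C * (1 + 1 / (r1 - r0)) * JF A u1 u2 r0 := by
  set m := Real.exp (-U) with hm
  set M := Real.exp U with hM
  have hmp : 0 < m := Real.exp_pos _
  obtain ⟨C, hC, hpair⟩ := pair_ineq hA hmp (Real.exp_pos U)
  set E := Real.exp (C * B) with hE
  have hE1 : 1 ≤ E := Real.one_le_exp (by positivity)
  set C2 := E + 4 / m ^ 2 * (C * E) + 4 / m ^ 2 with hC2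
  have hC2p : 0 < C2 := by positivity
  refine ⟨C2, hC2p, ?_⟩
  intro b s0 s1 u1 p1 q1 v1 u2 p2 q2 v2 S1 S2 r0 r1 h0 h01 h1 hrB hU1 hU2
  have hsub : ∀ t ∈ Icc r0 r1, t ∈ Ioo s0 s1 := fun t ht => ⟨h0.trans_le ht.1, ht.2.trans_lt h1⟩
  have hex : ∀ t : ℝ, ∃ J', t ∈ Icc r0 r1 → HasDerivAt (JF A u1 u2) J' t ∧ J' ≤ C * JF A u1 u2 t - m ^ 2 / 4 * DF p1 p2 t := by
    intro t
    by_cases ht : t ∈ Icc r0 r1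
    · obtain ⟨J', h⟩ := hpair b s0 s1 u1 p1 q1 v1 u2 p2 q2 v2 S1 S2 t (hsub t ht)
        (fun θ hθ => exp_mem (hU1 θ hθ t ht)) (fun θ hθ => exp_mem (hU2 θ hθ t ht))
      exact ⟨J', fun _ => h⟩
    · exact ⟨0, fun h => absurd h ht⟩
  choose J' hJ' using hex
  have hcont : ContinuousOn (JF A u1 u2) (Icc r0 r1) := fun t ht => (hJ' t ht).1.continuousAt.continuousWithinAt
  have hJ0 : ∀ t ∈ Icc r0 r1, 0 ≤ JF A u1 u2 t := by
    intro t ht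
    have := JF_lower (m := m) (M := M) hA hmp (slice_cont S1.cu (hsub t ht)) (slice_cont S2.cu (hsub t ht))
      (fun θ hθ => exp_mem (hU1 θ hθ t ht)) (fun θ hθ => exp_mem (hU2 θ hθ t ht))
    refine le_trans ?_ this
    exact mul_nonneg (by positivity) (int_nonneg (fun _ _ => sq_nonneg _))
  have hg : ∀ t ∈ Icc r0 r1, JF A u1 u2 t ≤ E * JF A u1 u2 r0 := by
    intro t ht
    have := gronwall_simple (J := JF A u1 u2) (J' := J') (C := C) ht.1 (hcont.mono (Icc_subset_Icc_right ht.2))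
      (fun τ hτ => (hJ' τ ⟨hτ.1.le, hτ.2.le.trans ht.2⟩).1)
      (fun τ hτ => by
        have h3 := (hJ' τ ⟨hτ.1.le, hτ.2.le.trans ht.2⟩).2
        have h4 : 0 ≤ m ^ 2 / 4 * DF p1 p2 τ := mul_nonneg (by positivity) (DF_nonneg _ _ _)
        linarith)
    refine this.trans ?_
    have h5 := hJ0 r0 ⟨le_rfl, h01.le⟩
    have h6 : t - r0 ≤ B := by linarith [ht.2]
    rw [hE]
    gcongr
  have hJr := hJ0 r0 ⟨le_rfl, h01.le⟩
  refine ⟨fun t ht => (hg t ht).trans (mul_le_mul_of_nonneg_right ?_ hJr), ?_⟩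
  · have : 0 ≤ 4 / m ^ 2 * (C * E) + 4 / m ^ 2 := by positivity
    rw [hC2]; linarith
  · obtain ⟨τ, hτ, hs⟩ := exists_hasDerivAt_eq_slope (JF A u1 u2) J' h01 hcont
      (fun τ hτ => (hJ' τ (Ioo_subset_Icc_self hτ)).1)
    refine ⟨τ, hτ, ?_⟩
    have h3 := (hJ' τ (Ioo_subset_Icc_self hτ)).2
    have h4 := hg τ (Ioo_subset_Icc_self hτ)
    have h5 := hJ0 r1 ⟨h01.le, le_rfl⟩
    have hd : 0 < r1 - r0 := by linarith
    have h6 : -(1 / (r1 - r0) * JF A u1 u2 r0) ≤ J' τ := by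
      rw [hs, le_div_iff₀ hd]
      have : -(1 / (r1 - r0) * JF A u1 u2 r0) * (r1 - r0) = - JF A u1 u2 r0 := by field_simp
      rw [this]; linarith
    have h7 : m ^ 2 / 4 * DF p1 p2 τ ≤ (C * E + 1 / (r1 - r0)) * JF A u1 u2 r0 := by
      have := mul_le_mul_of_nonneg_left h4 hC.le
      linarith
    have h8 : DF p1 p2 τ = 4 / m ^ 2 * (m ^ 2 / 4 * DF p1 p2 τ) := by field_simp
    rw [h8]
    refine (mul_le_mul_of_nonneg_left h7 (by positivity)).trans ?_
    rw [← mul_assoc]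
    refine mul_le_mul_of_nonneg_right ?_ hJr
    have hi : 0 < 1 / (r1 - r0) := by positivity
    have i1 : 4 / m ^ 2 * (C * E) ≤ C2 := by
      rw [hC2]
      have : 0 < 4 / m ^ 2 := by positivity
      linarith
    have i2 : 4 / m ^ 2 ≤ C2 := by
      rw [hC2]
      have : 0 < 4 / m ^ 2 * (C * E) := by positivity
      linarith
    have := mul_le_mul_of_nonneg_right i2 hi.le
    linarith

theorem exp_lip {a b U : ℝ} (ha : |a| ≤ U) (hb : |b| ≤ U) :
    |Real.exp a - Real.exp b| ≤ Real.exp U * |a - b| := by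
  have := exp_neg_lip (a := -a) (b := -b) (U := U) (by rwa [abs_neg]) (by rwa [abs_neg])
  simp only [neg_neg] at this
  rwa [show -a - -b = -(a - b) by ring, abs_neg] at this

theorem int_le_const {f : ℝ → ℝ} {C : ℝ} (hf : ContinuousOn f (Icc 0 Real.pi))
    (h : ∀ θ ∈ Icc 0 Real.pi, f θ ≤ C) : ∫ θ in (0:ℝ)..Real.pi, f θ ≤ C * Real.pi := by
  have := int_mono hf continuousOn_const h
  rw [intervalIntegral.integral_const, sub_zero, smul_eq_mul] at this
  linarith

/-- sup bound for u1-u2 from DF -/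
theorem sup_from_D {A b s0 s1 G η τ : ℝ} {u1 p1 q1 v1 u2 p2 q2 v2 : ℝ → ℝ → ℝ}
    (S1 : Sol A b s0 s1 u1 p1 q1 v1) (S2 : Sol A b s0 s1 u2 p2 q2 v2) (hτ : τ ∈ Ioo s0 s1)
    (hη : 0 < η) (hG : ∀ θ ∈ Icc 0 Real.pi, |p2 θ τ| ≤ G) :
    ∀ θ ∈ Icc 0 Real.pi, |u1 θ τ - u2 θ τ| ≤ η * Real.pi + (1 + (G + η) ^ 2) / η * DF p1 p2 τ := by
  intro x hx
  have c1 := slice_cont S1.cp hτ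
  have c2 := slice_cont S2.cp hτ
  have ca1 := Real.continuous_arctan.comp_continuousOn c1
  have ca2 := Real.continuous_arctan.comp_continuousOn c2
  simp only [Function.comp_def] at ca1 ca2
  have h0 : (0:ℝ) ∈ Icc 0 Real.pi := ⟨le_rfl, Real.pi_pos.le⟩
  have h1 := ftc (fun θ => u1 θ τ - u2 θ τ) (fun θ => p1 θ τ - p2 θ τ)
    (fun θ hθ => (S1.du θ hθ τ hτ).sub (S2.du θ hθ τ hτ)) (c1.sub c2) h0 hx hx.1
  simp only [S1.b0 τ hτ, S2.b0 τ hτ, sub_self, sub_zero] at h1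
  rw [← h1]
  refine (intervalIntegral.abs_integral_le_integral_abs hx.1).trans ?_
  have h2 := int_sub_le (f := fun θ => |p1 θ τ - p2 θ τ|) (c1.sub c2).abs (fun _ _ => abs_nonneg _) le_rfl hx.1 hx.2
  refine h2.trans ?_
  have h3 := int_mono (f := fun θ => |p1 θ τ - p2 θ τ|)
    (g := fun θ => η + (1 + (G + η) ^ 2) / η * ((Real.arctan (p1 θ τ) - Real.arctan (p2 θ τ)) * (p1 θ τ - p2 θ τ)))
    (c1.sub c2).abs (by fun_prop) (fun θ hθ => D_l1 hη (hG θ hθ))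
  rw [intervalIntegral.integral_add (slice_int (by fun_prop)) (slice_int (by fun_prop)),
    intervalIntegral.integral_const, intervalIntegral.integral_const_mul, sub_zero, smul_eq_mul] at h3
  rw [DF]
  linarith

theorem close_C0 {A b T : ℝ} (hA : 0 < A) (hT : 0 < T) {u2 p2 q2 v2 : ℝ → ℝ → ℝ}
    (S2 : Sol A b 0 T u2 p2 q2 v2)
    (cu2 : ContinuousOn (fun z : ℝ × ℝ => u2 z.1 z.2) (Icc 0 Real.pi ×ˢ Ico 0 T))
    (hb : u2 0 0 = b) {t1 T1 : ℝ} (ht1 : 0 < t1) (htT : t1 ≤ T1) (hT1 : T1 < T) {ε : ℝ} (hε : 0 < ε) :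
    ∃ δ > 0, ∀ u1 p1 q1 v1 : ℝ → ℝ → ℝ, Sol A b 0 T u1 p1 q1 v1 →
      ContinuousOn (fun z : ℝ × ℝ => u1 z.1 z.2) (Icc 0 Real.pi ×ˢ Ico 0 T) →
      (∀ θ ∈ Icc 0 Real.pi, |u1 θ 0 - u2 θ 0| < δ) →
      ∀ θ ∈ Icc 0 Real.pi, ∀ t ∈ Icc t1 T1, |u1 θ t - u2 θ t| ≤ ε := by
  have hpi := Real.pi_pos
  have h0 : (0:ℝ) ∈ Icc 0 Real.pi := ⟨le_rfl, hpi.le⟩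
  obtain ⟨Cu, hCu, hCu2⟩ := joint_bdd cu2 (s0 := 0) (s1 := T1) (Icc_subset_Ico_right hT1)
  have hT10 : 0 ≤ T1 := by linarith
  set U0 := Cu + 2 with hU0
  have hbU : |b| < U0 := by
    have := hCu2 0 h0 0 ⟨le_rfl, hT10⟩
    rw [hb] at this
    linarith
  set L := Real.exp (2 * (U0 + 1)) + A * Real.exp (U0 + 1) + 1 with hL
  have hLp : 0 < L := by positivity
  set t0 := min (1 / L) t1 with ht0
  have ht0p : 0 < t0 := lt_min (by positivity) ht1
  have ht0L : L * t0 ≤ 1 := by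
    have : t0 ≤ 1 / L := min_le_left _ _
    rw [le_div_iff₀ hLp] at this
    linarith
  have ht0t1 : t0 ≤ t1 := min_le_right _ _
  set r0 := t0 / 2 with hr0
  have hr0p : 0 < r0 := by positivity
  have hsubc : Icc r0 T1 ⊆ Ioo 0 T := fun t ht => ⟨hr0p.trans_le ht.1, ht.2.trans_lt hT1⟩
  obtain ⟨G, hG, hG2⟩ := joint_bdd S2.cp hsubc
  obtain ⟨H, hH, hH2⟩ := joint_bdd S2.cq hsubc
  obtain ⟨Cs, hCs, hstab⟩ := c0_stab (U := Cu) (G := G) (H := H) (t1 := r0) (t2 := T1) hA hG.le hH.le (by linarith)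
  obtain ⟨Cp, hCp, hpg⟩ := pair_good (A := A) (U := U0 + 1) (B := t0) hA ht0p
  -- choose tolerances
  set ε1 := min ε 1 / Cs with hε1
  have hε1p : 0 < ε1 := by
    have : 0 < min ε 1 := lt_min hε one_pos
    positivity
  set η := ε1 / (4 * Real.pi) with hη
  have hηp : 0 < η := by positivity
  set Cη := (1 + (G + η) ^ 2) / η with hCη
  have hCηp : 0 < Cη := by positivity
  set M := Real.exp (U0 + 1) with hM
  have hMp : 0 < M := Real.exp_pos _
  set KJ := Real.exp (2 * A / Real.pi * M) * M ^ 2 / 2 with hKJ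
  have hKJp : 0 < KJ := by positivity
  set Ct := Cη * (Cp * (1 + 1 / (t0 - r0)) * (Cp * (KJ * (M ^ 2 * Real.pi)))) with hCt
  have hdr : 0 < t0 - r0 := by rw [hr0]; linarith
  have hCtp : 0 < Ct := by positivity
  set δ := min 1 (ε1 / (2 * (Ct + 1))) with hδ
  have hδp : 0 < δ := lt_min one_pos (by positivity)
  have hδ1 : δ ≤ 1 := min_le_left _ _
  have hδ2 : Ct * δ ^ 2 < ε1 / 2 := by
    have h1 : δ ≤ ε1 / (2 * (Ct + 1)) := min_le_right _ _
    rw [le_div_iff₀ (by positivity)] at h1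
    have h2 : δ ^ 2 ≤ δ := by nlinarith
    nlinarith
  refine ⟨δ, hδp, ?_⟩
  intro u1 p1 q1 v1 S1 cu1 hi
  have ht0T : t0 < T := by linarith
  have hb1 : ∀ θ ∈ Icc 0 Real.pi, ∀ t ∈ Icc 0 t0, |u1 θ t| ≤ U0 + 1 := by
    refine barrier0 hA S1 cu1 hbU ?_ hL ht0L ht0T
    intro θ hθ
    have h1 := hi θ hθ
    have h2 := hCu2 θ hθ 0 ⟨le_rfl, hT10⟩
    have h3 := abs_add_le (u1 θ 0 - u2 θ 0) (u2 θ 0)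
    rw [sub_add_cancel] at h3
    linarith
  have hb2 : ∀ θ ∈ Icc 0 Real.pi, ∀ t ∈ Icc 0 t0, |u2 θ t| ≤ U0 + 1 := by
    intro θ hθ t ht
    have := hCu2 θ hθ t ⟨ht.1, ht.2.trans (ht0t1.trans htT)⟩
    linarith
  -- small time r
  have htube := tube (f := fun θ t => |u1 θ t - u2 θ t| - δ) hT
    ((cu1.sub cu2).abs.sub continuousOn_const) (fun θ hθ => by have := hi θ hθ; linarith)
  obtain ⟨r, hr, hr1, hr2⟩ := (htube.and (Ioo_mem_nhdsGT hr0p)).exists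
  have hrS : r ∈ Ioo 0 T := ⟨hr1, by linarith⟩
  have hJr : JF A u1 u2 r ≤ KJ * (M ^ 2 * Real.pi) * δ ^ 2 := by
    have h1 : r ∈ Icc 0 t0 := ⟨hr1.le, by linarith⟩
    have c1 := slice_cont S1.cu hrS
    have c2 := slice_cont S2.cu hrS
    have h2 := JF_upper (m := Real.exp (-(U0 + 1))) hA (Real.exp_pos _) c1 c2
      (fun θ hθ => exp_mem (hb1 θ hθ r h1)) (fun θ hθ => exp_mem (hb2 θ hθ r h1))
    have h3 := int_le_const (f := fun θ => (Real.exp (u1 θ r) - Real.exp (u2 θ r)) ^ 2) (C := M ^ 2 * δ ^ 2)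
      (by fun_prop) (fun θ hθ => by
        have h4 := exp_lip (hb1 θ hθ r h1) (hb2 θ hθ r h1)
        have h5 : |u1 θ r - u2 θ r| ≤ δ := by linarith [hr θ hθ]
        have h6 : |Real.exp (u1 θ r) - Real.exp (u2 θ r)| ≤ M * δ :=
          h4.trans (mul_le_mul_of_nonneg_left h5 hMp.le)
        have h7 := pow_le_pow_left₀ (abs_nonneg _) h6 2
        rw [sq_abs, mul_pow] at h7
        exact h7)
    refine h2.trans ?_
    have := mul_le_mul_of_nonneg_left h3 hKJp.le
    rw [← hM, ← hKJ]
    linarith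
  have hres : ∀ r', r ≤ r' → ∀ s, s ≤ t0 → Icc r' s ⊆ Icc 0 t0 := fun r' h s h' => Icc_subset_Icc (hr1.le.trans h) h'
  have hJ0 := (hpg b 0 T u1 p1 q1 v1 u2 p2 q2 v2 S1 S2 r r0 hr1 hr2 (by linarith) (by linarith)
    (fun θ hθ t ht => hb1 θ hθ t (hres r le_rfl r0 (by linarith) ht))
    (fun θ hθ t ht => hb2 θ hθ t (hres r le_rfl r0 (by linarith) ht))).1 r0 ⟨hr2.le, le_rfl⟩
  obtain ⟨τ, hτ, hD⟩ := (hpg b 0 T u1 p1 q1 v1 u2 p2 q2 v2 S1 S2 r0 t0 hr0p (by linarith) (by linarith) (by linarith)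
    (fun θ hθ t ht => hb1 θ hθ t (hres r0 hr2.le t0 le_rfl ht))
    (fun θ hθ t ht => hb2 θ hθ t (hres r0 hr2.le t0 le_rfl ht))).2
  have hτS : τ ∈ Icc r0 T1 := ⟨hτ.1.le, by linarith [hτ.2]⟩
  have hsup := sup_from_D S1 S2 (hsubc hτS) hηp (fun θ hθ => hG2 θ hθ τ hτS)
  have hfin : ∀ θ ∈ Icc 0 Real.pi, |u1 θ τ - u2 θ τ| < ε1 := by
    intro θ hθ
    refine (hsup θ hθ).trans_lt ?_
    have e1 : η * Real.pi = ε1 / 4 := by rw [hη]; field_simp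
    have e2 : Cη * DF p1 p2 τ ≤ Ct * δ ^ 2 := by
      have h1 : 0 ≤ Cp * (1 + 1 / (t0 - r0)) := by positivity
      have h2 := mul_le_mul_of_nonneg_left hJr hCp.le
      have h3 := mul_le_mul_of_nonneg_left (hJ0.trans h2) h1
      have h4 := mul_le_mul_of_nonneg_left (hD.trans h3) hCηp.le
      refine h4.trans (le_of_eq ?_)
      rw [hCt]; ring
    rw [e1, ← hCη]
    linarith
  have hCe : Cs * ε1 = min ε 1 := by rw [hε1]; field_simp
  have := hstab b 0 T u1 p1 q1 v1 u2 p2 q2 v2 S1 S2 hr0p hT1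
    (fun θ hθ t ht => hCu2 θ hθ t ⟨hr0p.le.trans ht.1, ht.2⟩) hG2 hH2 ε1 hε1p
    (by rw [hCe]; exact min_le_right _ _) τ hτS hfin
  intro θ hθ t ht
  refine (this θ hθ t ⟨by linarith [hτ.2, ht.1], ht.2⟩).trans ?_
  rw [hCe]; exact min_le_left _ _

theorem quot_unif {A b s0 s1 : ℝ} {u p q v : ℝ → ℝ → ℝ} (S : Sol A b s0 s1 u p q v) {s : ℝ}
    (hs : s ∈ Ioo s0 s1) :
    ∀ᶠ h in nhdsWithin (0:ℝ) (Ioi 0), ∀ θ ∈ Icc 0 Real.pi, |u θ (s + h) - u θ s - h * v θ s| ≤ h := by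
  obtain ⟨e, he, hes⟩ : ∃ e > 0, s + e < s1 := ⟨(s1 - s) / 2, by linarith [hs.2], by linarith [hs.2]⟩
  have hsub : Icc s (s + e) ⊆ Ioo s0 s1 := fun t ht => ⟨hs.1.trans_le ht.1, ht.2.trans_lt hes⟩
  have huc := (isCompact_Icc.prod isCompact_Icc).uniformContinuousOn_of_continuous
    (S.cv.mono (prod_mono (subset_refl (Icc 0 Real.pi)) hsub))
  rw [Metric.uniformContinuousOn_iff] at huc
  obtain ⟨δ, hδ, hu⟩ := huc 1 one_pos
  filter_upwards [Ioo_mem_nhdsGT (lt_min hδ he)] with h hh θ hθ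
  have hhe : h < e := hh.2.trans_le (min_le_right _ _)
  have hhd : h < δ := hh.2.trans_le (min_le_left _ _)
  have hlt : s < s + h := by linarith [hh.1]
  obtain ⟨ξ, hξ, hsl⟩ := exists_hasDerivAt_eq_slope (fun τ => u θ τ) (fun τ => v θ τ) hlt
    (fun τ hτ => (S.dt θ hθ τ (hsub ⟨hτ.1, hτ.2.trans (by linarith)⟩)).continuousAt.continuousWithinAt)
    (fun τ hτ => S.dt θ hθ τ (hsub ⟨hτ.1.le, hτ.2.le.trans (by linarith)⟩))
  have hh1 : 0 < h := hh.1
  rw [add_sub_cancel_left, eq_div_iff hh1.ne'] at hsl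
  have := hu (θ, ξ) ⟨hθ, hξ.1.le, by linarith [hξ.2]⟩ (θ, s) ⟨hθ, le_rfl, by linarith⟩ (by
    rw [Prod.dist_eq]
    simp only [dist_self]
    rw [max_eq_right dist_nonneg, Real.dist_eq, abs_of_pos (by linarith [hξ.1])]
    linarith [hξ.2])
  rw [Real.dist_eq] at this
  rw [← hsl, show v θ ξ * h - h * v θ s = h * (v θ ξ - v θ s) by ring, abs_mul, abs_of_pos hh1]
  nlinarith

theorem sqrt_lip (x y : ℝ) : |Real.sqrt (1 + x ^ 2) - Real.sqrt (1 + y ^ 2)| ≤ |x - y| := by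
  set a := Real.sqrt (1 + x ^ 2) with ha
  set c := Real.sqrt (1 + y ^ 2) with hc
  have ha2 : a ^ 2 = 1 + x ^ 2 := Real.sq_sqrt (by positivity)
  have hc2 : c ^ 2 = 1 + y ^ 2 := Real.sq_sqrt (by positivity)
  have ha0 : 0 ≤ a := Real.sqrt_nonneg _
  have hc0 : 0 ≤ c := Real.sqrt_nonneg _
  have hac : 1 + x * y ≤ a * c := by
    have : (1 + x * y) ^ 2 ≤ (a * c) ^ 2 := by
      rw [mul_pow, ha2, hc2]; nlinarith [sq_nonneg (x - y)]
    exact (le_abs_self _).trans (abs_le_of_sq_le_sq this (by positivity))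
  rw [← sq_le_sq]
  nlinarith

theorem add_sq_le_of {x y a b : ℝ} (hx : x ^ 2 ≤ a) (hy : y ^ 2 ≤ b) : (x + y) ^ 2 ≤ 2 * (a + b) := by
  nlinarith [sq_nonneg (x - y)]

theorem inv_lip {x y K : ℝ} (hx : |x| ≤ K) (hy : |y| ≤ K) :
    |1 / (1 + x ^ 2) - 1 / (1 + y ^ 2)| ≤ 2 * K * |x - y| := by
  have h1 : (1 + x ^ 2) ≠ 0 := by positivity
  have h2 : (1 + y ^ 2) ≠ 0 := by positivity
  have e : 1 / (1 + x ^ 2) - 1 / (1 + y ^ 2) = -(x + y) * (x - y) / ((1 + x ^ 2) * (1 + y ^ 2)) := by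
    field_simp; ring
  have h3 : 1 ≤ (1 + x ^ 2) * (1 + y ^ 2) := by nlinarith [sq_nonneg x, sq_nonneg y, mul_nonneg (sq_nonneg x) (sq_nonneg y)]
  rw [e, abs_div, abs_mul, abs_neg, abs_of_pos (by linarith : 0 < (1 + x ^ 2) * (1 + y ^ 2))]
  refine (div_le_self (by positivity) h3).trans ?_
  have := abs_add_le x y
  gcongr
  linarith

/-- remainder bound for difference of the right hand sides -/
theorem R_bound {A U K : ℝ} (hA : 0 < A) (hK : 0 ≤ K) {u1 u2 p1 p2 q2 : ℝ} (hu1 : |u1| ≤ U) (hu2 : |u2| ≤ U)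
    (hp1 : |p1| ≤ K) (hp2 : |p2| ≤ K) :
    |q2 * (Real.exp (-u1) ^ 2 / (1 + p1 ^ 2) - Real.exp (-u2) ^ 2 / (1 + p2 ^ 2))
      - (Real.exp (-u1) ^ 2 - Real.exp (-u2) ^ 2)
      + A * (Real.exp (-u1) * Real.sqrt (1 + p1 ^ 2) - Real.exp (-u2) * Real.sqrt (1 + p2 ^ 2))|
    ≤ ((2 + 2 * K) * Real.exp (2 * U) + A * Real.exp U * (1 + K)) * ((1 + |q2|) * (|u1 - u2| + |p1 - p2|)) := by
  have l1 := exp_neg_lip hu1 hu2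
  have l2 := exp_neg_sq_lip hu1 hu2
  obtain ⟨-, e2, e3⟩ := exp_bds hu2
  have i1 := inv_lip hp1 hp2
  have s1 := sqrt_lip p1 p2
  have sq1 : Real.sqrt (1 + p1 ^ 2) ≤ 1 + K := by
    have := sqrt_le_one_add (abs_nonneg p1) hp1
    rwa [sq_abs] at this
  have sq0 := Real.sqrt_nonneg (1 + p1 ^ 2)
  set z := |u1 - u2|
  set w := |p1 - p2|
  have hz : 0 ≤ z := abs_nonneg _
  have hw : 0 ≤ w := abs_nonneg _
  set a1 := Real.exp (-u1)
  set a2 := Real.exp (-u2)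
  have ha1 : 0 < a1 := Real.exp_pos _
  have ha2 : 0 < a2 := Real.exp_pos _
  set P1 := Real.sqrt (1 + p1 ^ 2)
  set P2 := Real.sqrt (1 + p2 ^ 2)
  have hi1 : 1 / (1 + p1 ^ 2) ≤ 1 := by
    rw [div_le_one (by positivity)]; nlinarith [sq_nonneg p1]
  have hi0 : 0 ≤ 1 / (1 + p1 ^ 2) := by positivity
  set E2 := Real.exp (2 * U)
  set E1 := Real.exp U
  have hE2 : 0 < E2 := Real.exp_pos _
  have hE1 : 0 < E1 := Real.exp_pos _
  have t1 : |a1 ^ 2 / (1 + p1 ^ 2) - a2 ^ 2 / (1 + p2 ^ 2)| ≤ (2 + 2 * K) * E2 * (z + w) := by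
    have e : a1 ^ 2 / (1 + p1 ^ 2) - a2 ^ 2 / (1 + p2 ^ 2)
      = (a1 ^ 2 - a2 ^ 2) * (1 / (1 + p1 ^ 2)) + a2 ^ 2 * (1 / (1 + p1 ^ 2) - 1 / (1 + p2 ^ 2)) := by
      simp only [div_eq_mul_inv]; ring
    rw [e]
    refine (abs_add_le _ _).trans ?_
    rw [abs_mul, abs_mul, abs_of_nonneg hi0, abs_of_nonneg (by positivity : 0 ≤ a2 ^ 2)]
    have b1 : |a1 ^ 2 - a2 ^ 2| * (1 / (1 + p1 ^ 2)) ≤ 2 * E2 * z * 1 := by gcongr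
    have b2 : a2 ^ 2 * |1 / (1 + p1 ^ 2) - 1 / (1 + p2 ^ 2)| ≤ E2 * (2 * K * w) := by gcongr
    have b3 : 0 ≤ 2 * K * E2 * z := by positivity
    have b4 : 0 ≤ 2 * E2 * w := by positivity
    linarith
  have t2 : |a1 ^ 2 - a2 ^ 2| ≤ (2 + 2 * K) * E2 * (z + w) := by
    have b3 : 0 ≤ 2 * K * E2 * z := by positivity
    have b4 : 0 ≤ 2 * E2 * w := by positivity
    have b5 : 0 ≤ 2 * K * E2 * w := by positivity
    linarith
  have t3 : |A * (a1 * P1 - a2 * P2)| ≤ A * E1 * (1 + K) * (z + w) := by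
    rw [abs_mul, abs_of_pos hA]
    have e : a1 * P1 - a2 * P2 = (a1 - a2) * P1 + a2 * (P1 - P2) := by ring
    have b : |a1 * P1 - a2 * P2| ≤ E1 * z * (1 + K) + E1 * w := by
      rw [e]
      refine (abs_add_le _ _).trans ?_
      rw [abs_mul, abs_mul, abs_of_nonneg sq0, abs_of_pos ha2]
      gcongr
    have b3 : 0 ≤ E1 * K * w := by positivity
    have := mul_le_mul_of_nonneg_left b hA.le
    have b4 := mul_nonneg hA.le b3
    linarith
  have t4 : |q2 * (a1 ^ 2 / (1 + p1 ^ 2) - a2 ^ 2 / (1 + p2 ^ 2)) - (a1 ^ 2 - a2 ^ 2) + A * (a1 * P1 - a2 * P2)|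
      ≤ |q2| * |a1 ^ 2 / (1 + p1 ^ 2) - a2 ^ 2 / (1 + p2 ^ 2)| + |a1 ^ 2 - a2 ^ 2| + |A * (a1 * P1 - a2 * P2)| := by
    rw [← abs_mul]
    exact (abs_add_le _ _).trans (add_le_add_left (abs_sub _ _) _)
  refine t4.trans ?_
  have hq := abs_nonneg q2
  have t5 := mul_le_mul_of_nonneg_left t1 hq
  have t6 : 0 ≤ |q2| * (A * E1 * (1 + K) * (z + w)) := by positivity
  linarith

theorem young_alg {a x r y : ℝ} (ha : 0 < a) (hy : a * x ^ 2 ≤ y) : -(2 * (y + x * r)) ≤ -(a * x ^ 2) + r ^ 2 / a := by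
  have h : 0 ≤ (a * x + r) ^ 2 / a := by positivity
  have e : (a * x + r) ^ 2 / a = a * x ^ 2 + 2 * (x * r) + r ^ 2 / a := by field_simp; ring
  linarith

set_option maxHeartbeats 1000000 in
theorem Z_ineq {A U K Q : ℝ} (hA : 0 < A) (hK : 0 ≤ K) (hQ : 0 ≤ Q) : ∃ C > 0,
    ∀ (b s0 s1 : ℝ) (u1 p1 q1 v1 u2 p2 q2 v2 : ℝ → ℝ → ℝ), Sol A b s0 s1 u1 p1 q1 v1 →
    Sol A b s0 s1 u2 p2 q2 v2 → ∀ t ∈ Ioo s0 s1,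
    (∀ θ ∈ Icc 0 Real.pi, |u1 θ t| ≤ U) → (∀ θ ∈ Icc 0 Real.pi, |u2 θ t| ≤ U) →
    (∀ θ ∈ Icc 0 Real.pi, |p1 θ t| ≤ K) → (∀ θ ∈ Icc 0 Real.pi, |p2 θ t| ≤ K) →
    (∫ θ in (0:ℝ)..Real.pi, q2 θ t ^ 2) ≤ Q →
    ∃ Z', HasDerivAt (fun τ => ∫ θ in (0:ℝ)..Real.pi, (p1 θ τ - p2 θ τ) ^ 2) Z' t ∧
      Z' ≤ C * ∫ θ in (0:ℝ)..Real.pi, (p1 θ t - p2 θ t) ^ 2 := by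
  have hpi := Real.pi_pos
  set a := Real.exp (-(2 * U)) / (1 + K ^ 2) with ha
  have hap : 0 < a := by have := Real.exp_pos (-(2 * U)); positivity
  set C1 := (2 + 2 * K) * Real.exp (2 * U) + A * Real.exp U * (1 + K) with hC1
  have hC1p : 0 < C1 := by positivity
  set B := 4 * C1 ^ 2 / a with hB
  have hBp : 0 < B := by positivity
  set B0 := B * (Real.pi + Q) with hB0
  have hB0p : 0 < B0 := by positivity
  refine ⟨B0 * (Real.pi + B0 / a), by positivity, ?_⟩
  intro b s0 s1 u1 p1 q1 v1 u2 p2 q2 v2 S1 S2 t ht hu1 hu2 hp1 hp2 hq2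
  have hder := energy_deriv (f := fun θ t => u1 θ t - u2 θ t) (g := fun θ t => p1 θ t - p2 θ t)
    (k := fun θ t => q1 θ t - q2 θ t) (w := fun θ t => v1 θ t - v2 θ t) (s0 := s0) (s1 := s1)
    (b0 := b - b) (b1 := b - b) (S1.cp.sub S2.cp) (S1.cq.sub S2.cq) (S1.cv.sub S2.cv)
    (fun θ hθ t ht => (S1.du θ hθ t ht).sub (S2.du θ hθ t ht))
    (fun θ hθ t ht => (S1.dp θ hθ t ht).sub (S2.dp θ hθ t ht))
    (fun θ hθ t ht => (S1.dt θ hθ t ht).sub (S2.dt θ hθ t ht))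
    (fun t ht => by simp only [S1.b0 t ht, S2.b0 t ht]) (fun t ht => by simp only [S1.b1 t ht, S2.b1 t ht]) ht
  refine ⟨_, hder, ?_⟩
  have cp1 := slice_cont S1.cp ht
  have cp2 := slice_cont S2.cp ht
  have cq1 := slice_cont S1.cq ht
  have cq2 := slice_cont S2.cq ht
  have cu1 := slice_cont S1.cu ht
  have cu2 := slice_cont S2.cu ht
  have cv1 := slice_cont S1.cv ht
  have cv2 := slice_cont S2.cv ht
  set X := ∫ θ in (0:ℝ)..Real.pi, (q1 θ t - q2 θ t) ^ 2 with hX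
  set Z := ∫ θ in (0:ℝ)..Real.pi, (p1 θ t - p2 θ t) ^ 2 with hZ
  have hX0 : 0 ≤ X := int_nonneg (fun _ _ => sq_nonneg _)
  have hZ0 : 0 ≤ Z := int_nonneg (fun _ _ => sq_nonneg _)
  have hd0 : ∀ θ ∈ Icc 0 Real.pi, HasDerivWithinAt (fun φ => u1 φ t - u2 φ t) (p1 θ t - p2 θ t) (Icc 0 Real.pi) θ :=
    fun θ hθ => (S1.du θ hθ t ht).sub (S2.du θ hθ t ht)
  have hd1 : ∀ θ ∈ Icc 0 Real.pi, HasDerivWithinAt (fun φ => p1 φ t - p2 φ t) (q1 θ t - q2 θ t) (Icc 0 Real.pi) θ :=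
    fun θ hθ => (S1.dp θ hθ t ht).sub (S2.dp θ hθ t ht)
  have h00 : (0:ℝ) ∈ Icc 0 Real.pi := ⟨le_rfl, hpi.le⟩
  -- sup bounds
  have hz : ∀ θ ∈ Icc 0 Real.pi, (u1 θ t - u2 θ t) ^ 2 ≤ Real.pi * Z := by
    intro θ hθ
    have := holder_half hd0 (cp1.sub cp2) hθ h00
    simp only [S1.b0 t ht, S2.b0 t ht, sub_self, sub_zero] at this
    refine this.trans (mul_le_mul_of_nonneg_right ?_ hZ0)
    rw [abs_of_nonneg hθ.1]; exact hθ.2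
  obtain ⟨y, hy, hy0⟩ := exists_hasDerivAt_eq_zero (f := fun φ => u1 φ t - u2 φ t) (f' := fun φ => p1 φ t - p2 φ t) hpi
    (cu1.sub cu2) (by simp only [S1.b0 t ht, S2.b0 t ht, S1.b1 t ht, S2.b1 t ht])
    (fun θ hθ => (S1.du_at hθ ht).sub (S2.du_at hθ ht))
  set η := a / B0 with hη
  have hηp : 0 < η := by positivity
  have hw : ∀ θ ∈ Icc 0 Real.pi, (p1 θ t - p2 θ t) ^ 2 ≤ η * X + 1 / η * Z :=
    fun θ hθ => agmon hd1 (cq1.sub cq2) hθ (Ioo_subset_Icc_self hy) hy0 hηp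
  set Sb := Real.pi * Z + (η * X + 1 / η * Z) with hSb
  have hSb0 : 0 ≤ Sb := by positivity
  -- pointwise
  have hpt : ∀ θ ∈ Icc 0 Real.pi, -(2 * ((q1 θ t - q2 θ t) * (v1 θ t - v2 θ t)))
      ≤ -(a * (q1 θ t - q2 θ t) ^ 2) + B * Sb * (1 + q2 θ t ^ 2) := by
    intro θ hθ
    have hR := R_bound (q2 := q2 θ t) hA hK (hu1 θ hθ) (hu2 θ hθ) (hp1 θ hθ) (hp2 θ hθ)
    rw [← hC1] at hR
    set R := q2 θ t * (Real.exp (-u1 θ t) ^ 2 / (1 + p1 θ t ^ 2) - Real.exp (-u2 θ t) ^ 2 / (1 + p2 θ t ^ 2))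
      - (Real.exp (-u1 θ t) ^ 2 - Real.exp (-u2 θ t) ^ 2)
      + A * (Real.exp (-u1 θ t) * Real.sqrt (1 + p1 θ t ^ 2) - Real.exp (-u2 θ t) * Real.sqrt (1 + p2 θ t ^ 2)) with hRd
    have e : (q1 θ t - q2 θ t) * (v1 θ t - v2 θ t) =
        Real.exp (-u1 θ t) ^ 2 / (1 + p1 θ t ^ 2) * (q1 θ t - q2 θ t) ^ 2 + (q1 θ t - q2 θ t) * R := by
      rw [S1.v_eq hθ ht, S2.v_eq hθ ht, hRd]
      simp only [div_eq_mul_inv]; ring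
    have hlow : a ≤ Real.exp (-u1 θ t) ^ 2 / (1 + p1 θ t ^ 2) := by
      have h1 := (exp_bds (hu1 θ hθ)).1
      have h2 : p1 θ t ^ 2 ≤ K ^ 2 := by
        rw [← sq_abs]; exact pow_le_pow_left₀ (abs_nonneg _) (hp1 θ hθ) 2
      rw [ha]
      gcongr
    have hy' := young_alg (r := R) hap (mul_le_mul_of_nonneg_right hlow (sq_nonneg (q1 θ t - q2 θ t)))
    rw [e]
    refine hy'.trans ?_
    have hR2 : R ^ 2 ≤ 4 * C1 ^ 2 * (Sb * (1 + q2 θ t ^ 2)) := by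
      have h1 := pow_le_pow_left₀ (abs_nonneg R) hR 2
      rw [sq_abs] at h1
      refine h1.trans ?_
      rw [mul_pow, mul_pow]
      have h2 : (1 + |q2 θ t|) ^ 2 ≤ 2 * (1 + q2 θ t ^ 2) := by
        rw [← sq_abs (q2 θ t)]; nlinarith [sq_nonneg (1 - |q2 θ t|)]
      have h3 : (|u1 θ t - u2 θ t| + |p1 θ t - p2 θ t|) ^ 2 ≤ 2 * Sb := by
        have h4 := hz θ hθ
        have h5 := hw θ hθ
        rw [← sq_abs] at h4 h5
        exact add_sq_le_of h4 h5
      calc C1 ^ 2 * ((1 + |q2 θ t|) ^ 2 * (|u1 θ t - u2 θ t| + |p1 θ t - p2 θ t|) ^ 2)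
          ≤ C1 ^ 2 * (2 * (1 + q2 θ t ^ 2) * (2 * Sb)) := by gcongr
        _ = _ := by ring
    have : R ^ 2 / a ≤ 4 * C1 ^ 2 * (Sb * (1 + q2 θ t ^ 2)) / a := by gcongr
    have e2 : 4 * C1 ^ 2 * (Sb * (1 + q2 θ t ^ 2)) / a = B * Sb * (1 + q2 θ t ^ 2) := by
      rw [hB]; ring
    linarith
  have hitg := int_mono (f := fun θ => -(2 * ((q1 θ t - q2 θ t) * (v1 θ t - v2 θ t))))
    (g := fun θ => -(a * (q1 θ t - q2 θ t) ^ 2) + B * Sb * (1 + q2 θ t ^ 2)) (by fun_prop) (by fun_prop) hpt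
  rw [intervalIntegral.integral_neg, intervalIntegral.integral_const_mul,
    intervalIntegral.integral_add (slice_int (by fun_prop)) (slice_int (by fun_prop)),
    intervalIntegral.integral_neg, intervalIntegral.integral_const_mul, intervalIntegral.integral_const_mul,
    intervalIntegral.integral_add (slice_int (by fun_prop)) (slice_int (by fun_prop)),
    intervalIntegral.integral_const, sub_zero, smul_eq_mul, mul_one, ← hX] at hitg
  refine hitg.trans ?_
  have h1 : B * Sb * (Real.pi + ∫ θ in (0:ℝ)..Real.pi, q2 θ t ^ 2) ≤ B0 * Sb := by
    rw [hB0]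
    have := mul_le_mul_of_nonneg_left hq2 (mul_nonneg hBp.le hSb0)
    linarith
  have h2 : B0 * Sb = B0 * (Real.pi + B0 / a) * Z + a * X := by
    rw [hSb, hη]; field_simp; ring
  linarith

theorem vq_cmp {A U K : ℝ} (hA : 0 < A) (hK : 0 ≤ K) : ∃ C > 0,
    ∀ (b s0 s1 : ℝ) (u p q v : ℝ → ℝ → ℝ), Sol A b s0 s1 u p q v → ∀ t ∈ Ioo s0 s1, ∀ θ ∈ Icc 0 Real.pi,
    |u θ t| ≤ U → |p θ t| ≤ K → v θ t ^ 2 ≤ C * (q θ t ^ 2 + 1) ∧ q θ t ^ 2 ≤ C * (v θ t ^ 2 + 1) ∧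
      -(2 * (q θ t * v θ t)) ≤ -(1 / C * q θ t ^ 2) + C := by
  set a := Real.exp (-(2 * U)) / (1 + K ^ 2) with ha
  have hap : 0 < a := by have := Real.exp_pos (-(2 * U)); positivity
  set E2 := Real.exp (2 * U) with hE2
  have hE2p : 0 < E2 := Real.exp_pos _
  set c1 := E2 + A * Real.exp U * (1 + K) with hc1
  have hc1p : 0 < c1 := by positivity
  set C := 2 * E2 ^ 2 + 2 * c1 ^ 2 + (2 + 2 * c1 ^ 2) / a ^ 2 + 1 / a + c1 ^ 2 / a with hC
  have k1 : 0 < 2 * E2 ^ 2 := by positivity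
  have k2 : 0 < 2 * c1 ^ 2 := by positivity
  have k3 : 0 < (2 + 2 * c1 ^ 2) / a ^ 2 := by positivity
  have k4 : 0 < 1 / a := by positivity
  have k5 : 0 < c1 ^ 2 / a := by positivity
  have hCp : 0 < C := by linarith
  refine ⟨C, hCp, ?_⟩
  intro b s0 s1 u p q v S t ht θ hθ hu hp
  obtain ⟨b1, b2, b3⟩ := exp_bds hu
  have hv := S.v_eq hθ ht
  have hp2 : p θ t ^ 2 ≤ K ^ 2 := by rw [← sq_abs]; exact pow_le_pow_left₀ (abs_nonneg _) hp 2
  have sq1 : Real.sqrt (1 + p θ t ^ 2) ≤ 1 + K := by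
    have := sqrt_le_one_add (abs_nonneg (p θ t)) hp
    rwa [sq_abs] at this
  have sq0 := Real.sqrt_nonneg (1 + p θ t ^ 2)
  have he0 := Real.exp_pos (-u θ t)
  set c := Real.exp (-u θ t) ^ 2 / (1 + p θ t ^ 2) with hc
  have hac : a ≤ c := by rw [ha, hc]; gcongr
  have hcE : c ≤ E2 := (div_le_self (by positivity) (by nlinarith [sq_nonneg (p θ t)])).trans b2
  set r := -Real.exp (-u θ t) ^ 2 + A * Real.exp (-u θ t) * Real.sqrt (1 + p θ t ^ 2) with hr
  have hvr : v θ t = c * q θ t + r := by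
    rw [hv, hc, hr]; simp only [div_eq_mul_inv]; ring
  have hrb : |r| ≤ c1 := by
    have h1 : A * Real.exp (-u θ t) * Real.sqrt (1 + p θ t ^ 2) ≤ A * Real.exp U * (1 + K) := by gcongr
    have h2 : 0 ≤ A * Real.exp (-u θ t) * Real.sqrt (1 + p θ t ^ 2) := by positivity
    have h3 : 0 ≤ A * Real.exp U * (1 + K) := by positivity
    have h4 : 0 ≤ Real.exp (-u θ t) ^ 2 := by positivity
    rw [abs_le]; constructor <;> linarith
  have hr2 : r ^ 2 ≤ c1 ^ 2 := by rw [← sq_abs]; exact pow_le_pow_left₀ (abs_nonneg _) hrb 2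
  have hq0 := sq_nonneg (q θ t)
  have hv0 := sq_nonneg (v θ t)
  refine ⟨?_, ?_, ?_⟩
  · have h1 : (c * q θ t) ^ 2 ≤ E2 ^ 2 * q θ t ^ 2 := by
      rw [mul_pow]
      have : c ^ 2 ≤ E2 ^ 2 := pow_le_pow_left₀ (hap.le.trans hac) hcE 2
      gcongr
    have h2 := add_sq_le_of h1 hr2
    rw [← hvr] at h2
    have h3 := mul_nonneg (by linarith : 0 ≤ C - 2 * E2 ^ 2) hq0
    linarith
  · have h1 : a ^ 2 * q θ t ^ 2 ≤ (c * q θ t) ^ 2 := by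
      rw [mul_pow]
      gcongr
    have h2 := add_sq_le_of (x := v θ t) (y := -r) (b := c1 ^ 2) le_rfl (by rw [neg_sq]; exact hr2)
    rw [show v θ t + -r = c * q θ t by rw [hvr]; ring] at h2
    have h3 : q θ t ^ 2 ≤ (2 * (v θ t ^ 2 + c1 ^ 2)) / a ^ 2 := by
      rw [le_div_iff₀ (by positivity)]; linarith
    have h4 : (2 * (v θ t ^ 2 + c1 ^ 2)) / a ^ 2 ≤ (2 + 2 * c1 ^ 2) / a ^ 2 * (v θ t ^ 2 + 1) := by
      rw [div_mul_eq_mul_div]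
      apply div_le_div_of_nonneg_right _ (by positivity)
      have := mul_nonneg k2.le hv0
      linarith
    have h5 : (2 + 2 * c1 ^ 2) / a ^ 2 * (v θ t ^ 2 + 1) ≤ C * (v θ t ^ 2 + 1) := by
      apply mul_le_mul_of_nonneg_right _ (by linarith)
      linarith
    linarith
  · have h1 := young_alg (r := r) hap (mul_le_mul_of_nonneg_right hac hq0)
    have e : q θ t * v θ t = c * q θ t ^ 2 + q θ t * r := by rw [hvr]; ring
    rw [e]
    refine h1.trans ?_
    have h2 : 1 / C ≤ a := by
      rw [div_le_iff₀ hCp]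
      have : a * (1 / a) ≤ a * C := mul_le_mul_of_nonneg_left (by linarith) hap.le
      rwa [mul_one_div_cancel hap.ne'] at this
    have h3 := mul_le_mul_of_nonneg_right h2 hq0
    have h4 : r ^ 2 / a ≤ c1 ^ 2 / a := by gcongr
    linarith

theorem good_slice {A U K τ : ℝ} (hA : 0 < A) (hK : 0 ≤ K) (hτ : 0 < τ) : ∃ C > 0,
    ∀ (b s0 s1 : ℝ) (u p q v : ℝ → ℝ → ℝ), Sol A b s0 s1 u p q v → ∀ r0, s0 < r0 → r0 + τ < s1 →
    (∀ θ ∈ Icc 0 Real.pi, ∀ t ∈ Icc r0 (r0 + τ), |u θ t| ≤ U) →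
    (∀ θ ∈ Icc 0 Real.pi, ∀ t ∈ Icc r0 (r0 + τ), |p θ t| ≤ K) →
    ∃ s ∈ Ioo r0 (r0 + τ), (∫ θ in (0:ℝ)..Real.pi, v θ s ^ 2) ≤ C := by
  have hpi := Real.pi_pos
  obtain ⟨C, hC, hcmp⟩ := vq_cmp (U := U) hA hK
  refine ⟨C * (C * (C * Real.pi + K ^ 2 * Real.pi / τ) + Real.pi), by positivity, ?_⟩
  intro b s0 s1 u p q v S r0 h0 h1 hu hp
  have hder : ∀ t ∈ Ioo s0 s1, _ := fun t ht => energy_deriv (f := u) (g := p) (k := q) (w := v) (b0 := b) (b1 := b)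
    S.cp S.cq S.cv S.du S.dp S.dt S.b0 S.b1 ht
  obtain ⟨s, hs, hsl⟩ := exists_hasDerivAt_eq_slope (fun τ => ∫ θ in (0:ℝ)..Real.pi, p θ τ ^ 2) _
    (show r0 < r0 + τ by linarith)
    (fun t ht => (hder t ⟨by linarith [ht.1], by linarith [ht.2]⟩).continuousAt.continuousWithinAt)
    (fun t ht => hder t ⟨by linarith [ht.1], by linarith [ht.2]⟩)
  have hsI : s ∈ Ioo s0 s1 := ⟨by linarith [hs.1], by linarith [hs.2]⟩
  refine ⟨s, hs, ?_⟩
  have cq := slice_cont S.cq hsI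
  have cv := slice_cont S.cv hsI
  have hall := fun θ hθ => hcmp b s0 s1 u p q v S s hsI θ hθ (hu θ hθ s (Ioo_subset_Icc_self hs)) (hp θ hθ s (Ioo_subset_Icc_self hs))
  have hE0 : 0 ≤ ∫ θ in (0:ℝ)..Real.pi, p θ (r0 + τ) ^ 2 := int_nonneg (fun _ _ => sq_nonneg _)
  have hE1 : ∫ θ in (0:ℝ)..Real.pi, p θ r0 ^ 2 ≤ K ^ 2 * Real.pi := by
    refine int_le_const ((slice_cont S.cp ⟨h0, by linarith⟩).pow 2) (fun θ hθ => ?_)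
    rw [← sq_abs]; exact pow_le_pow_left₀ (abs_nonneg _) (hp θ hθ r0 ⟨le_rfl, by linarith⟩) 2
  have i1 := int_mono (f := fun θ => -(2 * (q θ s * v θ s))) (g := fun θ => -(1 / C * q θ s ^ 2) + C)
    (by fun_prop) (by fun_prop) (fun θ hθ => (hall θ hθ).2.2)
  rw [intervalIntegral.integral_neg, intervalIntegral.integral_const_mul,
    intervalIntegral.integral_add (slice_int (by fun_prop)) (slice_int (by fun_prop)),
    intervalIntegral.integral_neg, intervalIntegral.integral_const_mul, 
    intervalIntegral.integral_const, sub_zero, smul_eq_mul, hsl] at i1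
  have i2 := int_mono (f := fun θ => v θ s ^ 2) (g := fun θ => C * (q θ s ^ 2 + 1))
    (by fun_prop) (by fun_prop) (fun θ hθ => (hall θ hθ).1)
  rw [intervalIntegral.integral_const_mul,
    intervalIntegral.integral_add (slice_int (by fun_prop)) (slice_int (by fun_prop)),
    intervalIntegral.integral_const, sub_zero, smul_eq_mul, mul_one] at i2
  refine i2.trans ?_
  set Q := ∫ θ in (0:ℝ)..Real.pi, q θ s ^ 2
  have j1 : -(K ^ 2 * Real.pi / τ) ≤ ((∫ θ in (0:ℝ)..Real.pi, p θ (r0 + τ) ^ 2) - ∫ θ in (0:ℝ)..Real.pi, p θ r0 ^ 2) / (r0 + τ - r0) := by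
    rw [add_sub_cancel_left, ← neg_div]
    apply div_le_div_of_nonneg_right _ hτ.le
    linarith
  have j2 : 1 / C * Q ≤ C * Real.pi + K ^ 2 * Real.pi / τ := by linarith
  have j3 : Q ≤ C * (C * Real.pi + K ^ 2 * Real.pi / τ) := by
    have := mul_le_mul_of_nonneg_left j2 hC.le
    rwa [← mul_assoc, mul_one_div_cancel hC.ne', one_mul] at this
  gcongr

theorem exp_low {a b U : ℝ} (ha : |a| ≤ U) (hb : |b| ≤ U) :
    Real.exp (-U) * |a - b| ≤ |Real.exp a - Real.exp b| := by
  wlog h : b ≤ a generalizing a b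
  · have := this hb ha (le_of_not_ge h)
    rwa [abs_sub_comm, abs_sub_comm (Real.exp a)]
  rw [abs_of_nonneg (by linarith), abs_of_nonneg (by linarith [Real.exp_le_exp.2 h])]
  have e : Real.exp a - Real.exp b = Real.exp b * (Real.exp (a - b) - 1) := by
    rw [mul_sub, ← Real.exp_add]; ring_nf
  rw [e]
  have h1 : Real.exp (-U) ≤ Real.exp b := Real.exp_le_exp.2 (abs_le.1 hb).1
  have h2 := Real.add_one_le_exp (a - b)
  exact mul_le_mul h1 (by linarith) (by linarith) (Real.exp_pos _).le

theorem JF_quot {A U : ℝ} (hA : 0 < A) : ∃ C > 0,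
    ∀ (b s0 s1 : ℝ) (u p q v : ℝ → ℝ → ℝ), Sol A b s0 s1 u p q v → ∀ t t', s0 < t → t < t' → t' < s1 →
    (∀ θ ∈ Icc 0 Real.pi, ∀ τ ∈ Icc t t', |u θ τ| ≤ U) →
    ∀ᶠ h in nhdsWithin (0:ℝ) (Ioi 0),
      JF A (fun θ τ => u θ (τ + h)) u t ≤ C * h ^ 2 * ((∫ θ in (0:ℝ)..Real.pi, v θ t ^ 2) + 1) ∧
      h ^ 2 * (∫ θ in (0:ℝ)..Real.pi, v θ t ^ 2) ≤ C * (JF A (fun θ τ => u θ (τ + h)) u t + h ^ 2) := by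
  have hpi := Real.pi_pos
  set m := Real.exp (-U) with hm
  set M := Real.exp U with hM
  have hmp : 0 < m := Real.exp_pos _
  have hMp : 0 < M := Real.exp_pos _
  set B := Real.exp (2 * A / Real.pi * M) * M ^ 2 / 2 with hB
  have hBp : 0 < B := by positivity
  have k1 : 0 < B * M ^ 2 * 2 := by positivity
  have k2 : 0 < B * M ^ 2 * (2 * Real.pi) := by positivity
  have k3 : 0 < 4 / m ^ 4 := by positivity
  have k4 : 0 < 2 * Real.pi := by positivity
  set C := B * M ^ 2 * 2 + B * M ^ 2 * (2 * Real.pi) + 4 / m ^ 4 + 2 * Real.pi with hC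
  refine ⟨C, by positivity, ?_⟩
  intro b s0 s1 u p q v S t t' h0 h1 h2 hu
  have htI : t ∈ Ioo s0 s1 := ⟨h0, h1.trans h2⟩
  filter_upwards [quot_unif S htI, Ioo_mem_nhdsGT (sub_pos.2 h1)] with h hh hI
  have hh0 : 0 < h := hI.1
  have hthI : t + h ∈ Ioo s0 s1 := ⟨by linarith, by linarith [hI.2]⟩
  have c1 : ContinuousOn (fun θ => u θ (t + h)) (Icc 0 Real.pi) := slice_cont S.cu hthI
  have c2 : ContinuousOn (fun θ => u θ t) (Icc 0 Real.pi) := slice_cont S.cu htI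
  have cv : ContinuousOn (fun θ => v θ t) (Icc 0 Real.pi) := slice_cont S.cv htI
  have b1 : ∀ θ ∈ Icc 0 Real.pi, |u θ (t + h)| ≤ U := fun θ hθ => hu θ hθ _ ⟨by linarith, by linarith [hI.2]⟩
  have b2 : ∀ θ ∈ Icc 0 Real.pi, |u θ t| ≤ U := fun θ hθ => hu θ hθ _ ⟨le_rfl, h1.le⟩
  have lo := JF_lower (u1 := fun θ τ => u θ (τ + h)) (u2 := u) hA hmp c1 c2 (fun θ hθ => exp_mem (b1 θ hθ)) (fun θ hθ => exp_mem (b2 θ hθ))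
  have up := JF_upper (u1 := fun θ τ => u θ (τ + h)) (u2 := u) hA hmp c1 c2 (fun θ hθ => exp_mem (b1 θ hθ)) (fun θ hθ => exp_mem (b2 θ hθ))
  rw [← hB] at up
  set J := JF A (fun θ τ => u θ (τ + h)) u t
  set I := ∫ θ in (0:ℝ)..Real.pi, (Real.exp (u θ (t + h)) - Real.exp (u θ t)) ^ 2 with hIdef
  set V := ∫ θ in (0:ℝ)..Real.pi, v θ t ^ 2 with hV
  have hV0 : 0 ≤ V := int_nonneg (fun _ _ => sq_nonneg _)
  have hI0 : 0 ≤ I := int_nonneg (fun _ _ => sq_nonneg _)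
  have hJ0 : 0 ≤ J := le_trans (by positivity) lo
  have hs : ∀ θ ∈ Icc 0 Real.pi, (u θ (t + h) - u θ t - h * v θ t) ^ 2 ≤ h ^ 2 := fun θ hθ => by
    rw [← sq_abs]; exact pow_le_pow_left₀ (abs_nonneg _) (hh θ hθ) 2
  have pu : ∀ θ ∈ Icc 0 Real.pi, (Real.exp (u θ (t + h)) - Real.exp (u θ t)) ^ 2 ≤ M ^ 2 * (2 * (h ^ 2 + h ^ 2 * v θ t ^ 2)) := by
    intro θ hθ
    have a1 := pow_le_pow_left₀ (abs_nonneg _) (exp_lip (b1 θ hθ) (b2 θ hθ)) 2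
    rw [sq_abs, mul_pow, sq_abs] at a1
    refine a1.trans ?_
    have a2 := add_sq_le_of (hs θ hθ) (le_refl ((h * v θ t) ^ 2))
    rw [sub_add_cancel, mul_pow] at a2
    exact mul_le_mul_of_nonneg_left a2 (by positivity)
  have pl : ∀ θ ∈ Icc 0 Real.pi, h ^ 2 * v θ t ^ 2 ≤ 2 * (h ^ 2 + 1 / m ^ 2 * (Real.exp (u θ (t + h)) - Real.exp (u θ t)) ^ 2) := by
    intro θ hθ
    have a1 := pow_le_pow_left₀ (by positivity) (exp_low (b1 θ hθ) (b2 θ hθ)) 2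
    rw [sq_abs, mul_pow, sq_abs, ← hm] at a1
    have a3 : (u θ (t + h) - u θ t) ^ 2 ≤ 1 / m ^ 2 * (Real.exp (u θ (t + h)) - Real.exp (u θ t)) ^ 2 := by
      rw [one_div, inv_mul_eq_div, le_div_iff₀ (by positivity)]; linarith
    have a2 := add_sq_le_of (x := -(u θ (t + h) - u θ t - h * v θ t)) (a := h ^ 2) (by rw [neg_sq]; exact hs θ hθ) a3
    rw [show -(u θ (t + h) - u θ t - h * v θ t) + (u θ (t + h) - u θ t) = h * v θ t by ring, mul_pow] at a2
    exact a2
  have iu := int_mono (by fun_prop) (by fun_prop) pu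
  have il := int_mono (by fun_prop) (by fun_prop) pl
  rw [intervalIntegral.integral_const_mul, intervalIntegral.integral_const_mul,
    intervalIntegral.integral_add (slice_int (by fun_prop)) (slice_int (by fun_prop)),
    intervalIntegral.integral_const, sub_zero, smul_eq_mul, intervalIntegral.integral_const_mul, ← hIdef, ← hV] at iu
  rw [intervalIntegral.integral_const_mul, intervalIntegral.integral_const_mul,
    intervalIntegral.integral_add (slice_int (by fun_prop)) (slice_int (by fun_prop)),
    intervalIntegral.integral_const, sub_zero, smul_eq_mul, intervalIntegral.integral_const_mul, ← hIdef, ← hV] at il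
  have hh2 : 0 ≤ h ^ 2 := sq_nonneg h
  constructor
  · have a1 := mul_le_mul_of_nonneg_left iu hBp.le
    have a2 := mul_nonneg (mul_nonneg (by linarith : 0 ≤ C - B * M ^ 2 * 2) hh2) hV0
    have a3 := mul_nonneg (by linarith : 0 ≤ C - B * M ^ 2 * (2 * Real.pi)) hh2
    linarith
  · have a1 : I ≤ 2 / m ^ 2 * J := by
      rw [div_mul_eq_mul_div, le_div_iff₀ (by positivity)]; linarith
    have a4 := mul_le_mul_of_nonneg_left a1 (by positivity : 0 ≤ 2 * (1 / m ^ 2))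
    have e : 2 * (1 / m ^ 2) * (2 / m ^ 2 * J) = 4 / m ^ 4 * J := by field_simp; ring
    rw [e] at a4
    have a2 := mul_nonneg (by linarith : 0 ≤ C - 4 / m ^ 4) hJ0
    have a3 := mul_nonneg (by linarith : 0 ≤ C - 2 * Real.pi) hh2
    linarith

set_option maxHeartbeats 1000000 in
theorem v_L2 {A U K τ : ℝ} (hA : 0 < A) (hK : 0 ≤ K) (hτ : 0 < τ) : ∃ C > 0,
    ∀ (b s0 s1 : ℝ) (u p q v : ℝ → ℝ → ℝ), Sol A b s0 s1 u p q v → ∀ r0, s0 < r0 → r0 + 4 * τ < s1 →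
    (∀ θ ∈ Icc 0 Real.pi, ∀ t ∈ Icc r0 (r0 + 4 * τ), |u θ t| ≤ U) →
    (∀ θ ∈ Icc 0 Real.pi, ∀ t ∈ Icc r0 (r0 + 4 * τ), |p θ t| ≤ K) →
    ∀ t ∈ Icc (r0 + τ) (r0 + 3 * τ), (∫ θ in (0:ℝ)..Real.pi, v θ t ^ 2) ≤ C := by
  obtain ⟨V0, hV0, hgood⟩ := good_slice (U := U) hA hK hτ
  obtain ⟨CJ, hCJ, hJ⟩ := JF_quot (U := U) hA
  obtain ⟨CG, hCG, hG⟩ := pair_good (U := U) hA (by positivity : 0 < 4 * τ)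
  refine ⟨CJ * (CG * (CJ * (V0 + 1)) + 1), by positivity, ?_⟩
  intro b s0 s1 u p q v S r0 h0 h1 hu hp t ht
  obtain ⟨s, hs, hsV⟩ := hgood b s0 s1 u p q v S r0 h0 (by linarith)
    (fun θ hθ t ht => hu θ hθ t ⟨ht.1, by linarith [ht.2]⟩) (fun θ hθ t ht => hp θ hθ t ⟨ht.1, by linarith [ht.2]⟩)
  have e1 := hJ b s0 s1 u p q v S s (r0 + 4 * τ) (by linarith [hs.1]) (by linarith [hs.2]) h1
    (fun θ hθ t ht => hu θ hθ t ⟨by linarith [ht.1, hs.1], ht.2⟩)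
  have e2 := hJ b s0 s1 u p q v S t (r0 + 4 * τ) (by linarith [ht.1]) (by linarith [ht.2]) h1
    (fun θ hθ t' ht' => hu θ hθ t' ⟨by linarith [ht.1, ht'.1], ht'.2⟩)
  obtain ⟨h, ⟨⟨e1u, -⟩, -, e2l⟩, hh⟩ := ((e1.and e2).and (Ioo_mem_nhdsGT hτ)).exists
  have hh0 : 0 < h := hh.1
  have hh1 : h < τ := hh.2
  have g := (hG b s0 (s1 - h) _ _ _ _ u p q v ((S.shift h).mono (by linarith) le_rfl) (S.mono le_rfl (by linarith))
    s t (by linarith [hs.1]) (by linarith [hs.2, ht.1]) (by linarith [ht.2]) (by linarith [ht.2, hs.1])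
    (fun θ hθ t' ht' => hu θ hθ _ ⟨by linarith [ht'.1, hs.1], by linarith [ht'.2, ht.2]⟩)
    (fun θ hθ t' ht' => hu θ hθ _ ⟨by linarith [ht'.1, hs.1], by linarith [ht'.2, ht.2]⟩)).1 t
    ⟨by linarith [hs.2, ht.1], le_rfl⟩
  have hh2 : 0 < h ^ 2 := by positivity
  have a1 : CJ * h ^ 2 * ((∫ θ in (0:ℝ)..Real.pi, v θ s ^ 2) + 1) ≤ CJ * h ^ 2 * (V0 + 1) := by gcongr
  have a2 := mul_le_mul_of_nonneg_left (e1u.trans a1) hCG.le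
  have a3 := mul_le_mul_of_nonneg_left (g.trans a2) hCJ.le
  have a4 : h ^ 2 * (∫ θ in (0:ℝ)..Real.pi, v θ t ^ 2) ≤ h ^ 2 * (CJ * (CG * (CJ * (V0 + 1)) + 1)) := by linarith
  exact le_of_mul_le_mul_left a4 hh2

set_option maxHeartbeats 1000000 in
theorem reg_bound {A U K τ : ℝ} (hA : 0 < A) (hK : 0 ≤ K) (hτ : 0 < τ) : ∃ C > 0,
    ∀ (b s0 s1 : ℝ) (u p q v : ℝ → ℝ → ℝ), Sol A b s0 s1 u p q v → ∀ r0, s0 < r0 → r0 + 4 * τ < s1 →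
    (∀ θ ∈ Icc 0 Real.pi, ∀ t ∈ Icc r0 (r0 + 4 * τ), |u θ t| ≤ U) →
    (∀ θ ∈ Icc 0 Real.pi, ∀ t ∈ Icc r0 (r0 + 4 * τ), |p θ t| ≤ K) →
    ∀ x ∈ Icc 0 Real.pi, ∀ y ∈ Icc 0 Real.pi,
      (v x (r0 + 3 * τ) - v y (r0 + 3 * τ)) ^ 2 ≤ C * |x - y| := by
  have hpi := Real.pi_pos
  obtain ⟨V1, hV1, hL2⟩ := v_L2 (U := U) hA hK hτ
  obtain ⟨CJ, hCJ, hJ⟩ := JF_quot (U := U) hA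
  obtain ⟨CG, hCG, hG⟩ := pair_good (U := U) hA hτ
  obtain ⟨Cv, hCv, hcmp⟩ := vq_cmp (U := U) hA hK
  set Q1 := Cv * (V1 + Real.pi) with hQ1
  have hQ1p : 0 < Q1 := by positivity
  obtain ⟨CZ, hCZ, hZ⟩ := Z_ineq (U := U) hA hK hQ1p.le
  set C3 := (1 + K ^ 2) * (CG * (1 + 1 / τ) * (CJ * (V1 + 1))) with hC3
  have hC3p : 0 < C3 := by positivity
  refine ⟨Real.exp (CZ * (2 * τ)) * C3, by positivity, ?_⟩
  intro b s0 s1 u p q v S r0 h0 h1 hu hp x hx y hy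
  have hV := hL2 b s0 s1 u p q v S r0 h0 h1 hu hp
  have hQ : ∀ t ∈ Icc (r0 + τ) (r0 + 3 * τ), (∫ θ in (0:ℝ)..Real.pi, q θ t ^ 2) ≤ Q1 := by
    intro t ht
    have htI : t ∈ Ioo s0 s1 := ⟨by linarith [ht.1], by linarith [ht.2]⟩
    have cq := slice_cont S.cq htI
    have cv := slice_cont S.cv htI
    have htI2 : t ∈ Icc r0 (r0 + 4 * τ) := ⟨by linarith [ht.1], by linarith [ht.2]⟩
    have i2 := int_mono (f := fun θ => q θ t ^ 2) (g := fun θ => Cv * (v θ t ^ 2 + 1))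
      (by fun_prop) (by fun_prop) (fun θ hθ => (hcmp b s0 s1 u p q v S t htI θ hθ (hu θ hθ t htI2) (hp θ hθ t htI2)).2.1)
    rw [intervalIntegral.integral_const_mul,
      intervalIntegral.integral_add (slice_int (by fun_prop)) (slice_int (by fun_prop)),
      intervalIntegral.integral_const, sub_zero, smul_eq_mul, mul_one] at i2
    refine i2.trans (mul_le_mul_of_nonneg_left ?_ hCv.le)
    linarith [hV t ht]
  set t := r0 + 3 * τ with ht
  have htI : t ∈ Ioo s0 s1 := ⟨by linarith, by linarith⟩
  have e1 := hJ b s0 s1 u p q v S (r0 + τ) (r0 + 4 * τ) (by linarith) (by linarith) h1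
    (fun θ hθ t ht => hu θ hθ t ⟨by linarith [ht.1], ht.2⟩)
  have key : ∀ᶠ h in nhdsWithin (0:ℝ) (Ioi 0),
      (h⁻¹ • (u x (t + h) - u x t) - h⁻¹ • (u y (t + h) - u y t)) ^ 2 ≤ Real.exp (CZ * (2 * τ)) * C3 * |x - y| := by
    filter_upwards [e1, Ioo_mem_nhdsGT hτ] with h e1h hh
    have hh0 : 0 < h := hh.1
    have hh1 : h < τ := hh.2
    have Sh : Sol A b s0 (s1 - h) (fun θ t => u θ (t + h)) (fun θ t => p θ (t + h))
      (fun θ t => q θ (t + h)) (fun θ t => v θ (t + h)) := (S.shift h).mono (by linarith) le_rfl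
    have Sm : Sol A b s0 (s1 - h) u p q v := S.mono le_rfl (by linarith)
    obtain ⟨g, hg, hgD⟩ := (hG b s0 (s1 - h) _ _ _ _ u p q v Sh Sm
      (r0 + τ) (r0 + 2 * τ) (by linarith) (by linarith) (by linarith) (by linarith)
      (fun θ hθ t' ht' => hu θ hθ _ ⟨by linarith [ht'.1], by linarith [ht'.2]⟩)
      (fun θ hθ t' ht' => hu θ hθ _ ⟨by linarith [ht'.1], by linarith [ht'.2]⟩)).2
    rw [show r0 + 2 * τ - (r0 + τ) = τ by ring] at hgD
    have a0 := e1h.1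
    have a1 : CJ * h ^ 2 * ((∫ θ in (0:ℝ)..Real.pi, v θ (r0 + τ) ^ 2) + 1) ≤ CJ * h ^ 2 * (V1 + 1) := by
      have := hV (r0 + τ) ⟨le_rfl, by linarith⟩
      gcongr
    have a2 := mul_le_mul_of_nonneg_left (a0.trans a1) (by positivity : 0 ≤ CG * (1 + 1 / τ))
    have hD := hgD.trans a2
    have hgI : g ∈ Ioo s0 (s1 - h) := ⟨by linarith [hg.1], by linarith [hg.2]⟩
    have cp1 := slice_cont (f := fun θ t => p θ (t + h)) Sh.cp hgI
    have cp2 := slice_cont Sm.cp hgI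
    set Z := fun τ => ∫ θ in (0:ℝ)..Real.pi, (p θ (τ + h) - p θ τ) ^ 2 with hZdef
    have hZg : Z g ≤ C3 * h ^ 2 := by
      have i1 := int_mono (f := fun θ => (p θ (g + h) - p θ g) ^ 2)
        (g := fun θ => (1 + K ^ 2) * ((Real.arctan (p θ (g + h)) - Real.arctan (p θ g)) * (p θ (g + h) - p θ g)))
        (by fun_prop) (by
          have := Real.continuous_arctan.comp_continuousOn cp1
          have := Real.continuous_arctan.comp_continuousOn cp2
          simp only [Function.comp_def] at *
          fun_prop) (fun θ hθ => by
          have := D_low (hp θ hθ (g + h) ⟨by linarith [hg.1], by linarith [hg.2]⟩) (hp θ hθ g ⟨by linarith [hg.1], by linarith [hg.2]⟩)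
          rw [div_le_iff₀ (by positivity)] at this
          linarith)
      rw [intervalIntegral.integral_const_mul] at i1
      refine i1.trans ?_
      have i2 := mul_le_mul_of_nonneg_left hD (by positivity : 0 ≤ 1 + K ^ 2)
      rw [hC3]
      unfold DF at i2
      linarith
    have hder : ∀ r ∈ Icc g t, ∃ Z', HasDerivAt Z Z' r ∧ Z' ≤ CZ * Z r := by
      intro r hr
      exact hZ b s0 (s1 - h) _ _ _ _ u p q v Sh Sm r ⟨by linarith [hr.1, hg.1], by linarith [hr.2]⟩
        (fun θ hθ => hu θ hθ _ ⟨by linarith [hr.1, hg.1], by linarith [hr.2]⟩)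
        (fun θ hθ => hu θ hθ _ ⟨by linarith [hr.1, hg.1], by linarith [hr.2]⟩)
        (fun θ hθ => hp θ hθ _ ⟨by linarith [hr.1, hg.1], by linarith [hr.2]⟩)
        (fun θ hθ => hp θ hθ _ ⟨by linarith [hr.1, hg.1], by linarith [hr.2]⟩)
        (hQ r ⟨by linarith [hr.1, hg.1], hr.2⟩)
    have hgt : g ≤ t := by linarith [hg.2]
    have hgr := gronwall_simple (J := Z) (J' := deriv Z) (C := CZ) hgt
      (fun r hr => by
        obtain ⟨Z', hz, -⟩ := hder r hr
        exact hz.continuousAt.continuousWithinAt)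
      (fun r hr => by
        obtain ⟨Z', hz, -⟩ := hder r (Ioo_subset_Icc_self hr)
        exact hz.differentiableAt.hasDerivAt)
      (fun r hr => by
        obtain ⟨Z', hz, hle⟩ := hder r (Ioo_subset_Icc_self hr)
        rw [hz.deriv]; exact hle)
    have hZt : Z t ≤ Real.exp (CZ * (2 * τ)) * (C3 * h ^ 2) := by
      refine hgr.trans (mul_le_mul ?_ hZg (int_nonneg (fun _ _ => sq_nonneg _)) (Real.exp_pos _).le)
      apply Real.exp_le_exp.2
      apply mul_le_mul_of_nonneg_left _ hCZ.le
      linarith [hg.1]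
    have htI' : t ∈ Ioo s0 (s1 - h) := ⟨by linarith, by linarith⟩
    have hol := holder_half (f := fun θ => u θ (t + h) - u θ t) (g := fun θ => p θ (t + h) - p θ t)
      (fun θ hθ => (Sh.du θ hθ t htI').sub (Sm.du θ hθ t htI'))
      ((slice_cont (f := fun θ t => p θ (t + h)) Sh.cp htI').sub (slice_cont Sm.cp htI')) hx hy
    have hol2 := hol.trans (mul_le_mul_of_nonneg_left hZt (abs_nonneg (x - y)))
    rw [← smul_sub, smul_eq_mul, mul_pow, inv_pow, inv_mul_eq_div, div_le_iff₀ (by positivity)]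
    linarith
  have lim : ∀ θ ∈ Icc 0 Real.pi, Filter.Tendsto (fun h : ℝ => h⁻¹ • (u θ (t + h) - u θ t)) (nhdsWithin 0 (Ioi 0)) (nhds (v θ t)) :=
    fun θ hθ => (hasDerivAt_iff_tendsto_slope_zero.1 (S.dt θ hθ t htI)).mono_left (nhdsGT_le_nhdsNE 0)
  exact le_of_tendsto (((lim x hx).sub (lim y hy)).pow 2) key

theorem unif3 {F : ℝ × ℝ × ℝ → ℝ} (hF : Continuous F) (B : ℝ) {ε : ℝ} (hε : 0 < ε) : ∃ δ > 0,
    ∀ a b c a' b' c' : ℝ, |a| ≤ B → |b| ≤ B → |c| ≤ B → |a'| ≤ B → |b'| ≤ B → |c'| ≤ B →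
    |a - a'| < δ → |b - b'| < δ → |c - c'| < δ → |F (a, b, c) - F (a', b', c')| < ε := by
  have hc : IsCompact (Icc (-B) B ×ˢ (Icc (-B) B ×ˢ Icc (-B) B)) :=
    isCompact_Icc.prod (isCompact_Icc.prod isCompact_Icc)
  have huc := hc.uniformContinuousOn_of_continuous hF.continuousOn
  rw [Metric.uniformContinuousOn_iff] at huc
  obtain ⟨δ, hδ, h⟩ := huc ε hε
  refine ⟨δ, hδ, ?_⟩
  intro a b c a' b' c' ha hb hc ha' hb' hc' h1 h2 h3
  have := h (a, b, c) ⟨abs_le.1 ha, abs_le.1 hb, abs_le.1 hc⟩ (a', b', c') ⟨abs_le.1 ha', abs_le.1 hb', abs_le.1 hc'⟩ (by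
    rw [Prod.dist_eq, Prod.dist_eq, Real.dist_eq, Real.dist_eq, Real.dist_eq]
    exact max_lt h1 (max_lt h2 h3))
  rwa [Real.dist_eq] at this

theorem lip_of_deriv {f g : ℝ → ℝ} (hd : ∀ θ ∈ Icc 0 Real.pi, HasDerivWithinAt f (g θ) (Icc 0 Real.pi) θ)
    {C : ℝ} (hg : ∀ θ ∈ Icc 0 Real.pi, |g θ| ≤ C) {x y : ℝ} (hx : x ∈ Icc 0 Real.pi) (hy : y ∈ Icc 0 Real.pi) :
    |f x - f y| ≤ C * |x - y| :=
  (convex_Icc 0 Real.pi).norm_image_sub_le_of_norm_hasDerivWithin_le hd hg hy hx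

theorem Sol.q_eq {A b s0 s1 : ℝ} {u p q v : ℝ → ℝ → ℝ} (S : Sol A b s0 s1 u p q v) {θ t : ℝ}
    (hθ : θ ∈ Icc 0 Real.pi) (ht : t ∈ Ioo s0 s1) :
    q θ t = (1 + p θ t ^ 2) * (Real.exp (u θ t) ^ 2 * v θ t + 1 - A * Real.exp (u θ t) * Real.sqrt (1 + p θ t ^ 2)) := by
  rw [S.pde θ hθ t ht]
  have : (1 + p θ t ^ 2) ≠ 0 := by positivity
  field_simp
  ring

theorem Sol.v_zero {A b s0 s1 : ℝ} {u p q v : ℝ → ℝ → ℝ} (S : Sol A b s0 s1 u p q v) {t : ℝ}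
    (ht : t ∈ Ioo s0 s1) : v 0 t = 0 := by
  have h1 := S.dt 0 ⟨le_rfl, Real.pi_pos.le⟩ t ht
  have h2 : HasDerivAt (fun τ => u 0 τ) 0 t :=
    (hasDerivAt_const t b).congr_of_eventuallyEq (by
      filter_upwards [Ioo_mem_nhds ht.1 ht.2] with τ hτ
      exact S.b0 τ hτ)
  exact h1.unique h2

set_option maxHeartbeats 1000000 in
theorem equi {A U K τ : ℝ} (hA : 0 < A) (hK : 0 ≤ K) (hτ : 0 < τ) : ∃ Q > 0, ∀ ε > 0, ∃ δ > 0,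
    ∀ (b s0 s1 : ℝ) (u p q v : ℝ → ℝ → ℝ), Sol A b s0 s1 u p q v → ∀ r0, s0 < r0 → r0 + 4 * τ < s1 →
    (∀ θ ∈ Icc 0 Real.pi, ∀ t ∈ Icc r0 (r0 + 4 * τ), |u θ t| ≤ U) →
    (∀ θ ∈ Icc 0 Real.pi, ∀ t ∈ Icc r0 (r0 + 4 * τ), |p θ t| ≤ K) →
    (∀ θ ∈ Icc 0 Real.pi, |q θ (r0 + 3 * τ)| ≤ Q) ∧
    ∀ x ∈ Icc 0 Real.pi, ∀ y ∈ Icc 0 Real.pi, |x - y| ≤ δ → |q x (r0 + 3 * τ) - q y (r0 + 3 * τ)| ≤ ε := by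
  have hpi := Real.pi_pos
  obtain ⟨C, hC, hreg⟩ := reg_bound (U := U) hA hK hτ
  obtain ⟨Cv, hCv, hcmp⟩ := vq_cmp (U := U) hA hK
  set V := Real.sqrt (C * Real.pi) with hV
  have hV0 : 0 ≤ V := Real.sqrt_nonneg _
  set Q := Real.sqrt (Cv * (C * Real.pi + 1)) with hQ
  have hQp : 0 < Q := Real.sqrt_pos.2 (by positivity)
  refine ⟨Q, hQp, ?_⟩
  intro ε hε
  set F : ℝ × ℝ × ℝ → ℝ := fun z => (1 + z.2.1 ^ 2) * (Real.exp z.1 ^ 2 * z.2.2 + 1 - A * Real.exp z.1 * Real.sqrt (1 + z.2.1 ^ 2)) with hF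
  have hFc : Continuous F := by rw [hF]; fun_prop
  set B := max U (max K V) with hB
  have hUB : U ≤ B := le_max_left _ _
  have hKB : K ≤ B := (le_max_left _ _).trans (le_max_right _ _)
  have hVB : V ≤ B := (le_max_right _ _).trans (le_max_right _ _)
  obtain ⟨d, hd, hunif⟩ := unif3 hFc B hε
  set δ := min (d / (2 * (K + 1))) (min (d / (2 * Q)) (d ^ 2 / (4 * C))) with hδ
  have hδp : 0 < δ := by
    have : 0 < d / (2 * (K + 1)) := by positivity
    have : 0 < d / (2 * Q) := by positivity
    have : 0 < d ^ 2 / (4 * C) := by positivity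
    exact lt_min ‹_› (lt_min ‹_› ‹_›)
  have d1 : δ ≤ d / (2 * (K + 1)) := min_le_left _ _
  have d2 : δ ≤ d / (2 * Q) := (min_le_right _ _).trans (min_le_left _ _)
  have d3 : δ ≤ d ^ 2 / (4 * C) := (min_le_right _ _).trans (min_le_right _ _)
  rw [le_div_iff₀ (by positivity)] at d1 d2 d3
  refine ⟨δ, hδp, ?_⟩
  intro b s0 s1 u p q v S r0 h0 h1 hu hp
  have hv := hreg b s0 s1 u p q v S r0 h0 h1 hu hp
  set t := r0 + 3 * τ with ht
  have htI : t ∈ Ioo s0 s1 := ⟨by linarith, by linarith⟩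
  have htI2 : t ∈ Icc r0 (r0 + 4 * τ) := ⟨by linarith, by linarith⟩
  have hv2 : ∀ θ ∈ Icc 0 Real.pi, v θ t ^ 2 ≤ C * Real.pi := by
    intro θ hθ
    have := hv θ hθ 0 ⟨le_rfl, hpi.le⟩
    rw [S.v_zero htI, sub_zero, sub_zero, abs_of_nonneg hθ.1] at this
    exact this.trans (mul_le_mul_of_nonneg_left hθ.2 hC.le)
  have hvV : ∀ θ ∈ Icc 0 Real.pi, |v θ t| ≤ V := fun θ hθ => Real.abs_le_sqrt (hv2 θ hθ)
  have hqQ : ∀ θ ∈ Icc 0 Real.pi, |q θ t| ≤ Q := by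
    intro θ hθ
    apply Real.abs_le_sqrt
    refine (hcmp b s0 s1 u p q v S t htI θ hθ (hu θ hθ t htI2) (hp θ hθ t htI2)).2.1.trans ?_
    have := hv2 θ hθ
    gcongr
  refine ⟨hqQ, ?_⟩
  intro x hx y hy hxy
  have l1 := lip_of_deriv (fun θ hθ => S.du θ hθ t htI) (fun θ hθ => hp θ hθ t htI2) hx hy
  have l2 := lip_of_deriv (fun θ hθ => S.dp θ hθ t htI) hqQ hx hy
  have l3 := hv x hx y hy
  have m1 : K * |x - y| ≤ K * δ := mul_le_mul_of_nonneg_left hxy hK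
  have m2 : Q * |x - y| ≤ Q * δ := mul_le_mul_of_nonneg_left hxy hQp.le
  have m3 : C * |x - y| ≤ C * δ := mul_le_mul_of_nonneg_left hxy hC.le
  have n3 : |v x t - v y t| < d := by
    apply abs_lt_of_sq_lt_sq _ hd.le
    nlinarith
  rw [S.q_eq hx htI, S.q_eq hy htI]
  exact (hunif (u x t) (p x t) (v x t) (u y t) (p y t) (v y t) ((hu x hx t htI2).trans hUB) ((hp x hx t htI2).trans hKB)
    ((hvV x hx).trans hVB) ((hu y hy t htI2).trans hUB) ((hp y hy t htI2).trans hKB)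
    ((hvV y hy).trans hVB) (by linarith) (by linarith) n3).le

set_option maxHeartbeats 1000000 in
theorem sol_C2 {A b T : ℝ} (hA : 0 < A) (hT : 0 < T) {u2 p2 q2 v2 : ℝ → ℝ → ℝ}
    (S2 : Sol A b 0 T u2 p2 q2 v2)
    (cu2 : ContinuousOn (fun z : ℝ × ℝ => u2 z.1 z.2) (Icc 0 Real.pi ×ˢ Ico 0 T))
    (hb : u2 0 0 = b) {t : ℝ} (ht : t ∈ Ioo 0 T) {ε : ℝ} (hε : 0 < ε) :
    ∃ δ > 0, ∀ u1 p1 q1 v1 : ℝ → ℝ → ℝ, Sol A b 0 T u1 p1 q1 v1 →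
      ContinuousOn (fun z : ℝ × ℝ => u1 z.1 z.2) (Icc 0 Real.pi ×ˢ Ico 0 T) →
      (∀ θ ∈ Icc 0 Real.pi, |u1 θ 0 - u2 θ 0| < δ) →
      ∀ θ ∈ Icc 0 Real.pi, |u1 θ t - u2 θ t| ≤ ε ∧ |p1 θ t - p2 θ t| ≤ ε ∧ |q1 θ t - q2 θ t| ≤ ε := by
  have hpi := Real.pi_pos
  obtain ⟨ht0, htT⟩ := ht
  obtain ⟨τ, hτ, hτ1, hτ2⟩ : ∃ τ > 0, 0 < t - 4 * τ ∧ t + τ < T := by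
    have m1 := min_le_left t (T - t)
    have m2 := min_le_right t (T - t)
    have m3 : 0 < min t (T - t) := lt_min ht0 (by linarith)
    exact ⟨min t (T - t) / 8, by linarith, by linarith, by linarith⟩
  have hsub : Icc (t - 4 * τ) (t + τ) ⊆ Ioo 0 T := fun s hs => ⟨by linarith [hs.1], by linarith [hs.2]⟩
  obtain ⟨U0, hU0, hu2⟩ := joint_bdd S2.cu hsub
  obtain ⟨G, hG, hp2⟩ := joint_bdd S2.cp hsub
  set U := U0 + 1 with hU
  obtain ⟨ε0, K0, hε0, hK0, hgrad⟩ := grad_bound (U := U) hA hG.le hτ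
  set K := max K0 G with hK
  have hKp : 0 ≤ K := hK0.le.trans (le_max_left _ _)
  obtain ⟨Q, hQ, hequi⟩ := equi (U := U) hA hKp hτ
  obtain ⟨d1, hd1, he⟩ := hequi (ε / 4) (by linarith)
  set δ1 := min d1 (Real.pi / 2) with hδ1
  have hδ1p : 0 < δ1 := lt_min hd1 (by linarith)
  set η := min ε (ε * δ1 / 4) with hη
  have hηp : 0 < η := lt_min hε (by positivity)
  have hη1 : η ≤ ε := min_le_left _ _
  have hη2 : η ≤ ε * δ1 / 4 := min_le_right _ _
  set δ2 := min (Real.pi / 2) (η / (4 * Q)) with hδ2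
  have hδ2p : 0 < δ2 := lt_min (by linarith) (by positivity)
  have hδ2b : δ2 ≤ η / (4 * Q) := min_le_right _ _
  rw [le_div_iff₀ (by positivity)] at hδ2b
  set ζ := min (min ε 1) (min (ε0 / 2) (η * δ2 / 4)) with hζ
  have hζp : 0 < ζ := lt_min (lt_min hε one_pos) (lt_min (by linarith) (by positivity))
  have hζ1 : ζ ≤ ε := (min_le_left _ _).trans (min_le_left _ _)
  have hζ2 : ζ ≤ 1 := (min_le_left _ _).trans (min_le_right _ _)
  have hζ3 : ζ ≤ ε0 / 2 := (min_le_right _ _).trans (min_le_left _ _)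
  have hζ4 : ζ ≤ η * δ2 / 4 := (min_le_right _ _).trans (min_le_right _ _)
  obtain ⟨δ, hδ, hclose⟩ := close_C0 hA hT S2 cu2 hb (t1 := t - 4 * τ) (T1 := t + τ) hτ1 (by linarith) hτ2 hζp
  refine ⟨δ, hδ, ?_⟩
  intro u1 p1 q1 v1 S1 cu1 hi
  have hc := hclose u1 p1 q1 v1 S1 cu1 hi
  have hu1 : ∀ θ ∈ Icc 0 Real.pi, ∀ s ∈ Icc (t - 4 * τ) (t + τ), |u1 θ s| ≤ U := by
    intro θ hθ s hs
    have a1 := abs_le.1 (hc θ hθ s hs)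
    have a2 := abs_le.1 (hu2 θ hθ s hs)
    rw [abs_le]; constructor <;> linarith [a1.1, a1.2, a2.1, a2.2]
  have hosc : ∀ x ∈ Icc 0 Real.pi, ∀ y ∈ Icc 0 Real.pi, ∀ s ∈ Icc (t - 4 * τ) (t + τ),
      u1 x s - u1 y s ≤ ε0 + G * |x - y| := by
    intro x hx y hy s hs
    have a1 := abs_le.1 (hc x hx s hs)
    have a2 := abs_le.1 (hc y hy s hs)
    have a3 := (le_abs_self _).trans (lip_of_deriv (fun θ hθ => S2.du θ hθ s (hsub hs)) (fun θ hθ => hp2 θ hθ s hs) hx hy)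
    linarith [a1.2, a2.1]
  have hp1 : ∀ θ ∈ Icc 0 Real.pi, ∀ s ∈ Icc (t - 3 * τ) (t - 3 * τ + 4 * τ), |p1 θ s| ≤ K := by
    intro θ hθ s hs
    have := hgrad b 0 T u1 p1 q1 v1 S1 (s - τ) (by linarith [hs.1]) (by linarith [hs.2])
      (fun θ hθ r hr => hu1 θ hθ r ⟨by linarith [hs.1, hr.1], by linarith [hs.2, hr.2]⟩)
      (fun x hx y hy r hr => hosc x hx y hy r ⟨by linarith [hs.1, hr.1], by linarith [hs.2, hr.2]⟩) θ hθ
    rw [sub_add_cancel] at this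
    exact this.trans (le_max_left _ _)
  have hI : Icc (t - 3 * τ) (t - 3 * τ + 4 * τ) ⊆ Icc (t - 4 * τ) (t + τ) :=
    Icc_subset_Icc (by linarith) (by linarith)
  have E1 := he b 0 T u1 p1 q1 v1 S1 (t - 3 * τ) (by linarith) (by linarith)
    (fun θ hθ s hs => hu1 θ hθ s (hI hs)) hp1
  have E2 := he b 0 T u2 p2 q2 v2 S2 (t - 3 * τ) (by linarith) (by linarith)
    (fun θ hθ s hs => (hu2 θ hθ s (hI hs)).trans (by linarith))
    (fun θ hθ s hs => (hp2 θ hθ s (hI hs)).trans (le_max_right _ _))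
  rw [sub_add_cancel] at E1 E2
  obtain ⟨Q1, E1⟩ := E1
  obtain ⟨Q2, E2⟩ := E2
  have htI : t ∈ Ioo 0 T := ⟨ht0, htT⟩
  have hcu : ∀ θ ∈ Icc 0 Real.pi, |u1 θ t - u2 θ t| ≤ ζ := fun θ hθ => hc θ hθ t ⟨by linarith, by linarith⟩
  have hcp : ∀ θ ∈ Icc 0 Real.pi, |p1 θ t - p2 θ t| ≤ η := by
    intro θ hθ
    have := interp (f := fun θ => u1 θ t - u2 θ t) (g := fun θ => p1 θ t - p2 θ t) (ε := η / 2) (δ := δ2) (η := ζ)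
      (fun θ hθ => (S1.du θ hθ t htI).sub (S2.du θ hθ t htI)) hδ2p (min_le_left _ _) hcu
      (fun x hx y hy hxy => by
        have a1 := lip_of_deriv (fun θ hθ => S1.dp θ hθ t htI) Q1 hx hy
        have a2 := lip_of_deriv (fun θ hθ => S2.dp θ hθ t htI) Q2 hx hy
        have a3 := mul_le_mul_of_nonneg_left hxy hQ.le
        have a4 := abs_sub (p1 x t - p1 y t) (p2 x t - p2 y t)
        rw [show p1 x t - p2 x t - (p1 y t - p2 y t) = p1 x t - p1 y t - (p2 x t - p2 y t) by ring]
        linarith) θ hθ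
    refine this.trans ?_
    have : 2 * ζ / δ2 ≤ η / 2 := by rw [div_le_iff₀ hδ2p]; linarith
    linarith
  have hcq : ∀ θ ∈ Icc 0 Real.pi, |q1 θ t - q2 θ t| ≤ ε := by
    intro θ hθ
    have := interp (f := fun θ => p1 θ t - p2 θ t) (g := fun θ => q1 θ t - q2 θ t) (ε := ε / 2) (δ := δ1) (η := η)
      (fun θ hθ => (S1.dp θ hθ t htI).sub (S2.dp θ hθ t htI)) hδ1p (min_le_right _ _) hcp
      (fun x hx y hy hxy => by
        have hxy' := hxy.trans (min_le_left _ _)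
        have a1 := E1 x hx y hy hxy'
        have a2 := E2 x hx y hy hxy'
        have a4 := abs_sub (q1 x t - q1 y t) (q2 x t - q2 y t)
        rw [show q1 x t - q2 x t - (q1 y t - q2 y t) = q1 x t - q1 y t - (q2 x t - q2 y t) by ring]
        linarith) θ hθ
    refine this.trans ?_
    have : 2 * η / δ1 ≤ ε / 2 := by rw [div_le_iff₀ hδ1p]; linarith
    linarith
  exact fun θ hθ => ⟨(hcu θ hθ).trans hζ1, (hcp θ hθ).trans hη1, hcq θ hθ⟩

set_option maxHeartbeats 1000000 in
theorem to_sol {A a T : ℝ} {ρ ρθ ρθθ ρt : ℝ → ℝ → ℝ}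
    (hρ_cont : ContinuousOn (fun p : ℝ × ℝ => ρ p.1 p.2) (Icc 0 Real.pi ×ˢ Ico 0 T))
    (hρpos : ∀ θ ∈ Icc 0 Real.pi, ∀ t ∈ Ico (0 : ℝ) T, 0 < ρ θ t)
    (hρθ : ∀ θ ∈ Icc 0 Real.pi, ∀ t ∈ Ioo (0 : ℝ) T,
      HasDerivWithinAt (fun φ => ρ φ t) (ρθ θ t) (Icc 0 Real.pi) θ)
    (hρθθ : ∀ θ ∈ Icc 0 Real.pi, ∀ t ∈ Ioo (0 : ℝ) T,
      HasDerivWithinAt (fun φ => ρθ φ t) (ρθθ θ t) (Icc 0 Real.pi) θ)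
    (hρt : ∀ θ ∈ Icc 0 Real.pi, ∀ t ∈ Ioo (0 : ℝ) T,
      HasDerivAt (fun τ => ρ θ τ) (ρt θ t) t)
    (hρθ_cont : ContinuousOn (fun p : ℝ × ℝ => ρθ p.1 p.2) (Icc 0 Real.pi ×ˢ Ioo 0 T))
    (hρθθ_cont : ContinuousOn (fun p : ℝ × ℝ => ρθθ p.1 p.2) (Icc 0 Real.pi ×ˢ Ioo 0 T))
    (hρt_cont : ContinuousOn (fun p : ℝ × ℝ => ρt p.1 p.2) (Icc 0 Real.pi ×ˢ Ioo 0 T))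
    (hbc : ∀ t ∈ Ico (0 : ℝ) T, ρ 0 t = a ∧ ρ Real.pi t = a)
    (hpde : ∀ θ ∈ Ioo 0 Real.pi, ∀ t ∈ Ioo (0 : ℝ) T,
      ρt θ t = ρθθ θ t / ((ρ θ t) ^ 2 + (ρθ θ t) ^ 2)
        - (2 * (ρθ θ t) ^ 2 + (ρ θ t) ^ 2) / (ρ θ t * ((ρθ θ t) ^ 2 + (ρ θ t) ^ 2))
        + (A / ρ θ t) * Real.sqrt ((ρθ θ t) ^ 2 + (ρ θ t) ^ 2)) :
    Sol A (Real.log a) 0 T (fun θ t => Real.log (ρ θ t)) (fun θ t => ρθ θ t / ρ θ t)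
      (fun θ t => ρθθ θ t / ρ θ t - (ρθ θ t / ρ θ t) ^ 2) (fun θ t => ρt θ t / ρ θ t) := by
  have hsub : Ioo 0 T ⊆ Ico 0 T := Ioo_subset_Ico_self
  have hc : ContinuousOn (fun p : ℝ × ℝ => ρ p.1 p.2) (Icc 0 Real.pi ×ˢ Ioo 0 T) :=
    hρ_cont.mono (prod_mono_right hsub)
  have hne : ∀ z ∈ Icc 0 Real.pi ×ˢ Ioo 0 T, ρ z.1 z.2 ≠ 0 := fun z hz => (hρpos z.1 hz.1 z.2 (hsub hz.2)).ne'
  have hne' : ∀ θ ∈ Icc 0 Real.pi, ∀ t ∈ Ioo 0 T, ρ θ t ≠ 0 := fun θ hθ t ht => (hρpos θ hθ t (hsub ht)).ne'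
  have c1 := hc.log hne
  have c2 := hρθ_cont.div hc hne
  have c3 := (hρθθ_cont.div hc hne).sub (c2.pow 2)
  have c4 := hρt_cont.div hc hne
  refine ⟨c1, c2, c3, c4, ?_, ?_, ?_, ?_, ?_, ?_⟩
  · intro θ hθ t ht
    exact (hρθ θ hθ t ht).log (hne' θ hθ t ht)
  · intro θ hθ t ht
    have := (hρθθ θ hθ t ht).div (hρθ θ hθ t ht) (hne' θ hθ t ht)
    refine this.congr_deriv ?_
    have := hne' θ hθ t ht
    field_simp
  · intro θ hθ t ht
    exact (hρt θ hθ t ht).log (hne' θ hθ t ht)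
  · intro t ht
    simp only [(hbc t (hsub ht)).1]
  · intro t ht
    simp only [(hbc t (hsub ht)).2]
  · intro θ hθ t ht
    have s1 := slice_cont (f := fun θ t => Real.log (ρ θ t)) c1 ht
    have s2 := slice_cont (f := fun θ t => ρθ θ t / ρ θ t) c2 ht
    have s3 := slice_cont (f := fun θ t => ρθθ θ t / ρ θ t - (ρθ θ t / ρ θ t) ^ 2) c3 ht
    have s4 := slice_cont (f := fun θ t => ρt θ t / ρ θ t) c4 ht
    have key : EqOn (fun θ => Real.exp (Real.log (ρ θ t)) ^ 2 * (ρt θ t / ρ θ t))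
        (fun θ => (ρθθ θ t / ρ θ t - (ρθ θ t / ρ θ t) ^ 2) / (1 + (ρθ θ t / ρ θ t) ^ 2) - 1
          + A * Real.exp (Real.log (ρ θ t)) * Real.sqrt (1 + (ρθ θ t / ρ θ t) ^ 2)) (Ioo 0 Real.pi) := by
      intro θ hθ
      have hp := hρpos θ (Ioo_subset_Icc_self hθ) t (hsub ht)
      simp only [Real.exp_log hp]
      rw [hpde θ hθ t ht]
      have e1 : Real.sqrt (ρθ θ t ^ 2 + ρ θ t ^ 2) = ρ θ t * Real.sqrt (1 + (ρθ θ t / ρ θ t) ^ 2) := by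
        rw [show ρθ θ t ^ 2 + ρ θ t ^ 2 = ρ θ t ^ 2 * (1 + (ρθ θ t / ρ θ t) ^ 2) by field_simp; ring,
          Real.sqrt_mul (by positivity), Real.sqrt_sq hp.le]
      rw [e1]
      generalize Real.sqrt (1 + (ρθ θ t / ρ θ t) ^ 2) = P
      generalize ρθ θ t = y
      generalize ρθθ θ t = z
      generalize ρ θ t = r at hp
      have h1 : r ^ 2 + y ^ 2 ≠ 0 := by positivity
      have h2 : y ^ 2 + r ^ 2 ≠ 0 := by positivity
      have e2 : 1 + (y / r) ^ 2 = (r ^ 2 + y ^ 2) / r ^ 2 := by field_simp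
      rw [e2, add_comm (y ^ 2) (r ^ 2)]
      field_simp
      ring
    have hpi := Real.pi_pos
    refine EqOn.of_subset_closure key (by fun_prop) ?_ Ioo_subset_Icc_self (by rw [closure_Ioo hpi.ne]) hθ
    refine ((s3.div (by fun_prop) (fun θ _ => by positivity)).sub continuousOn_const).add (by fun_prop)

theorem log_close {c x y δ : ℝ} (hc : 0 < c) (hy : c ≤ y) (h : |x - y| < min (c / 2) (c * δ / 2)) :
    |Real.log x - Real.log y| < δ := by
  have h1 := h.trans_le (min_le_left _ _)
  have h2 := h.trans_le (min_le_right _ _)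
  have hx : c / 2 < x := by have := abs_lt.1 h1; linarith [this.1]
  have hx0 : 0 < x := by linarith
  have hy0 : 0 < y := by linarith
  have key : ∀ a b : ℝ, 0 < a → 0 < b → c / 2 ≤ b → |a - b| < c * δ / 2 → Real.log a - Real.log b < δ := by
    intro a b ha hb hcb hab
    rw [← Real.log_div ha.ne' hb.ne']
    have := Real.log_le_sub_one_of_pos (div_pos ha hb)
    refine this.trans_lt ?_
    have hδ : 0 < δ := by
      by_contra hn
      have : c * δ ≤ 0 := mul_nonpos_of_nonneg_of_nonpos hc.le (not_lt.1 hn)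
      linarith [abs_nonneg (a - b)]
    rw [show a / b - 1 = (a - b) / b by field_simp, div_lt_iff₀ hb]
    have := le_abs_self (a - b)
    have := mul_le_mul_of_nonneg_left hcb hδ.le
    linarith
  rw [abs_lt]
  constructor
  · have := key y x hy0 hx0 hx.le (by rw [abs_sub_comm]; exact h2)
    linarith
  · exact key x y hx0 hy0 (by linarith) h2

/-- (Lemma 3.5: continuous dependence on the initial curve.)
If `ρ` and `ρₙ` are positive solutions of the polar flow equation with the same fixed
boundary value `a`, `ρ` is bounded below by `c > 0`, and `ρₙ(·,0) → ρ(·,0)` in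
`C¹([0,π])`, then `ρₙ(·,t) → ρ(·,t)` in `C²([0,π])` for every `t ∈ (0,T)`. -/
theorem continuous_dependence_polar (A a T c : ℝ) (hA : 0 < A) (ha : 0 < a)
    (hT : 0 < T) (hc : 0 < c)
    (ρ ρθ ρθθ ρt : ℝ → ℝ → ℝ)
    (ρn ρnθ ρnθθ ρnt : ℕ → ℝ → ℝ → ℝ)
    -- regularity and positivity of ρ
    (hρ_cont : ContinuousOn (fun p : ℝ × ℝ => ρ p.1 p.2) (Icc 0 Real.pi ×ˢ Ico 0 T))
    (hρpos : ∀ θ ∈ Icc 0 Real.pi, ∀ t ∈ Ico (0 : ℝ) T, 0 < ρ θ t)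
    (hρθ : ∀ θ ∈ Icc 0 Real.pi, ∀ t ∈ Ioo (0 : ℝ) T,
      HasDerivWithinAt (fun φ => ρ φ t) (ρθ θ t) (Icc 0 Real.pi) θ)
    (hρθθ : ∀ θ ∈ Icc 0 Real.pi, ∀ t ∈ Ioo (0 : ℝ) T,
      HasDerivWithinAt (fun φ => ρθ φ t) (ρθθ θ t) (Icc 0 Real.pi) θ)
    (hρt : ∀ θ ∈ Icc 0 Real.pi, ∀ t ∈ Ioo (0 : ℝ) T,
      HasDerivAt (fun τ => ρ θ τ) (ρt θ t) t)
    (hρθ_cont : ContinuousOn (fun p : ℝ × ℝ => ρθ p.1 p.2) (Icc 0 Real.pi ×ˢ Ioo 0 T))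
    (hρθθ_cont : ContinuousOn (fun p : ℝ × ℝ => ρθθ p.1 p.2) (Icc 0 Real.pi ×ˢ Ioo 0 T))
    (hρt_cont : ContinuousOn (fun p : ℝ × ℝ => ρt p.1 p.2) (Icc 0 Real.pi ×ˢ Ioo 0 T))
    (hbc : ∀ t ∈ Ico (0 : ℝ) T, ρ 0 t = a ∧ ρ Real.pi t = a)
    (hpde : ∀ θ ∈ Ioo 0 Real.pi, ∀ t ∈ Ioo (0 : ℝ) T,
      ρt θ t = ρθθ θ t / ((ρ θ t) ^ 2 + (ρθ θ t) ^ 2)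
        - (2 * (ρθ θ t) ^ 2 + (ρ θ t) ^ 2) / (ρ θ t * ((ρθ θ t) ^ 2 + (ρ θ t) ^ 2))
        + (A / ρ θ t) * Real.sqrt ((ρθ θ t) ^ 2 + (ρ θ t) ^ 2))
    -- lower bound for ρ
    (hρc : ∀ θ ∈ Icc 0 Real.pi, ∀ t ∈ Ico (0 : ℝ) T, c ≤ ρ θ t)
    -- regularity and positivity of each ρₙ
    (hρn_cont : ∀ n : ℕ,
      ContinuousOn (fun p : ℝ × ℝ => ρn n p.1 p.2) (Icc 0 Real.pi ×ˢ Ico 0 T))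
    (hρnpos : ∀ n : ℕ, ∀ θ ∈ Icc 0 Real.pi, ∀ t ∈ Ico (0 : ℝ) T, 0 < ρn n θ t)
    (hρnθ : ∀ n : ℕ, ∀ θ ∈ Icc 0 Real.pi, ∀ t ∈ Ioo (0 : ℝ) T,
      HasDerivWithinAt (fun φ => ρn n φ t) (ρnθ n θ t) (Icc 0 Real.pi) θ)
    (hρnθθ : ∀ n : ℕ, ∀ θ ∈ Icc 0 Real.pi, ∀ t ∈ Ioo (0 : ℝ) T,
      HasDerivWithinAt (fun φ => ρnθ n φ t) (ρnθθ n θ t) (Icc 0 Real.pi) θ)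
    (hρnt : ∀ n : ℕ, ∀ θ ∈ Icc 0 Real.pi, ∀ t ∈ Ioo (0 : ℝ) T,
      HasDerivAt (fun τ => ρn n θ τ) (ρnt n θ t) t)
    (hρnθ_cont : ∀ n : ℕ,
      ContinuousOn (fun p : ℝ × ℝ => ρnθ n p.1 p.2) (Icc 0 Real.pi ×ˢ Ioo 0 T))
    (hρnθθ_cont : ∀ n : ℕ,
      ContinuousOn (fun p : ℝ × ℝ => ρnθθ n p.1 p.2) (Icc 0 Real.pi ×ˢ Ioo 0 T))
    (hρnt_cont : ∀ n : ℕ,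
      ContinuousOn (fun p : ℝ × ℝ => ρnt n p.1 p.2) (Icc 0 Real.pi ×ˢ Ioo 0 T))
    (hnbc : ∀ n : ℕ, ∀ t ∈ Ico (0 : ℝ) T, ρn n 0 t = a ∧ ρn n Real.pi t = a)
    (hnpde : ∀ n : ℕ, ∀ θ ∈ Ioo 0 Real.pi, ∀ t ∈ Ioo (0 : ℝ) T,
      ρnt n θ t = ρnθθ n θ t / ((ρn n θ t) ^ 2 + (ρnθ n θ t) ^ 2)
        - (2 * (ρnθ n θ t) ^ 2 + (ρn n θ t) ^ 2)
            / (ρn n θ t * ((ρnθ n θ t) ^ 2 + (ρn n θ t) ^ 2))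
        + (A / ρn n θ t) * Real.sqrt ((ρnθ n θ t) ^ 2 + (ρn n θ t) ^ 2))
    -- C¹ convergence of the initial data
    (hinit : ∀ ε : ℝ, 0 < ε → ∃ N : ℕ, ∀ n : ℕ, N ≤ n → ∀ θ ∈ Icc 0 Real.pi,
      |ρn n θ 0 - ρ θ 0|
        + |derivWithin (fun φ => ρn n φ 0) (Icc 0 Real.pi) θ
            - derivWithin (fun φ => ρ φ 0) (Icc 0 Real.pi) θ| < ε) :
    -- C² convergence at each positive time
    ∀ t ∈ Ioo (0 : ℝ) T, ∀ ε : ℝ, 0 < ε → ∃ N : ℕ, ∀ n : ℕ, N ≤ n →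
      ∀ θ ∈ Icc 0 Real.pi,
        |ρn n θ t - ρ θ t| + |ρnθ n θ t - ρθ θ t| + |ρnθθ n θ t - ρθθ θ t| < ε := by
  have hpi := Real.pi_pos
  intro t ht ε hε
  have S2 := to_sol hρ_cont hρpos hρθ hρθθ hρt hρθ_cont hρθθ_cont hρt_cont hbc hpde
  have cu2 : ContinuousOn (fun z : ℝ × ℝ => Real.log (ρ z.1 z.2)) (Icc 0 Real.pi ×ˢ Ico 0 T) :=
    hρ_cont.log (fun z hz => (hρpos z.1 hz.1 z.2 hz.2).ne')
  have hb : Real.log (ρ 0 0) = Real.log a := by rw [(hbc 0 ⟨le_rfl, hT⟩).1]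
  have hsub : Icc t t ⊆ Ioo 0 T := fun s hs => ⟨ht.1.trans_le hs.1, hs.2.trans_lt ht.2⟩
  obtain ⟨U, hU, hu⟩ := joint_bdd (f := fun θ t => Real.log (ρ θ t)) S2.cu hsub
  obtain ⟨K, hK, hp⟩ := joint_bdd (f := fun θ t => ρθ θ t / ρ θ t) S2.cp hsub
  obtain ⟨Q, hQ, hq⟩ := joint_bdd (f := fun θ t => ρθθ θ t / ρ θ t - (ρθ θ t / ρ θ t) ^ 2) S2.cq hsub
  set B := U + K + Q + 1 with hB
  have hε3 : 0 < ε / 3 := by linarith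
  obtain ⟨d1, hd1, f1⟩ := unif3 (F := fun z => Real.exp z.1) (by fun_prop) B hε3
  obtain ⟨d2, hd2, f2⟩ := unif3 (F := fun z => Real.exp z.1 * z.2.1) (by fun_prop) B hε3
  obtain ⟨d3, hd3, f3⟩ := unif3 (F := fun z => Real.exp z.1 * (z.2.2 + z.2.1 ^ 2)) (by fun_prop) B hε3
  set d := min (min d1 d2) (min d3 1) / 2 with hd
  have hdp : 0 < min (min d1 d2) (min d3 1) := lt_min (lt_min hd1 hd2) (lt_min hd3 one_pos)
  have g1 : d < d1 := by
    have := (min_le_left (min d1 d2) (min d3 1)).trans (min_le_left _ _); linarith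
  have g2 : d < d2 := by
    have := (min_le_left (min d1 d2) (min d3 1)).trans (min_le_right _ _); linarith
  have g3 : d < d3 := by
    have := (min_le_right (min d1 d2) (min d3 1)).trans (min_le_left _ _); linarith
  have g4 : d < 1 := by
    have := (min_le_right (min d1 d2) (min d3 1)).trans (min_le_right _ _); linarith
  have hd0 : 0 < d := by linarith
  obtain ⟨δ, hδ, hmain⟩ := sol_C2 hA hT S2 cu2 hb ht hd0
  obtain ⟨N, hN⟩ := hinit (min (c / 2) (c * δ / 2)) (lt_min (by linarith) (by positivity))
  refine ⟨N, ?_⟩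
  intro n hn θ hθ
  have S1 := to_sol (hρn_cont n) (hρnpos n) (hρnθ n) (hρnθθ n) (hρnt n) (hρnθ_cont n) (hρnθθ_cont n)
    (hρnt_cont n) (hnbc n) (hnpde n)
  have cu1 : ContinuousOn (fun z : ℝ × ℝ => Real.log (ρn n z.1 z.2)) (Icc 0 Real.pi ×ˢ Ico 0 T) :=
    (hρn_cont n).log (fun z hz => (hρnpos n z.1 hz.1 z.2 hz.2).ne')
  obtain ⟨m1, m2, m3⟩ := hmain _ _ _ _ S1 cu1 (fun φ hφ => by
    refine log_close hc (hρc φ hφ 0 ⟨le_rfl, hT⟩) ?_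
    exact (le_add_of_nonneg_right (abs_nonneg _)).trans_lt (hN n hn φ hφ)) θ hθ
  have htI : t ∈ Ico 0 T := Ioo_subset_Ico_self ht
  have r1 := hρnpos n θ hθ t htI
  have r2 := hρpos θ hθ t htI
  have b1 := hu θ hθ t ⟨le_rfl, le_rfl⟩
  have b2 := hp θ hθ t ⟨le_rfl, le_rfl⟩
  have b3 := hq θ hθ t ⟨le_rfl, le_rfl⟩
  have tri : ∀ x y : ℝ, |x - y| ≤ d → |x| ≤ |y| + 1 := by
    intro x y hxy
    have := abs_sub_abs_le_abs_sub x y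
    linarith
  have a1 := tri _ _ m1
  have a2 := tri _ _ m2
  have a3 := tri _ _ m3
  have w1 := f1 _ _ _ _ _ _ (by linarith) (by linarith) (by linarith) (by linarith) (by linarith)
    (by linarith) (m1.trans_lt g1) (m2.trans_lt g1) (m3.trans_lt g1)
  have w2 := f2 _ _ _ _ _ _ (by linarith) (by linarith) (by linarith) (by linarith) (by linarith)
    (by linarith) (m1.trans_lt g2) (m2.trans_lt g2) (m3.trans_lt g2)
  have w3 := f3 _ _ _ _ _ _ (by linarith) (by linarith) (by linarith) (by linarith) (by linarith)
    (by linarith) (m1.trans_lt g3) (m2.trans_lt g3) (m3.trans_lt g3)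
  simp only [Real.exp_log r1, Real.exp_log r2, sub_add_cancel] at w1 w2 w3
  have e1 : ∀ r x : ℝ, 0 < r → r * (x / r) = x := fun r x hr => by field_simp
  rw [e1 _ _ r1, e1 _ _ r2] at w2 w3
  linarith
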